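/- (Littlewood–Paley theorem on mixed Lebesgue spaces over the torus) Let 1 < r, r̃ < ∞ and let (P_N)_{N ∈ 2^ℕ} be the smooth Littlewood–Paley projectors on 𝕋^{d−k} × 𝕋^k defined via a smooth radial cutoff. Then there is C > 1 such that for all f ∈ L^r_x L^{r̃}_y(𝕋^{d−k} × 𝕋^k), C^{−1} ‖f‖_{L^r_x L^{r̃}_y} ≤ ‖ ( ∑_{N ∈ 2^ℕ} |P_N f|² )^{1/2} ‖_{L^r_x L^{r̃}_y} ≤ C ‖f‖_{L^r_x L^{r̃}_y}. -/

import Mathlib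

open MeasureTheory Complex Finset
open scoped ENNReal Real ComplexConjugate

noncomputable section

/-- Mixed-norm building block: the `L^p` "norm" (`p ∈ [1,∞]`) of an
`ℝ≥0∞`-valued function, with the convention `essSup` for `p = ∞`. -/
def eNorm {α : Type*} [MeasurableSpace α] (p : ℝ≥0∞) (μ : Measure α) (g : α → ℝ≥0∞) : ℝ≥0∞ :=
  if p = ∞ then essSup g μ else (∫⁻ a, g a ^ p.toReal ∂μ) ^ (1 / p.toReal)

/-- The `m`-dimensional torus `𝕋^m = (ℝ/ℤ)^m`. -/
abbrev Torus (m : ℕ) := Fin m → AddCircle (1 : ℝ)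

/-- The character `z ↦ e^{2πi z·ξ}` on `𝕋^m`. -/
def eChar {m : ℕ} (ξ : Fin m → ℤ) (z : Torus m) : ℂ := ∏ i, fourier (ξ i) (z i)

/-- Fourier coefficient of a function on the product torus `𝕋^m × 𝕋^k`. -/
def fcoef {m k : ℕ} (f : Torus m × Torus k → ℂ) (ξ : (Fin m → ℤ) × (Fin k → ℤ)) : ℂ :=
  ∫ z : Torus m × Torus k, f z * conj (eChar ξ.1 z.1 * eChar ξ.2 z.2)

/-- The frequency box `ℤ^m ∩ [-N,N]^m`. -/
def box (m N : ℕ) : Finset (Fin m → ℤ) :=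
  Finset.Icc (fun _ => -(N : ℤ)) (fun _ => (N : ℤ))

/-- The mixed norm `‖f‖_{L^r_x L^s_y}` on `𝕋^m × 𝕋^k`, valued in `ℝ≥0∞`. -/
def mixedNorm {m k : ℕ} (r s : ℝ≥0∞) (f : Torus m × Torus k → ℂ) : ℝ≥0∞ :=
  eNorm r volume (fun x => eNorm s volume (fun y => (‖f (x, y)‖₊ : ℝ≥0∞)))

/-- The frequency-truncated Schrödinger propagator `e^{-itΔ}P_{≤N} f` on `𝕋^m × 𝕋^k`,
given on the Fourier side by multiplication with `e^{2πit|ξ|²} 𝟙_{[-N,N]^d}(ξ)`. -/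
def prp {m k : ℕ} (N : ℕ) (t : ℝ) (f : Torus m × Torus k → ℂ)
    (z : Torus m × Torus k) : ℂ :=
  ∑ ξ₁ ∈ box m N, ∑ ξ₂ ∈ box k N,
    fcoef f (ξ₁, ξ₂) *
      Complex.exp (2 * Real.pi * I * t * ((∑ i, (ξ₁ i : ℝ) ^ 2) + ∑ i, (ξ₂ i : ℝ) ^ 2)) *
      (eChar ξ₁ z.1 * eChar ξ₂ z.2)

/-- Euclidean length of a point of `ℝ^m × ℝ^k`. -/
def eLen {m k : ℕ} (v : (Fin m → ℝ) × (Fin k → ℝ)) : ℝ :=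
  Real.sqrt ((∑ i, v.1 i ^ 2) + ∑ i, v.2 i ^ 2)

/-- Coercion of a lattice point of `ℤ^m × ℤ^k` into `ℝ^m × ℝ^k`. -/
def latCoe {m k : ℕ} (ξ : (Fin m → ℤ) × (Fin k → ℤ)) : (Fin m → ℝ) × (Fin k → ℝ) :=
  (fun i => (ξ.1 i : ℝ), fun i => (ξ.2 i : ℝ))

/-- `φ` is an admissible smooth Littlewood–Paley cutoff: smooth, even, `[0,1]`-valued,
equal to `1` on the (Euclidean) unit ball and vanishing outside the ball of radius 2. -/
structure IsLPCutoff {m k : ℕ} (φ : (Fin m → ℝ) × (Fin k → ℝ) → ℝ) : Prop where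
  smooth : ContDiff ℝ (⊤ : ℕ∞) φ
  even : ∀ v, φ (-v) = φ v
  mem_Icc : ∀ v, φ v ∈ Set.Icc (0 : ℝ) 1
  eq_one : ∀ v, eLen v ≤ 1 → φ v = 1
  eq_zero : ∀ v, 2 ≤ eLen v → φ v = 0

/-- The dyadic symbol `ψ_N` with `N = 2^j`: `ψ_{2^0} = φ` and
`ψ_{2^j}(ξ) = φ(ξ/2^j) - φ(ξ/2^{j-1})` for `j ≥ 1`, evaluated at lattice points. -/
def psiCut {m k : ℕ} (φ : (Fin m → ℝ) × (Fin k → ℝ) → ℝ) (j : ℕ)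
    (ξ : (Fin m → ℤ) × (Fin k → ℤ)) : ℝ :=
  if j = 0 then φ (latCoe ξ)
  else φ (((2 : ℝ) ^ j)⁻¹ • latCoe ξ) - φ (((2 : ℝ) ^ (j - 1))⁻¹ • latCoe ξ)

/-- The Littlewood–Paley projector `P_{2^j}` on `𝕋^m × 𝕋^k` built from `φ`. -/
def lpProj {m k : ℕ} (φ : (Fin m → ℝ) × (Fin k → ℝ) → ℝ) (j : ℕ)
    (f : Torus m × Torus k → ℂ) (z : Torus m × Torus k) : ℂ :=
  ∑' ξ : (Fin m → ℤ) × (Fin k → ℤ),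
    (psiCut φ j ξ : ℂ) * fcoef f ξ * (eChar ξ.1 z.1 * eChar ξ.2 z.2)


set_option linter.unusedSectionVars false
set_option linter.unusedVariables false

/-- Pointwise layer cake. -/
lemma layer_pt (t : ℝ≥0∞) {p : ℝ} (hp : 0 < p) :
    t ^ p = ∫⁻ l in Set.Ioi (0:ℝ), (if ENNReal.ofReal l < t then 1 else 0) *
      ENNReal.ofReal (p * l ^ (p - 1)) := by
  have key : ∀ a : ℝ, 0 ≤ a → (ENNReal.ofReal a) ^ p =
      ∫⁻ l in Set.Ioi (0:ℝ), (if l < a then 1 else 0) *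
      ENNReal.ofReal (p * l ^ (p - 1)) := by
    intro a ha
    have := lintegral_rpow_eq_lintegral_meas_lt_mul (Measure.dirac (0:ℝ)) (f := fun _ => a)
      (Filter.Eventually.of_forall fun _ => ha) aemeasurable_const hp
    rw [lintegral_const, measure_univ, mul_one, ← ENNReal.ofReal_rpow_of_nonneg ha hp.le] at this
    rw [this, ← lintegral_const_mul']
    · refine lintegral_congr fun l => ?_
      rw [ENNReal.ofReal_mul hp.le]
      by_cases h : l < a
      · simp [h]
      · simp [h]
    · exact ENNReal.ofReal_ne_top
  rcases eq_or_ne t ∞ with rfl | ht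
  · rw [ENNReal.top_rpow_of_pos hp]
    symm
    refine ENNReal.eq_top_of_forall_nnreal_le fun r => le_of_lt ?_
    have h1 := key ((r + 1 : ℝ) ^ (1/p)) (by positivity)
    rw [ENNReal.ofReal_rpow_of_nonneg (by positivity) hp.le, ← Real.rpow_mul (by positivity),
      one_div_mul_cancel hp.ne', Real.rpow_one] at h1
    calc (r : ℝ≥0∞) < ENNReal.ofReal (r + 1 : ℝ) := by
          rw [← ENNReal.ofReal_coe_nnreal]
          exact (ENNReal.ofReal_lt_ofReal_iff (by positivity)).2 (by linarith)
      _ ≤ _ := by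
          rw [h1]
          refine lintegral_mono fun l => ?_
          dsimp only
          gcongr
          simp only [ENNReal.ofReal_lt_top, if_true]
          split_ifs <;> simp
  · have := key t.toReal ENNReal.toReal_nonneg
    rw [ENNReal.ofReal_toReal ht] at this
    rw [this]
    refine setLIntegral_congr_fun measurableSet_Ioi fun l hl => ?_
    have : (l < t.toReal) ↔ ENNReal.ofReal l < t :=
      (ENNReal.ofReal_lt_iff_lt_toReal (le_of_lt hl) ht).symm
    simp [this]

lemma layer_meas {α : Type*} [MeasurableSpace α] {g : α → ℝ≥0∞} (hg : Measurable g) :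
    Measurable (fun z : α × ℝ => (if ENNReal.ofReal z.2 < g z.1 then (1:ℝ≥0∞) else 0)) := by
  refine Measurable.ite ?_ measurable_const measurable_const
  exact measurableSet_lt (by fun_prop) (by fun_prop)

/-- Layer cake for `ℝ≥0∞`-valued functions. -/
lemma layer_cake {α : Type*} [MeasurableSpace α] (μ : Measure α) [SFinite μ] {g : α → ℝ≥0∞}
    (hg : Measurable g) {p : ℝ} (hp : 0 < p) :
    ∫⁻ x, g x ^ p ∂μ = ∫⁻ l in Set.Ioi (0:ℝ), μ {x | ENNReal.ofReal l < g x} *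
      ENNReal.ofReal (p * l ^ (p - 1)) := by
  simp_rw [layer_pt _ hp]
  rw [lintegral_lintegral_swap]
  · refine lintegral_congr fun l => ?_
    rw [lintegral_mul_const]
    · congr 1
      have : (fun x => if ENNReal.ofReal l < g x then (1:ℝ≥0∞) else 0) =
          Set.indicator {x | ENNReal.ofReal l < g x} 1 := by
        ext x; simp [Set.indicator_apply]
      rw [this, lintegral_indicator_one]
      exact measurableSet_lt measurable_const hg
    · exact Measurable.ite (measurableSet_lt measurable_const hg) measurable_const measurable_const
  · refine Measurable.aemeasurable ?_
    have := layer_meas hg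
    exact this.mul (by fun_prop)

/-- Weighted Jensen inequality. -/
lemma jensen_w {α : Type*} [MeasurableSpace α] (μ : Measure α) {w g : α → ℝ≥0∞}
    (hw : AEMeasurable w μ) (hg : AEMeasurable g μ) {s : ℝ} (hs : 1 < s) :
    (∫⁻ x, w x * g x ∂μ) ^ s ≤ (∫⁻ x, w x ∂μ) ^ (s - 1) * ∫⁻ x, w x * g x ^ s ∂μ := by
  have hs0 : 0 < s := by linarith
  obtain ⟨q, hq⟩ : ∃ q, q = s / (s - 1) := ⟨_, rfl⟩
  have hpq : q.HolderConjugate s := by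
    rw [hq]; exact (Real.HolderConjugate.conjExponent hs).symm
  have h := ENNReal.lintegral_mul_le_Lp_mul_Lq μ hpq (f := fun x => w x ^ (1/q))
    (g := fun x => w x ^ (1/s) * g x) (by fun_prop) (by fun_prop)
  have hq0 : 0 < q := hpq.pos
  have e1 : ∀ x, ((fun x => w x ^ (1/q)) * (fun x => w x ^ (1/s) * g x)) x = w x * g x := by
    intro x
    simp only [Pi.mul_apply]
    rw [← mul_assoc, ← ENNReal.rpow_add_of_nonneg _ _ (by positivity) (by positivity)]
    have : 1/q + 1/s = 1 := by simpa [one_div] using hpq.inv_add_inv_eq_one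
    rw [this, ENNReal.rpow_one]
  simp_rw [e1] at h
  have e2 : ∀ x, (w x ^ (1/q)) ^ q = w x := by
    intro x; rw [← ENNReal.rpow_mul, one_div_mul_cancel hq0.ne', ENNReal.rpow_one]
  have e3 : ∀ x, (w x ^ (1/s) * g x) ^ s = w x * g x ^ s := by
    intro x; rw [ENNReal.mul_rpow_of_nonneg _ _ hs0.le, ← ENNReal.rpow_mul,
      one_div_mul_cancel hs0.ne', ENNReal.rpow_one]
  simp_rw [e2, e3] at h
  calc _ ≤ _ := ENNReal.rpow_le_rpow h hs0.le
    _ = _ := by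
      rw [ENNReal.mul_rpow_of_nonneg _ _ hs0.le, ← ENNReal.rpow_mul, ← ENNReal.rpow_mul,
        one_div_mul_cancel hs0.ne', ENNReal.rpow_one]
      congr 2
      rw [hq]; field_simp

/-- Structural facts about the homogeneous space `X`. -/
structure HomSp (X : Type*) [NormedAddCommGroup X] [MeasureSpace X] (n : ℕ) (D : ℝ≥0∞) :
    Prop where
  one_le : 1 ≤ D
  ne_top : D ≠ ∞
  pos : ∀ (x : X) (ρ : ℝ), 0 < ρ → volume (Metric.ball x ρ) ≠ 0
  dbl : ∀ (x y : X) (ρ : ℝ), 0 < ρ → volume (Metric.ball x (7 * ρ)) ≤ D * volume (Metric.ball y ρ)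
  bdd : ∀ x : X, ‖x‖ < 1
  upper : ∀ (x : X) (ρ : ℝ), 0 < ρ → volume (Metric.ball x ρ) ≤ D * ENNReal.ofReal (ρ ^ n)

/-- Uncentred maximal function. -/
def Mx {X : Type*} [NormedAddCommGroup X] [MeasureSpace X] (g : X → ℝ≥0∞) (x : X) : ℝ≥0∞ :=
  ⨆ (c : X) (ρ : ℝ) (_ : 0 < ρ) (_ : x ∈ Metric.ball c ρ),
    (∫⁻ u in Metric.ball c ρ, g u) / volume (Metric.ball c ρ)

section MaxFn
variable {X : Type*} [NormedAddCommGroup X] [MeasureSpace X] [BorelSpace X]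
  [SecondCountableTopology X] [IsProbabilityMeasure (volume : Measure X)]
  {n : ℕ} {D : ℝ≥0∞}

lemma HomSp.le_Mx (hX : HomSp X n D) (g : X → ℝ≥0∞) {c x : X} {ρ : ℝ} (hρ : 0 < ρ)
    (hx : x ∈ Metric.ball c ρ) :
    ∫⁻ u in Metric.ball c ρ, g u ≤ Mx g x * volume (Metric.ball c ρ) := by
  rw [← ENNReal.div_le_iff (hX.pos c ρ hρ) (measure_ne_top _ _)]
  unfold Mx
  exact le_iSup_of_le c (le_iSup_of_le ρ (le_iSup_of_le hρ (le_iSup_of_le hx le_rfl)))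

lemma HomSp.ball_univ (hX : HomSp X n D) (c : X) {ρ : ℝ} (hρ : 2 ≤ ρ) :
    Metric.ball c ρ = Set.univ := by
  ext x
  simp only [Metric.mem_ball, Set.mem_univ, iff_true]
  have := hX.bdd x
  have := hX.bdd c
  have := norm_sub_le x c
  rw [dist_eq_norm]; linarith

lemma HomSp.lt_Mx (hX : HomSp X n D) (g : X → ℝ≥0∞) {x : X} {l : ℝ≥0∞} (h : l < Mx g x) :
    ∃ c ρ, 0 < ρ ∧ ρ ≤ 2 ∧ x ∈ Metric.ball c ρ ∧
      l * volume (Metric.ball c ρ) < ∫⁻ u in Metric.ball c ρ, g u := by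
  unfold Mx at h
  simp only [lt_iSup_iff] at h
  obtain ⟨c, ρ, hρ, hx, h⟩ := h
  rw [ENNReal.lt_div_iff_mul_lt (Or.inl (hX.pos c ρ hρ)) (Or.inl (measure_ne_top _ _))] at h
  rcases le_total ρ 2 with h2 | h2
  · exact ⟨c, ρ, hρ, h2, hx, h⟩
  · refine ⟨c, 2, by norm_num, le_rfl, ?_, ?_⟩
    · rw [hX.ball_univ c le_rfl]; trivial
    · rw [hX.ball_univ c le_rfl]; rwa [hX.ball_univ c h2] at h

lemma Mx_open (g : X → ℝ≥0∞) (l : ℝ≥0∞) : IsOpen {x | l < Mx g x} := by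
  have : {x | l < Mx g x} = ⋃ (c : X) (ρ : ℝ) (_ : 0 < ρ)
      (_ : l < (∫⁻ u in Metric.ball c ρ, g u) / volume (Metric.ball c ρ)), Metric.ball c ρ := by
    ext x
    simp only [Set.mem_ofPred_eq, Mx, lt_iSup_iff, Set.mem_iUnion]
    constructor
    · rintro ⟨c, ρ, h, h1, h2⟩; exact ⟨c, ρ, h, h2, h1⟩
    · rintro ⟨c, ρ, h, h1, h2⟩; exact ⟨c, ρ, h, h2, h1⟩
  rw [this]
  exact isOpen_iUnion fun _ => isOpen_iUnion fun _ => isOpen_iUnion fun _ => isOpen_iUnion fun _ =>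
    Metric.isOpen_ball

lemma Mx_meas (g : X → ℝ≥0∞) : Measurable (Mx g) :=
  measurable_of_Ioi fun l => (Mx_open g l).measurableSet

/-- Vitali covering in the form used below. -/
lemma vitali_use (hX : HomSp X n D) (t : Set X) (c : X → X) (ρ : X → ℝ)
    (hρ : ∀ x ∈ t, 0 < ρ x ∧ ρ x ≤ 2 ∧ x ∈ Metric.ball (c x) (ρ x)) :
    ∃ u : Set X, u ⊆ t ∧ u.Countable ∧ (u.PairwiseDisjoint fun a => Metric.ball (c a) (ρ a)) ∧
      t ⊆ ⋃ b ∈ u, Metric.ball (c b) (5 * ρ b) := by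
  obtain ⟨u, hu, hd, hc⟩ := Vitali.exists_disjoint_subfamily_covering_enlargement_closedBall t c ρ 2
    (fun a ha => (hρ a ha).2.1) 4 (by norm_num)
  have hd' : u.PairwiseDisjoint fun a => Metric.ball (c a) (ρ a) :=
    hd.mono fun a => Metric.ball_subset_closedBall
  refine ⟨u, hu, ?_, hd', ?_⟩
  · exact hd'.countable_of_isOpen (fun _ _ => Metric.isOpen_ball)
      (fun a ha => ⟨a, (hρ a (hu ha)).2.2⟩)
  · intro x hx
    obtain ⟨b, hb, hs⟩ := hc x hx
    simp only [Set.mem_iUnion]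
    refine ⟨b, hb, ?_⟩
    have h1 := hs (Metric.ball_subset_closedBall (hρ x hx).2.2)
    exact Metric.closedBall_subset_ball (by have := (hρ b (hu hb)).1; linarith) h1

/-- Weak type (1,1). -/
lemma weak_type (hX : HomSp X n D) (g : X → ℝ≥0∞) (l : ℝ≥0∞) :
    l * volume {x | l < Mx g x} ≤ D * ∫⁻ u, g u := by
  classical
  have h0 : ∀ x : X, ∃ (c : X) (ρ : ℝ), x ∈ {x | l < Mx g x} → (0 < ρ ∧ ρ ≤ 2 ∧ x ∈ Metric.ball c ρ ∧
      l * volume (Metric.ball c ρ) < ∫⁻ u in Metric.ball c ρ, g u) := by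
    intro x
    by_cases hx : l < Mx g x
    · obtain ⟨c, ρ, h⟩ := hX.lt_Mx g hx; exact ⟨c, ρ, fun _ => h⟩
    · exact ⟨0, 0, fun h => absurd h hx⟩
  choose c ρ h using h0
  obtain ⟨u, hu, hcount, hd, hcov⟩ := vitali_use hX {x | l < Mx g x} c ρ
    (fun x hx => ⟨(h x hx).1, (h x hx).2.1, (h x hx).2.2.1⟩)
  calc l * volume {x | l < Mx g x} ≤ l * ∑' b : u, volume (Metric.ball (c b) (5 * ρ b)) := by
        gcongr
        exact (measure_mono hcov).trans (measure_biUnion_le _ hcount _)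
    _ ≤ l * ∑' b : u, D * volume (Metric.ball (c b) (ρ b)) := by
        gcongr with b
        refine (measure_mono (Metric.ball_subset_ball ?_)).trans (hX.dbl _ _ _ (h b (hu b.2)).1)
        have := (h b (hu b.2)).1; linarith
    _ = D * ∑' b : u, l * volume (Metric.ball (c b) (ρ b)) := by
        rw [ENNReal.tsum_mul_left, ENNReal.tsum_mul_left]; ring
    _ ≤ D * ∑' b : u, ∫⁻ v in Metric.ball (c b) (ρ b), g v := by
        gcongr with b
        exact (h b (hu b.2)).2.2.2.le
    _ = D * ∫⁻ v in ⋃ b ∈ u, Metric.ball (c b) (ρ b), g v := by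
        rw [lintegral_biUnion hcount (fun _ _ => Metric.isOpen_ball.measurableSet) hd]
    _ ≤ D * ∫⁻ u, g u := by exact mul_le_mul_right (setLIntegral_le_lintegral _ _) _

lemma Mx_mono {g g' : X → ℝ≥0∞} (h : ∀ x, g x ≤ g' x) (x : X) : Mx g x ≤ Mx g' x := by
  unfold Mx
  gcongr with c ρ _ _ u
  exact h u

lemma Mx_const_add (hX : HomSp X n D) (g : X → ℝ≥0∞) (a : ℝ≥0∞) (x : X) :
    Mx (fun u => g u + a) x ≤ Mx g x + a := by
  conv_lhs => unfold Mx
  refine iSup_le fun c => iSup_le fun ρ => iSup_le fun hρ => iSup_le fun hx => ?_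
  rw [ENNReal.div_le_iff (hX.pos c ρ hρ) (measure_ne_top _ _), lintegral_add_right _ measurable_const,
    setLIntegral_const, add_mul]
  gcongr
  exact hX.le_Mx g hρ hx

lemma Mx_one_le (hX : HomSp X n D) (x : X) : Mx (fun _ : X => (1:ℝ≥0∞)) x ≤ 1 := by
  unfold Mx
  refine iSup_le fun c => iSup_le fun ρ => iSup_le fun hρ => iSup_le fun hx => ?_
  rw [ENNReal.div_le_iff (hX.pos c ρ hρ) (measure_ne_top _ _)]
  simp

lemma Mx_le_const (hX : HomSp X n D) {g : X → ℝ≥0∞} {a : ℝ≥0∞} (h : ∀ x, g x ≤ a) (x : X) :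
    Mx g x ≤ a := by
  unfold Mx
  refine iSup_le fun c => iSup_le fun ρ => iSup_le fun hρ => iSup_le fun hx => ?_
  rw [ENNReal.div_le_iff (hX.pos c ρ hρ) (measure_ne_top _ _)]
  calc _ ≤ ∫⁻ u in Metric.ball c ρ, a := lintegral_mono fun u => h u
    _ = _ := by simp

/-- Strong type. -/
lemma strong_type (hX : HomSp X n D) {q : ℝ} (hq : 1 < q) :
    ∃ C : ℝ≥0∞, C ≠ ∞ ∧ ∀ g : X → ℝ≥0∞, Measurable g →
      ∫⁻ x, Mx g x ^ q ≤ C * ∫⁻ x, g x ^ q := by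
  refine ⟨ENNReal.ofReal (2 * q / (q - 1)) * D * 2 ^ (q - 1), ?_, ?_⟩
  · have := hX.ne_top
    refine ENNReal.mul_ne_top (ENNReal.mul_ne_top ENNReal.ofReal_ne_top this) ?_
    exact ENNReal.rpow_ne_top_of_nonneg (by linarith) (by simp)
  intro g hg
  have hw : ∀ l : ℝ, 0 < l → ENNReal.ofReal l * volume {x | ENNReal.ofReal l < Mx g x} ≤
      2 * D * ∫⁻ x, (if ENNReal.ofReal l < 2 * g x then 1 else 0) * g x := by
    intro l hl
    set g1 : X → ℝ≥0∞ := fun x => (if ENNReal.ofReal l < 2 * g x then 1 else 0) * g x with hg1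
    have hsub : {x | ENNReal.ofReal l < Mx g x} ⊆ {x | ENNReal.ofReal (l/2) < Mx g1 x} := by
      intro x hx
      simp only [Set.mem_ofPred_eq] at hx ⊢
      by_contra hcon
      push Not at hcon
      have : Mx g x ≤ Mx (fun u => g1 u + ENNReal.ofReal (l/2)) x := by
        refine Mx_mono (fun u => ?_) x
        simp only [hg1]
        split_ifs with h
        · simp
        · simp only [zero_mul, zero_add]
          push Not at h
          rw [ENNReal.ofReal_div_of_pos (by norm_num), ENNReal.ofReal_ofNat,
            ENNReal.le_div_iff_mul_le (by simp) (by simp), mul_comm]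
          exact h
      refine absurd hx (not_lt.2 (this.trans ((Mx_const_add hX g1 _ x).trans ?_)))
      calc _ ≤ ENNReal.ofReal (l/2) + ENNReal.ofReal (l/2) := by gcongr
        _ = _ := by rw [← ENNReal.ofReal_add (by positivity) (by positivity)]; congr 1; ring
    calc _ ≤ (2 * ENNReal.ofReal (l/2)) * volume {x | ENNReal.ofReal (l/2) < Mx g1 x} := by
          gcongr ?_ * volume ?_
          · rw [show (2:ℝ≥0∞) = ENNReal.ofReal 2 by simp, ← ENNReal.ofReal_mul (by norm_num)]
            apply ENNReal.ofReal_le_ofReal; linarith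
      _ = 2 * (ENNReal.ofReal (l/2) * volume {x | ENNReal.ofReal (l/2) < Mx g1 x}) := by ring
      _ ≤ 2 * (D * ∫⁻ x, g1 x) := by exact mul_le_mul_right (weak_type hX g1 _) _
      _ = _ := by ring
  have hq0 : 0 < q - 1 := by linarith
  rw [layer_cake volume (Mx_meas g) (by linarith : 0 < q)]
  calc ∫⁻ l in Set.Ioi (0:ℝ), volume {x | ENNReal.ofReal l < Mx g x} * ENNReal.ofReal (q * l ^ (q - 1))
      ≤ ∫⁻ l in Set.Ioi (0:ℝ), (2 * D * ENNReal.ofReal (q / (q - 1))) * ∫⁻ x, g x *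
        ((if ENNReal.ofReal l < 2 * g x then 1 else 0) * ENNReal.ofReal ((q - 1) * l ^ (q - 1 - 1))) := by
        refine setLIntegral_mono' measurableSet_Ioi fun l hl => ?_
        have hl : 0 < l := hl
        have e : ENNReal.ofReal (q * l ^ (q - 1)) = ENNReal.ofReal l * (ENNReal.ofReal (q / (q-1)) *
            ENNReal.ofReal ((q - 1) * l ^ (q - 1 - 1))) := by
          rw [← ENNReal.ofReal_mul (by positivity), ← ENNReal.ofReal_mul hl.le]
          congr 1
          rw [Real.rpow_sub_one hl.ne' (q - 1)]
          field_simp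
        rw [e, ← mul_assoc, mul_comm (volume _)]
        calc _ ≤ (2 * D * ∫⁻ x, (if ENNReal.ofReal l < 2 * g x then 1 else 0) * g x) *
                (ENNReal.ofReal (q / (q-1)) * ENNReal.ofReal ((q - 1) * l ^ (q - 1 - 1))) := by
              exact mul_le_mul_left (hw l hl) _
          _ = (2 * D * ENNReal.ofReal (q / (q-1))) * (ENNReal.ofReal ((q - 1) * l ^ (q - 1 - 1)) *
                ∫⁻ x, (if ENNReal.ofReal l < 2 * g x then 1 else 0) * g x) := by ring
          _ = _ := by
              congr 1
              rw [← lintegral_const_mul' _ _ ENNReal.ofReal_ne_top]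
              refine lintegral_congr fun x => ?_
              ring
    _ = (2 * D * ENNReal.ofReal (q / (q - 1))) * ∫⁻ x, g x * (2 * g x) ^ (q - 1) := by
        rw [lintegral_const_mul']
        · congr 1
          rw [lintegral_lintegral_swap]
          · refine lintegral_congr fun x => ?_
            rw [layer_pt (2 * g x) hq0, lintegral_const_mul]
            refine Measurable.mul (Measurable.ite ?_ measurable_const measurable_const) (by fun_prop)
            exact measurableSet_lt (by fun_prop) measurable_const
          · refine Measurable.aemeasurable ?_
            have h1 := (layer_meas (hg.const_mul 2)).comp measurable_swap
            simp only [Function.comp_def, Prod.fst_swap, Prod.snd_swap] at h1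
            refine (hg.comp measurable_snd).mul (h1.mul (by fun_prop))
        · exact ENNReal.mul_ne_top (ENNReal.mul_ne_top (by simp) hX.ne_top) ENNReal.ofReal_ne_top
    _ = _ := by
        have : ∀ x, g x * (2 * g x) ^ (q - 1) = 2 ^ (q-1) * g x ^ q := by
          intro x
          rw [ENNReal.mul_rpow_of_nonneg _ _ hq0.le, mul_left_comm]
          congr 1
          nth_rw 1 [← ENNReal.rpow_one (g x)]
          rw [← ENNReal.rpow_add_of_nonneg _ _ zero_le_one hq0.le]
          congr 1; ring
        simp_rw [this]
        rw [lintegral_const_mul _ (by fun_prop), mul_div_assoc, ENNReal.ofReal_mul (by norm_num)]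
        simp only [ENNReal.ofReal_ofNat]
        ring

end MaxFn

set_option linter.unusedSectionVars false
set_option linter.unusedVariables false

section GoodL
variable {X : Type*} [NormedAddCommGroup X] [MeasureSpace X] [BorelSpace X]
  [SecondCountableTopology X] [IsProbabilityMeasure (volume : Measure X)]
  {n : ℕ} {D : ℝ≥0∞}

/-- Oscillation control of `G` by `H`. -/
def OscCtl (G H : X → ℝ≥0∞) : Prop :=
  ∀ (c : X) (ρ : ℝ), 0 < ρ → ∃ (a : ℝ≥0∞) (E : X → ℝ≥0∞), Measurable E ∧
    (∀ u ∈ Metric.ball c ρ, G u ≤ a + E u ∧ a ≤ G u + E u) ∧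
    ∀ z ∈ Metric.ball c ρ, ∫⁻ u in Metric.ball c ρ, E u ≤ H z * volume (Metric.ball c ρ)

lemma good_lambda (hX : HomSp X n D) {G H : X → ℝ≥0∞} (hG : Measurable G) (hosc : OscCtl G H)
    {l γ : ℝ≥0∞} (hl0 : l ≠ 0) (hlt : l ≠ ∞) (hGl : ∫⁻ u, G u ≤ l) (hγ : γ ≤ 1) :
    volume {x | (D + 3) * l < Mx G x} ≤ D * D * γ * volume {x | l < Mx G x}
      + volume {x | γ * l < H x} := by
  classical
  set S : Set X := {x | (D + 3) * l < Mx G x ∧ H x ≤ γ * l} with hS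
  have hsub : {x | (D + 3) * l < Mx G x} ⊆ S ∪ {x | γ * l < H x} := by
    intro x hx
    by_cases h : γ * l < H x
    · exact Or.inr h
    · exact Or.inl ⟨hx, not_lt.1 h⟩
  suffices hmain : volume S ≤ D * D * γ * volume {x | l < Mx G x} by
    calc _ ≤ volume S + volume {x | γ * l < H x} := (measure_mono hsub).trans (measure_union_le _ _)
      _ ≤ _ := by gcongr
  have h0 : ∀ x : X, ∃ (c : X) (ρ : ℝ), x ∈ S → (0 < ρ ∧ ρ ≤ 2 ∧ x ∈ Metric.ball c ρ ∧
      l * volume (Metric.ball c ρ) < ∫⁻ u in Metric.ball c ρ, G u) ∧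
      ∀ (c' : X) (ρ' : ℝ), 2 * ρ ≤ ρ' → x ∈ Metric.ball c' ρ' →
        ∫⁻ u in Metric.ball c' ρ', G u ≤ l * volume (Metric.ball c' ρ') := by
    intro x
    by_cases hx : x ∈ S
    swap
    · exact ⟨0, 0, fun h => absurd h hx⟩
    have hx1 : l < Mx G x := by
      refine lt_of_le_of_lt ?_ hx.1
      calc l = 1 * l := (one_mul l).symm
        _ ≤ _ := by gcongr; exact le_add_left (by norm_num)
    set R : Set ℝ := {ρ | ∃ c, 0 < ρ ∧ ρ ≤ 2 ∧ x ∈ Metric.ball c ρ ∧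
      l * volume (Metric.ball c ρ) < ∫⁻ u in Metric.ball c ρ, G u} with hR
    have hRne : R.Nonempty := by
      obtain ⟨c, ρ, h⟩ := hX.lt_Mx G hx1
      exact ⟨ρ, c, h⟩
    have hRb : BddAbove R := ⟨2, fun ρ ⟨c, h⟩ => h.2.1⟩
    have hpos : 0 < sSup R := by
      obtain ⟨ρ, hρ⟩ := hRne
      obtain ⟨c, h⟩ := id hρ
      exact lt_of_lt_of_le h.1 (le_csSup hRb hρ)
    obtain ⟨ρ, ⟨c, h⟩, hlt⟩ := exists_lt_of_lt_csSup hRne (half_lt_self hpos)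
    refine ⟨c, ρ, fun _ => ⟨h, fun c' ρ' h2 hx' => ?_⟩⟩
    by_contra hcon
    push Not at hcon
    rcases le_or_gt ρ' 2 with h3 | h3
    · have : ρ' ≤ sSup R := le_csSup hRb ⟨c', by linarith [h.1], h3, hx', hcon⟩
      linarith
    · rw [hX.ball_univ c' h3.le] at hcon
      simp only [measure_univ, mul_one, Measure.restrict_univ] at hcon
      exact absurd hcon (not_lt.2 hGl)
  choose c ρ h using h0
  obtain ⟨u, hu, hcount, hd, hcov⟩ := vitali_use hX S c ρ
    (fun x hx => ⟨(h x hx).1.1, (h x hx).1.2.1, (h x hx).1.2.2.1⟩)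
  have hloc : ∀ b ∈ u, volume (S ∩ Metric.ball (c b) (5 * ρ b)) ≤
      D * D * γ * volume (Metric.ball (c b) (ρ b)) := by
    intro b hb
    obtain ⟨⟨hρ, hρ2, hbm, hbl⟩, hmax⟩ := h b (hu hb)
    rcases Set.eq_empty_or_nonempty (S ∩ Metric.ball (c b) (5 * ρ b)) with he | ⟨y0, hy0⟩
    · rw [he]; simp
    obtain ⟨a, E, hEm, hE, hEint⟩ := hosc (c b) (7 * ρ b) (by linarith)
    set B := Metric.ball (c b) (7 * ρ b) with hB
    have hVB : volume B ≠ 0 := hX.pos _ _ (by linarith)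
    have hVt : volume B ≠ ∞ := measure_ne_top _ _
    have hEi : ∫⁻ u in B, E u ≤ γ * l * volume B := by
      refine (hEint y0 (Metric.ball_subset_ball (by linarith) hy0.2)).trans ?_
      gcongr
      exact hy0.1.2
    have hGB : ∫⁻ u in B, G u ≤ l * volume B := by
      refine hmax _ _ (by linarith) (Metric.ball_subset_ball (by linarith) hbm)
    have ha : a ≤ 2 * l := by
      rw [← ENNReal.mul_le_mul_iff_left hVB hVt]
      calc a * volume B = ∫⁻ u in B, a := by rw [setLIntegral_const]
        _ ≤ ∫⁻ u in B, (G u + E u) := setLIntegral_mono' Metric.isOpen_ball.measurableSet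
            fun u hu => (hE u hu).2
        _ ≤ l * volume B + γ * l * volume B := by
            rw [lintegral_add_right _ hEm]; gcongr
        _ ≤ l * volume B + 1 * l * volume B := by gcongr
        _ = 2 * l * volume B := by ring
    have hsub2 : S ∩ Metric.ball (c b) (5 * ρ b) ⊆ {y | l < Mx (B.indicator E) y} := by
      rintro y ⟨hyS, hyb⟩
      obtain ⟨c', ρ', hρ', hρ'2, hyc, hgt⟩ := hX.lt_Mx G hyS.1
      set b' := Metric.ball c' ρ' with hb'
      have hdist : ∀ w ∈ b', dist w (c b) < 5 * ρ b + 2 * ρ' := by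
        intro w hw
        rw [hb', Metric.mem_ball] at hw
        rw [Metric.mem_ball] at hyc hyb
        have h1 := dist_triangle w c' (c b)
        have h2 := dist_triangle c' y (c b)
        rw [dist_comm c' y] at h2
        linarith
      have hlt' : ρ' < ρ b := by
        by_contra hcon
        push Not at hcon
        have hsb : b' ⊆ Metric.ball (c b) (7 * ρ') := by
          intro w hw; rw [Metric.mem_ball]; have := hdist w hw; linarith
        have h1 := hmax (c b) (7 * ρ') (by linarith) (Metric.ball_subset_ball (by linarith) hbm)
        have h2 : (D + 3) * l * volume b' < (D * l) * volume b' := by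
          calc _ < _ := hgt
            _ ≤ ∫⁻ u in Metric.ball (c b) (7 * ρ'), G u := lintegral_mono_set hsb
            _ ≤ _ := h1
            _ ≤ l * (D * volume b') := by gcongr; exact hX.dbl _ _ _ hρ'
            _ = _ := by ring
        refine absurd h2 (not_lt.2 ?_)
        gcongr
        exact le_self_add
      have hsb : b' ⊆ B := by
        intro w hw; rw [hB, Metric.mem_ball]; have := hdist w hw; linarith
      have hgt2 : l * volume b' < ∫⁻ u in b', E u := by
        by_contra hcon
        push Not at hcon
        refine absurd hgt (not_lt.2 ?_)
        calc ∫⁻ u in b', G u ≤ ∫⁻ u in b', (a + E u) :=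
              setLIntegral_mono' Metric.isOpen_ball.measurableSet fun u hu => (hE u (hsb hu)).1
          _ ≤ a * volume b' + l * volume b' := by
              rw [lintegral_add_right _ hEm, setLIntegral_const]; gcongr
          _ ≤ (2 * l) * volume b' + l * volume b' := by gcongr
          _ = 3 * l * volume b' := by ring
          _ ≤ _ := by gcongr; exact le_add_self
      have hgt3 : ∫⁻ u in b', E u ≤ Mx (B.indicator E) y * volume b' := by
        calc _ = ∫⁻ u in b', B.indicator E u := by
              refine setLIntegral_congr_fun Metric.isOpen_ball.measurableSet fun u hu => ?_
              rw [Set.indicator_of_mem (hsb hu)]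
          _ ≤ _ := hX.le_Mx _ hρ' hyc
      exact lt_of_mul_lt_mul_right' (hgt2.trans_le hgt3)
    rw [← ENNReal.mul_le_mul_iff_right hl0 hlt]
    calc l * volume (S ∩ Metric.ball (c b) (5 * ρ b)) ≤ l * volume {y | l < Mx (B.indicator E) y} := by
          exact mul_le_mul_right (measure_mono hsub2) _
      _ ≤ D * ∫⁻ u, B.indicator E u := weak_type hX _ _
      _ = D * ∫⁻ u in B, E u := by rw [lintegral_indicator Metric.isOpen_ball.measurableSet]
      _ ≤ D * (γ * l * volume B) := by gcongr
      _ ≤ D * (γ * l * (D * volume (Metric.ball (c b) (ρ b)))) := by gcongr; exact hX.dbl _ _ _ hρ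
      _ = _ := by ring
  calc volume S ≤ volume (⋃ b ∈ u, S ∩ Metric.ball (c b) (5 * ρ b)) := by
        refine measure_mono fun x hx => ?_
        have := hcov hx
        simp only [Set.mem_iUnion] at this ⊢
        obtain ⟨b, hb, hxb⟩ := this
        exact ⟨b, hb, hx, hxb⟩
    _ ≤ ∑' b : u, volume (S ∩ Metric.ball (c b) (5 * ρ b)) := measure_biUnion_le _ hcount _
    _ ≤ ∑' b : u, D * D * γ * volume (Metric.ball (c b) (ρ b)) :=
        ENNReal.tsum_le_tsum fun b => hloc b b.2
    _ = D * D * γ * volume (⋃ b ∈ u, Metric.ball (c b) (ρ b)) := by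
        rw [ENNReal.tsum_mul_left, measure_biUnion hcount hd (fun _ _ => Metric.isOpen_ball.measurableSet)]
    _ ≤ _ := by
        refine mul_le_mul_right (measure_mono ?_) _
        refine Set.iUnion₂_subset fun b hb x hx => ?_
        obtain ⟨⟨hρ, hρ2, hbm, hbl⟩, hmax⟩ := h b (hu hb)
        exact lt_of_mul_lt_mul_right' (hbl.trans_le (hX.le_Mx G hρ hx))

/-- Fefferman–Stein type inequality. -/
lemma fefferman_stein (hX : HomSp X n D) {r : ℝ} (hr : 0 < r) :
    ∃ C : ℝ≥0∞, C ≠ ∞ ∧ ∀ G H : X → ℝ≥0∞, Measurable G → Measurable H → OscCtl G H →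
      (∃ b : ℝ≥0∞, b ≠ ∞ ∧ ∀ x, G x ≤ b) → (∀ x, G x ≤ Mx G x) →
      ∫⁻ x, G x ^ r ≤ C * ((∫⁻ x, H x ^ r) + (∫⁻ x, G x) ^ r) := by
  set K := D + 3 with hK
  have hKt : K ≠ ∞ := ENNReal.add_ne_top.2 ⟨hX.ne_top, by simp⟩
  have hK0 : K ≠ 0 := by simp [hK]
  have hD0 : D ≠ 0 := (lt_of_lt_of_le zero_lt_one hX.one_le).ne'
  have hKrt : K ^ r ≠ ∞ := ENNReal.rpow_ne_top_of_nonneg hr.le hKt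
  have hKr1 : 1 ≤ K ^ r := ENNReal.one_le_rpow (le_add_left (by norm_num)) hr
  have hKr0 : K ^ r ≠ 0 := (lt_of_lt_of_le zero_lt_one hKr1).ne'
  set γ : ℝ≥0∞ := (2 * (D * D) * K ^ r)⁻¹ with hγ
  have hden0 : 2 * (D * D) * K ^ r ≠ 0 := by simp [hD0, hKr0]
  have hdent : 2 * (D * D) * K ^ r ≠ ∞ :=
    ENNReal.mul_ne_top (ENNReal.mul_ne_top (by simp) (ENNReal.mul_ne_top hX.ne_top hX.ne_top)) hKrt
  have hγ0 : γ ≠ 0 := ENNReal.inv_ne_zero.2 hdent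
  have hγt : γ ≠ ∞ := ENNReal.inv_ne_top.2 hden0
  have hγ1 : γ ≤ 1 := by
    rw [hγ, ENNReal.inv_le_one]
    calc (1:ℝ≥0∞) = 1 * (1 * 1) * 1 := by ring
      _ ≤ _ := by gcongr <;> first | exact hX.one_le | norm_num
  have hθ : D * D * γ * K ^ r = 2⁻¹ := by
    rw [hγ, ENNReal.mul_inv (by simp [hKrt]) (by simp [hKr0]),
      ENNReal.mul_inv (by simp) (by simp)]
    have h1 : D * D ≠ 0 := mul_ne_zero hD0 hD0
    have h2 : D * D ≠ ∞ := ENNReal.mul_ne_top hX.ne_top hX.ne_top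
    calc _ = 2⁻¹ * ((D * D) * (D * D)⁻¹) * (K ^ r * (K ^ r)⁻¹) := by ring
      _ = _ := by rw [ENNReal.mul_inv_cancel h1 h2, ENNReal.mul_inv_cancel hKr0 hKrt]; simp
  refine ⟨2 * K ^ r * (1 + (γ⁻¹) ^ r), ?_, ?_⟩
  · refine ENNReal.mul_ne_top (ENNReal.mul_ne_top (by simp) hKrt) (ENNReal.add_ne_top.2 ⟨by simp, ?_⟩)
    exact ENNReal.rpow_ne_top_of_nonneg hr.le (ENNReal.inv_ne_top.2 hγ0)
  intro G H hG hH hosc ⟨b, hbt, hb⟩ hGM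
  set I := ∫⁻ x, Mx G x ^ r with hI
  have hIt : I ≠ ∞ := by
    refine ne_of_lt (lt_of_le_of_lt (lintegral_mono (g := fun _ => b ^ r) fun x => ?_) ?_)
    · exact ENNReal.rpow_le_rpow (Mx_le_const hX hb x) hr.le
    · simp only [lintegral_const, measure_univ, mul_one]
      exact (ENNReal.rpow_ne_top_of_nonneg hr.le hbt).lt_top
  set A := ∫⁻ u, G u with hA
  have hAt : A ≠ ∞ := by
    refine ne_of_lt (lt_of_le_of_lt (lintegral_mono (g := fun _ => b) hb) ?_)
    simpa using hbt.lt_top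
  have hmeasl : ∀ {g : X → ℝ≥0∞}, Measurable g → Measurable fun l : ℝ =>
      volume {x | ENNReal.ofReal l < g x} * ENNReal.ofReal (r * l ^ (r - 1)) := by
    intro g hg
    refine Measurable.mul (Antitone.measurable fun l l' hll => measure_mono fun x hx => ?_) (by fun_prop)
    exact lt_of_le_of_lt (ENNReal.ofReal_le_ofReal hll) hx
  have hkey : ∫⁻ x, (K⁻¹ * Mx G x) ^ r ≤ A ^ r + (D * D * γ * I + ∫⁻ x, (γ⁻¹ * H x) ^ r) := by
    rw [layer_cake volume ((Mx_meas G).const_mul _) hr, hI, layer_cake volume (Mx_meas G) hr,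
      layer_cake volume (hH.const_mul _) hr, layer_pt A hr, ← lintegral_const_mul',
      ← lintegral_add_right', ← lintegral_add_right']
    · refine setLIntegral_mono' measurableSet_Ioi fun l hl => ?_
      have hl : 0 < l := hl
      simp only [← mul_assoc, ← add_mul]
      gcongr
      by_cases hlA : ENNReal.ofReal l < A
      · simp only [hlA, if_true]
        exact prob_le_one.trans le_self_add
      · simp only [hlA, if_false, zero_add]
        have h1 := good_lambda hX hG hosc (l := ENNReal.ofReal l) (γ := γ) (by simpa using hl)
          ENNReal.ofReal_ne_top (not_lt.1 hlA) hγ1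
        have e1 : {x | ENNReal.ofReal l < K⁻¹ * Mx G x} = {x | K * ENNReal.ofReal l < Mx G x} := by
          ext x
          simp only [Set.mem_ofPred_eq]
          rw [mul_comm K⁻¹, ← div_eq_mul_inv, ENNReal.lt_div_iff_mul_lt (Or.inl hK0) (Or.inl hKt),
            mul_comm]
        have e2 : {x | ENNReal.ofReal l < γ⁻¹ * H x} = {x | γ * ENNReal.ofReal l < H x} := by
          ext x
          simp only [Set.mem_ofPred_eq]
          rw [mul_comm γ⁻¹, ← div_eq_mul_inv, ENNReal.lt_div_iff_mul_lt (Or.inl hγ0) (Or.inl hγt),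
            mul_comm]
        rw [e1, e2]
        exact h1
    · exact (hmeasl (Mx_meas G)).const_mul _ |>.add (hmeasl (hH.const_mul _)) |>.aemeasurable
    · exact (hmeasl (hH.const_mul _)).aemeasurable
    · exact ENNReal.mul_ne_top (ENNReal.mul_ne_top hX.ne_top hX.ne_top) hγt
  have hK1 : ∫⁻ x, (K⁻¹ * Mx G x) ^ r = (K ^ r)⁻¹ * I := by
    simp_rw [ENNReal.mul_rpow_of_nonneg _ _ hr.le]
    rw [lintegral_const_mul _ ((Mx_meas G).pow_const _), ENNReal.inv_rpow]
  have hH1 : ∫⁻ x, (γ⁻¹ * H x) ^ r = γ⁻¹ ^ r * ∫⁻ x, H x ^ r := by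
    simp_rw [ENNReal.mul_rpow_of_nonneg _ _ hr.le]
    rw [lintegral_const_mul _ (hH.pow_const _)]
  rw [hK1, hH1] at hkey
  set T := A ^ r + γ⁻¹ ^ r * ∫⁻ x, H x ^ r with hT
  have h3 : I ≤ K ^ r * T + 2⁻¹ * I := by
    calc I = K ^ r * ((K ^ r)⁻¹ * I) := by
          rw [← mul_assoc, ENNReal.mul_inv_cancel hKr0 hKrt, one_mul]
      _ ≤ K ^ r * (A ^ r + (D * D * γ * I + γ⁻¹ ^ r * ∫⁻ x, H x ^ r)) := by gcongr
      _ = K ^ r * T + (D * D * γ * K ^ r) * I := by rw [hT]; ring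
      _ = _ := by rw [hθ]
  have h4 : I ≤ 2 * (K ^ r * T) := by
    have h5 : 2⁻¹ * I + 2⁻¹ * I ≤ K ^ r * T + 2⁻¹ * I := by
      rwa [← add_mul, ENNReal.inv_two_add_inv_two, one_mul]
    have h6 := ENNReal.le_of_add_le_add_right (ENNReal.mul_ne_top (by simp) hIt) h5
    calc I = 2 * (2⁻¹ * I) := by
          rw [← mul_assoc, ENNReal.mul_inv_cancel (by simp) (by simp), one_mul]
      _ ≤ _ := by gcongr
  calc ∫⁻ x, G x ^ r ≤ I := lintegral_mono fun x => ENNReal.rpow_le_rpow (hGM x) hr.le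
    _ ≤ 2 * (K ^ r * T) := h4
    _ = 2 * K ^ r * (A ^ r + γ⁻¹ ^ r * ∫⁻ x, H x ^ r) := by rw [hT]; ring
    _ ≤ 2 * K ^ r * ((1 + γ⁻¹ ^ r) * A ^ r + (1 + γ⁻¹ ^ r) * ∫⁻ x, H x ^ r) := by
        gcongr
        · exact le_mul_of_one_le_left zero_le le_self_add
        · exact le_add_self
    _ = _ := by ring

end GoodL

set_option linter.unusedSectionVars false
set_option linter.unusedVariables false
section Extrap
variable {X : Type*} [NormedAddCommGroup X] [MeasureSpace X] [BorelSpace X]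
  [SecondCountableTopology X] [IsProbabilityMeasure (volume : Measure X)]
  {Y : Type*} [NormedAddCommGroup Y] [MeasureSpace Y] [BorelSpace Y]
  [SecondCountableTopology Y] [IsProbabilityMeasure (volume : Measure Y)]
  [CompactSpace X] [CompactSpace Y] [(volume : Measure Y).IsAddHaarMeasure]
  {n : ℕ} {D : ℝ≥0∞}

/-- Convolution. -/
def cv {Z : Type*} [AddCommGroup Z] [MeasureSpace Z] (K f : Z → ℂ) (z : Z) : ℂ :=
  ∫ w, K (z - w) * f w

/-- Hörmander condition, in the form of a maximal function bound. -/
def HorK (K : X × Y → ℂ) (A : ℝ≥0∞) : Prop :=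
  ∀ (c : X) (ρ : ℝ), 0 < ρ → ∀ x ∈ Metric.ball c ρ, ∀ z ∈ Metric.ball c ρ,
    ∀ Φ : X → ℝ≥0∞, Measurable Φ →
    ∫⁻ u in (Metric.ball c (7 * ρ))ᶜ, (∫⁻ y, ‖K (x - u, y) - K (c - u, y)‖ₑ) * Φ u ≤ A * Mx Φ z

/-- The `L^s` norm on `Y`. -/
def nY {Y : Type*} [MeasureSpace Y] (s : ℝ) (g : Y → ℂ) : ℝ≥0∞ := (∫⁻ y, ‖g y‖ₑ ^ s) ^ (1 / s)

lemma nY_add {Y : Type*} [MeasureSpace Y] {s : ℝ} (hs : 1 ≤ s) {g h : Y → ℂ} (hg : Measurable g) (hh : Measurable h) :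
    nY s (fun y => g y + h y) ≤ nY s g + nY s h := by
  unfold nY
  refine le_trans ?_ (ENNReal.lintegral_Lp_add_le (μ := volume) (f := fun y => ‖g y‖ₑ) (g := fun y => ‖h y‖ₑ)
    (by fun_prop) (by fun_prop) hs)
  gcongr with y
  exact enorm_add_le _ _

lemma nY_pow {Y : Type*} [MeasureSpace Y] {s : ℝ} (hs : 0 < s) (g : Y → ℂ) : nY s g ^ s = ∫⁻ y, ‖g y‖ₑ ^ s := by
  unfold nY
  rw [← ENNReal.rpow_mul, one_div, inv_mul_cancel₀ hs.ne', ENNReal.rpow_one]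

lemma nY_sub_comm {Y : Type*} [MeasureSpace Y] {s : ℝ} (g h : Y → ℂ) :
    nY s (fun y => g y - h y) = nY s (fun y => h y - g y) := by
  unfold nY; simp_rw [enorm_sub_rev]

lemma nY_meas {X Y : Type*} [MeasurableSpace X] [MeasureSpace Y] [SFinite (volume : Measure Y)] {s : ℝ}
    {g : X × Y → ℂ} (hg : Measurable g) : Measurable fun x => nY s (fun y => g (x, y)) := by
  unfold nY
  refine Measurable.pow_const ?_ _
  exact Measurable.lintegral_prod_right' (f := fun z : X × Y => ‖g z‖ₑ ^ s) (by fun_prop)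

section cvZ
variable {Z : Type*} [NormedAddCommGroup Z] [MeasureSpace Z] [BorelSpace Z]
  [SecondCountableTopology Z] [IsProbabilityMeasure (volume : Measure Z)] [CompactSpace Z]

lemma bdd_of_cont {K : Z → ℂ} (hK : Continuous K) : ∃ b : ℝ, 0 ≤ b ∧ ∀ z, ‖K z‖ ≤ b := by
  obtain ⟨b, hb⟩ := isCompact_univ.exists_bound_of_continuousOn (f := K) hK.continuousOn
  exact ⟨b, (norm_nonneg _).trans (hb 0 (Set.mem_univ _)), fun z => hb z (Set.mem_univ _)⟩

lemma cv_int {K f : Z → ℂ} (hK : Continuous K) (hf : Integrable f) (z : Z) :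
    Integrable fun w => K (z - w) * f w := by
  obtain ⟨b, hb0, hb⟩ := bdd_of_cont hK
  exact hf.bdd_mul (c := b) (by fun_prop) (Filter.Eventually.of_forall fun w => hb _)

lemma cv_cont {K f : Z → ℂ} (hK : Continuous K) (hf : Integrable f) : Continuous (cv K f) := by
  obtain ⟨b, hb0, hb⟩ := bdd_of_cont hK
  unfold cv
  refine continuous_of_dominated (bound := fun w => b * ‖f w‖) ?_ ?_ ?_ ?_
  · intro z; exact (cv_int hK hf z).aestronglyMeasurable
  · intro z; refine Filter.Eventually.of_forall fun w => ?_
    rw [norm_mul]; gcongr; exact hb _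
  · exact hf.norm.const_mul b
  · refine Filter.Eventually.of_forall fun w => by fun_prop

lemma cv_add {K f g : Z → ℂ} (hK : Continuous K) (hf : Integrable f) (hg : Integrable g) (z : Z) :
    cv K (fun w => f w + g w) z = cv K f z + cv K g z := by
  unfold cv
  rw [← integral_add (cv_int hK hf z) (cv_int hK hg z)]
  simp_rw [mul_add]
end cvZ

lemma le_Mx_of_cont (hX : HomSp X n D) {G : X → ℝ≥0∞} (hG : Continuous G) (x : X) : G x ≤ Mx G x := by
  refine le_of_forall_lt fun l hl => ?_
  obtain ⟨l', hl1, hl2⟩ := exists_between hl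
  refine hl1.trans_le ?_
  have ho : IsOpen {u | l' < G u} := isOpen_lt continuous_const hG
  obtain ⟨ρ, hρ, hb⟩ := Metric.isOpen_iff.1 ho x hl2
  have h1 := hX.le_Mx G hρ (Metric.mem_ball_self (x := x) hρ)
  rw [← ENNReal.mul_le_mul_iff_left (hX.pos x ρ hρ) (measure_ne_top _ _)]
  refine le_trans ?_ h1
  rw [← setLIntegral_const]
  exact setLIntegral_mono' Metric.isOpen_ball.measurableSet fun u hu => (hb hu).le

lemma nY_cont {g : X × Y → ℂ} (hg : Continuous g) {s : ℝ} (hs : 0 < s) :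
    Continuous fun x => nY s (fun y => g (x, y)) := by
  obtain ⟨b, hb0⟩ := isCompact_univ.exists_bound_of_continuousOn (f := g) hg.continuousOn
  unfold nY
  refine (ENNReal.continuous_rpow_const).comp ?_
  refine continuous_iff_continuousAt.2 fun x => ?_
  refine tendsto_lintegral_filter_of_dominated_convergence (fun _ => (ENNReal.ofReal b) ^ s) ?_ ?_ ?_ ?_
  · refine Filter.Eventually.of_forall fun x => ?_
    exact (hg.measurable.comp (by fun_prop : Measurable fun y : Y => (x, y))).enorm.pow_const _
  · refine Filter.Eventually.of_forall fun x => Filter.Eventually.of_forall fun y => ?_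
    gcongr
    rw [← ofReal_norm]
    exact ENNReal.ofReal_le_ofReal (hb0 _ (Set.mem_univ _))
  · simp only [lintegral_const, measure_univ, mul_one]
    exact ENNReal.rpow_ne_top_of_nonneg hs.le ENNReal.ofReal_ne_top
  · refine Filter.Eventually.of_forall fun y => ?_
    refine ((ENNReal.continuous_rpow_const).comp (continuous_enorm.comp (hg.comp ?_))).continuousAt
    fun_prop

lemma jensen_set {α : Type*} [MeasurableSpace α] (μ : Measure α) {g : α → ℝ≥0∞}
    (hg : AEMeasurable g μ) {s : ℝ} (hs : 1 < s) :
    (∫⁻ x, g x ∂μ) ^ s ≤ μ Set.univ ^ (s - 1) * ∫⁻ x, g x ^ s ∂μ := by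
  have := jensen_w μ (w := fun _ => 1) aemeasurable_const hg hs
  simpa using this

lemma jensen_le {α : Type*} [MeasurableSpace α] (μ : Measure α) [IsProbabilityMeasure μ] {g : α → ℝ≥0∞}
    (hg : AEMeasurable g μ) {s : ℝ} (hs : 1 < s) :
    (∫⁻ x, g x ∂μ) ^ s ≤ ∫⁻ x, g x ^ s ∂μ := by
  have := jensen_set μ hg hs
  simpa using this

/-- the far part -/
lemma far_part {K : X × Y → ℂ} {A : ℝ≥0∞} (hK : Continuous K) (hX : HomSp X n D) (hH : HorK K A)
    {s : ℝ} (hs : 1 < s) {f : X × Y → ℂ} (hf : Measurable f) (hfi : Integrable f) {c x z : X} {ρ : ℝ} (hρ : 0 < ρ)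
    (hx : x ∈ Metric.ball c ρ) (hz : z ∈ Metric.ball c ρ)
    (hf0 : ∀ w : X × Y, w.1 ∈ Metric.ball c (7 * ρ) → f w = 0) :
    nY s (fun y => cv K f (x, y) - cv K f (c, y)) ≤ A * Mx (fun x => ∫⁻ y, ‖f (x, y)‖ₑ ^ s) z ^ (1 / s) := by
  have hs0 : 0 < s := by linarith
  set P : X → ℝ≥0∞ := fun x => ∫⁻ y, ‖f (x, y)‖ₑ ^ s with hP
  have hPm : Measurable P :=
    Measurable.lintegral_prod_right' (f := fun z : X × Y => ‖f z‖ₑ ^ s) (by fun_prop)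
  set B := Metric.ball c (7 * ρ) with hB
  have hBm : MeasurableSet Bᶜ := Metric.isOpen_ball.measurableSet.compl
  set w : X × Y → ℝ≥0∞ := fun q => (Bᶜ).indicator 1 q.1 * ‖K (x - q.1, q.2) - K (c - q.1, q.2)‖ₑ with hw
  have hwm : Measurable w := by
    refine Measurable.mul ((measurable_one.indicator hBm).comp measurable_fst) ?_
    have : Continuous fun q : X × Y => K (x - q.1, q.2) - K (c - q.1, q.2) := by fun_prop
    exact this.measurable.enorm
  have hinner : ∀ Φ : X → ℝ≥0∞, Measurable Φ → ∫⁻ u, (∫⁻ v, w (u, v)) * Φ u ≤ A * Mx Φ z := by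
    intro Φ hΦ
    refine le_trans (le_of_eq ?_) (hH c ρ hρ x hx z hz Φ hΦ)
    rw [← lintegral_indicator hBm]
    refine lintegral_congr fun u => ?_
    by_cases hu : u ∈ Bᶜ
    · simp only [hw, Set.indicator_of_mem hu, Pi.one_apply, one_mul]
    · simp only [hw, Set.indicator_of_notMem hu, zero_mul, lintegral_zero]
  have hA1 : ∫⁻ u, ∫⁻ v, w (u, v) ≤ A := by
    have := hinner (fun _ => 1) measurable_const
    simp only [mul_one] at this
    refine this.trans ?_
    calc _ ≤ A * 1 := by gcongr; exact Mx_one_le hX z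
      _ = A := mul_one A
  have hshift : ∀ u y, ∫⁻ v, w (u, y - v) = ∫⁻ v, w (u, v) := fun u y =>
    lintegral_sub_left_eq_self (fun v => w (u, v)) y
  have hpt : ∀ y, ‖cv K f (x, y) - cv K f (c, y)‖ₑ ^ s ≤
      A ^ (s - 1) * ∫⁻ q : X × Y, w (q.1, y - q.2) * ‖f q‖ₑ ^ s := by
    intro y
    have h1 : ‖cv K f (x, y) - cv K f (c, y)‖ₑ ≤ ∫⁻ q : X × Y, w (q.1, y - q.2) * ‖f q‖ₑ := by
      unfold cv
      rw [← integral_sub (cv_int hK hfi _) (cv_int hK hfi _)]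
      refine (enorm_integral_le_lintegral_enorm _).trans (lintegral_mono fun q => ?_)
      rw [← sub_mul, enorm_mul]
      by_cases hq : q.1 ∈ B
      · simp [hf0 q hq]
      · have : q.1 ∈ Bᶜ := hq
        simp only [hw, Set.indicator_of_mem this, Pi.one_apply, one_mul]
        rfl
    have hwm' : Measurable fun q : X × Y => w (q.1, y - q.2) := hwm.comp (by fun_prop)
    calc _ ≤ (∫⁻ q : X × Y, w (q.1, y - q.2) * ‖f q‖ₑ) ^ s := by gcongr
      _ ≤ (∫⁻ q : X × Y, w (q.1, y - q.2)) ^ (s - 1) * ∫⁻ q : X × Y, w (q.1, y - q.2) * ‖f q‖ₑ ^ s :=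
          jensen_w _ hwm'.aemeasurable (by fun_prop) hs
      _ ≤ _ := by
          have : ∫⁻ q : X × Y, w (q.1, y - q.2) ≤ A := by
            rw [Measure.volume_eq_prod, lintegral_prod _ hwm'.aemeasurable]
            simp only [hshift]; exact hA1
          have hs1 : 0 ≤ s - 1 := by linarith
          gcongr
  have hbig : ∫⁻ y, ‖cv K f (x, y) - cv K f (c, y)‖ₑ ^ s ≤ A ^ s * Mx P z := by
    have hm2 : Measurable fun p : Y × (X × Y) => w (p.2.1, p.1 - p.2.2) * ‖f p.2‖ₑ ^ s := by
      refine Measurable.mul (hwm.comp (by fun_prop)) (by fun_prop)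
    have hm3 : Measurable fun y : Y => ∫⁻ q : X × Y, w (q.1, y - q.2) * ‖f q‖ₑ ^ s :=
      hm2.lintegral_prod_right'
    calc _ ≤ ∫⁻ y, A ^ (s - 1) * ∫⁻ q : X × Y, w (q.1, y - q.2) * ‖f q‖ₑ ^ s := lintegral_mono hpt
      _ = A ^ (s - 1) * ∫⁻ q : X × Y, ∫⁻ y, w (q.1, y - q.2) * ‖f q‖ₑ ^ s := by
          rw [lintegral_const_mul _ hm3, lintegral_lintegral_swap hm2.aemeasurable]
      _ = A ^ (s - 1) * ∫⁻ q : X × Y, (∫⁻ v, w (q.1, v)) * ‖f q‖ₑ ^ s := by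
          congr 1
          refine lintegral_congr fun q => ?_
          rw [lintegral_mul_const]
          · rw [lintegral_sub_right_eq_self (fun v => w (q.1, v))]
          · exact hwm.comp (by fun_prop)
      _ = A ^ (s - 1) * ∫⁻ u, (∫⁻ v, w (u, v)) * P u := by
          congr 1
          rw [Measure.volume_eq_prod, lintegral_prod]
          · refine lintegral_congr fun u => ?_
            dsimp only
            rw [lintegral_const_mul]
            exact Measurable.pow_const (hf.comp (by fun_prop)).enorm _
          · refine Measurable.aemeasurable (Measurable.mul ?_ (by fun_prop))
            exact (Measurable.lintegral_prod_right' hwm).comp measurable_fst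
      _ ≤ A ^ (s - 1) * (A * Mx P z) := by gcongr; exact hinner P hPm
      _ = _ := by
          rw [← mul_assoc]
          congr 1
          nth_rewrite 2 [← ENNReal.rpow_one A]
          rw [← ENNReal.rpow_add_of_nonneg _ _ (by linarith) (by norm_num)]
          congr 1; ring
  unfold nY
  calc _ ≤ (A ^ s * Mx P z) ^ (1 / s) := by gcongr
    _ = _ := by
      rw [ENNReal.mul_rpow_of_nonneg _ _ (by positivity), ← ENNReal.rpow_mul, mul_one_div_cancel hs0.ne', ENNReal.rpow_one]

lemma near_part {K : X × Y → ℂ} {C : ℝ≥0∞} (hK : Continuous K) (hX : HomSp X n D)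
    {s : ℝ} (hs : 1 < s)
    (hC : ∀ f : X × Y → ℂ, Measurable f → ∫⁻ z, ‖cv K f z‖ₑ ^ s ≤ C * ∫⁻ z, ‖f z‖ₑ ^ s)
    {f : X × Y → ℂ} (hf : Measurable f) (hfi : Integrable f) {c z : X} {ρ : ℝ} (hρ : 0 < ρ)
    (hz : z ∈ Metric.ball c ρ)
    (hf0 : ∀ w : X × Y, w.1 ∉ Metric.ball c (7 * ρ) → f w = 0) :
    ∫⁻ x in Metric.ball c ρ, nY s (fun y => cv K f (x, y)) ≤
      (C * D) ^ (1 / s) * Mx (fun x => ∫⁻ y, ‖f (x, y)‖ₑ ^ s) z ^ (1 / s) * volume (Metric.ball c ρ) := by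
  have hs0 : 0 < s := by linarith
  set P : X → ℝ≥0∞ := fun x => ∫⁻ y, ‖f (x, y)‖ₑ ^ s with hP
  set B := Metric.ball c ρ with hB
  have hcm : Measurable (cv K f) := (cv_cont hK hfi).measurable
  have hgm : Measurable fun x => nY s (fun y => cv K f (x, y)) := nY_meas hcm
  have h1 : (∫⁻ x in B, nY s (fun y => cv K f (x, y))) ^ s ≤
      volume B ^ (s - 1) * (C * (D * (Mx P z * volume B))) := by
    calc _ ≤ volume B ^ (s - 1) * ∫⁻ x in B, nY s (fun y => cv K f (x, y)) ^ s := by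
          have := jensen_set (volume.restrict B) hgm.aemeasurable hs
          rwa [Measure.restrict_apply_univ] at this
      _ ≤ volume B ^ (s - 1) * ∫⁻ x, nY s (fun y => cv K f (x, y)) ^ s := by
          refine mul_le_mul_right (setLIntegral_le_lintegral _ _) _
      _ = volume B ^ (s - 1) * ∫⁻ z, ‖cv K f z‖ₑ ^ s := by
          simp_rw [nY_pow hs0]
          rw [Measure.volume_eq_prod, lintegral_prod]
          exact (hcm.enorm.pow_const _).aemeasurable
      _ ≤ volume B ^ (s - 1) * (C * ∫⁻ z, ‖f z‖ₑ ^ s) := mul_le_mul_right (hC f hf) _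
      _ = volume B ^ (s - 1) * (C * ∫⁻ x in Metric.ball c (7 * ρ), P x) := by
          rw [Measure.volume_eq_prod, lintegral_prod _ (hf.enorm.pow_const _).aemeasurable,
            ← lintegral_indicator Metric.isOpen_ball.measurableSet]
          congr 2
          refine lintegral_congr fun x => ?_
          by_cases hx : x ∈ Metric.ball c (7 * ρ)
          · rw [Set.indicator_of_mem hx]
          · rw [Set.indicator_of_notMem hx]
            simp [hf0 (x, _) hx, hs0]
      _ ≤ volume B ^ (s - 1) * (C * (D * (Mx P z * volume B))) := by
          refine mul_le_mul_right (mul_le_mul_right ?_ _) _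
          refine (hX.le_Mx P (by linarith : 0 < 7 * ρ) (Metric.ball_subset_ball (by linarith) hz)).trans ?_
          calc _ ≤ Mx P z * (D * volume B) := mul_le_mul_right (hX.dbl c c ρ hρ) _
            _ = _ := by ring
  have hV0 : volume B ≠ 0 := hX.pos c ρ hρ
  have hVt : volume B ≠ ∞ := measure_ne_top _ _
  calc ∫⁻ x in B, nY s (fun y => cv K f (x, y))
      = ((∫⁻ x in B, nY s (fun y => cv K f (x, y))) ^ s) ^ (1 / s) := by
        rw [← ENNReal.rpow_mul, mul_one_div_cancel hs0.ne', ENNReal.rpow_one]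
    _ ≤ (volume B ^ (s - 1) * (C * (D * (Mx P z * volume B)))) ^ (1 / s) := by gcongr
    _ = ((C * D) * Mx P z * volume B ^ s) ^ (1 / s) := by
        congr 1
        have : volume B ^ s = volume B ^ (s - 1) * volume B := by
          nth_rewrite 3 [← ENNReal.rpow_one (volume B)]
          rw [← ENNReal.rpow_add _ _ hV0 hVt]; congr 1; ring
        rw [this]; ring
    _ = _ := by
        rw [ENNReal.mul_rpow_of_nonneg _ _ (by positivity), ENNReal.mul_rpow_of_nonneg _ _ (by positivity),
          ← ENNReal.rpow_mul (volume B), mul_one_div_cancel hs0.ne', ENNReal.rpow_one]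

lemma osc_cv {K : X × Y → ℂ} {C A : ℝ≥0∞} (hK : Continuous K) (hX : HomSp X n D) (hH : HorK K A)
    {s : ℝ} (hs : 1 < s)
    (hC : ∀ f : X × Y → ℂ, Measurable f → ∫⁻ z, ‖cv K f z‖ₑ ^ s ≤ C * ∫⁻ z, ‖f z‖ₑ ^ s)
    {f : X × Y → ℂ} (hf : Measurable f) (hfi : Integrable f) :
    OscCtl (fun x => nY s (fun y => cv K f (x, y)))
      (fun z => ((C * D) ^ (1 / s) + A) * Mx (fun x => ∫⁻ y, ‖f (x, y)‖ₑ ^ s) z ^ (1 / s)) := by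
  intro c ρ hρ
  have hs0 : 0 < s := by linarith
  set S : Set (X × Y) := {w | w.1 ∈ Metric.ball c (7 * ρ)} with hS
  have hSm : MeasurableSet S := measurable_fst Metric.isOpen_ball.measurableSet
  set f1 : X × Y → ℂ := S.indicator f with hf1
  set f2 : X × Y → ℂ := Sᶜ.indicator f with hf2
  have hf1m : Measurable f1 := hf.indicator hSm
  have hf2m : Measurable f2 := hf.indicator hSm.compl
  have hf1i : Integrable f1 := hfi.indicator hSm
  have hf2i : Integrable f2 := hfi.indicator hSm.compl
  have hsum : f = fun w => f1 w + f2 w := by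
    ext w; exact (congrFun (Set.indicator_self_add_compl S f) w).symm
  have hcv : ∀ z, cv K f z = cv K f1 z + cv K f2 z := by
    intro z
    rw [← cv_add hK hf1i hf2i, ← hsum]
  have hm1 : Measurable (cv K f1) := (cv_cont hK hf1i).measurable
  have hm2 : Measurable (cv K f2) := (cv_cont hK hf2i).measurable
  have hm : Measurable (cv K f) := (cv_cont hK hfi).measurable
  have hsec : ∀ {g : X × Y → ℂ}, Measurable g → ∀ x, Measurable fun y => g (x, y) :=
    fun hg x => hg.comp (by fun_prop)
  have hmd : Measurable fun q : X × Y => cv K f2 q - cv K f2 (c, q.2) := by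
    refine hm2.sub (hm2.comp (by fun_prop))
  have hle1 : ∀ z, Mx (fun x => ∫⁻ y, ‖f1 (x, y)‖ₑ ^ s) z ≤ Mx (fun x => ∫⁻ y, ‖f (x, y)‖ₑ ^ s) z := by
    intro z
    refine Mx_mono (fun x => lintegral_mono fun y => ?_) z
    dsimp only
    gcongr
    exact enorm_indicator_le_enorm_self _ _
  have hle2 : ∀ z, Mx (fun x => ∫⁻ y, ‖f2 (x, y)‖ₑ ^ s) z ≤ Mx (fun x => ∫⁻ y, ‖f (x, y)‖ₑ ^ s) z := by
    intro z
    refine Mx_mono (fun x => lintegral_mono fun y => ?_) z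
    dsimp only
    gcongr
    exact enorm_indicator_le_enorm_self _ _
  refine ⟨nY s (fun y => cv K f2 (c, y)), fun x => nY s (fun y => cv K f1 (x, y)) +
    nY s (fun y => cv K f2 (x, y) - cv K f2 (c, y)), (nY_meas hm1).add (nY_meas hmd), ?_, ?_⟩
  · intro x hx
    constructor
    · calc nY s (fun y => cv K f (x, y)) = nY s (fun y => cv K f2 (c, y) +
            (cv K f1 (x, y) + (cv K f2 (x, y) - cv K f2 (c, y)))) := by
            congr 1; ext y; rw [hcv]; ring
        _ ≤ _ := by
            refine (nY_add hs.le (hsec hm2 c) ((hsec hm1 x).add (hsec hmd x))).trans ?_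
            gcongr
            exact nY_add hs.le (hsec hm1 x) (hsec hmd x)
    · have e1 : nY s (fun y => cv K f1 (x, y)) = nY s (fun y => - cv K f1 (x, y)) := by
        unfold nY; simp
      dsimp only
      rw [e1, nY_sub_comm (fun y => cv K f2 (x, y))]
      have hmd' : Measurable fun y => cv K f2 (c, y) - cv K f2 (x, y) := (hsec hm2 c).sub (hsec hm2 x)
      calc nY s (fun y => cv K f2 (c, y)) = nY s (fun y => cv K f (x, y) +
            (- cv K f1 (x, y) + (cv K f2 (c, y) - cv K f2 (x, y)))) := by
            congr 1; ext y; rw [hcv]; ring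
        _ ≤ _ := by
            refine (nY_add hs.le (hsec hm x) ((hsec hm1 x).neg.add hmd')).trans ?_
            gcongr
            exact nY_add hs.le (hsec hm1 x).neg hmd'
  · intro z hz
    set M := Mx (fun x => ∫⁻ y, ‖f (x, y)‖ₑ ^ s) z with hM
    rw [lintegral_add_left (nY_meas hm1)]
    have hn := near_part hK hX hs hC hf1m hf1i hρ hz (fun w hw => Set.indicator_of_notMem (s := S) hw f)
    have hfar : ∀ x ∈ Metric.ball c ρ, nY s (fun y => cv K f2 (x, y) - cv K f2 (c, y)) ≤ A * M ^ (1 / s) := by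
      intro x hx
      refine (far_part hK hX hH hs hf2m hf2i hρ hx hz (fun w hw => ?_)).trans ?_
      · exact Set.indicator_of_notMem (s := Sᶜ) (fun h => h hw) f
      · gcongr; exact hle2 z
    calc _ ≤ (C * D) ^ (1 / s) * M ^ (1 / s) * volume (Metric.ball c ρ) +
          ∫⁻ x in Metric.ball c ρ, A * M ^ (1 / s) := by
          gcongr ?_ + ?_
          · refine hn.trans ?_
            gcongr
            exact hle1 z
          · exact setLIntegral_mono' Metric.isOpen_ball.measurableSet hfar
      _ = _ := by rw [setLIntegral_const]; ring

/-- From `(s,s)` to `(r,s)`, `r > s`. -/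
lemma extrapolate (hX : HomSp X n D) {r s : ℝ} (hs : 1 < s) (hr : s < r) {C A : ℝ≥0∞}
    (hCt : C ≠ ∞) (hAt : A ≠ ∞) :
    ∃ C' : ℝ≥0∞, C' ≠ ∞ ∧ ∀ K : X × Y → ℂ, Continuous K → HorK K A →
      (∀ f : X × Y → ℂ, Measurable f → ∫⁻ z, ‖cv K f z‖ₑ ^ s ≤ C * ∫⁻ z, ‖f z‖ₑ ^ s) →
      ∀ f : X × Y → ℂ, Measurable f →
        ∫⁻ x, (∫⁻ y, ‖cv K f (x, y)‖ₑ ^ s) ^ (r / s) ≤ C' * ∫⁻ x, (∫⁻ y, ‖f (x, y)‖ₑ ^ s) ^ (r / s) := by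
  have hs0 : 0 < s := by linarith
  have hr0 : 0 < r := by linarith
  have hq : 1 < r / s := (one_lt_div hs0).2 hr
  have hq0 : 0 < r / s := by linarith
  obtain ⟨C1, hC1, hFS⟩ := fefferman_stein hX hr0
  obtain ⟨C2, hC2, hst⟩ := strong_type hX hq
  set c0 := (C * D) ^ (1 / s) + A with hc0
  have hc0t : c0 ≠ ∞ := ENNReal.add_ne_top.2 ⟨ENNReal.rpow_ne_top_of_nonneg (by positivity)
    (ENNReal.mul_ne_top hCt hX.ne_top), hAt⟩
  refine ⟨C1 * (c0 ^ r * C2 + C ^ (r / s)) + 1, ?_, ?_⟩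
  · refine ENNReal.add_ne_top.2 ⟨ENNReal.mul_ne_top hC1 (ENNReal.add_ne_top.2 ⟨ENNReal.mul_ne_top ?_ hC2, ?_⟩), by simp⟩
    · exact ENNReal.rpow_ne_top_of_nonneg hr0.le hc0t
    · exact ENNReal.rpow_ne_top_of_nonneg hq0.le hCt
  intro K hK hH hC f hf
  set P : X → ℝ≥0∞ := fun x => ∫⁻ y, ‖f (x, y)‖ₑ ^ s with hP
  have hPm : Measurable P :=
    Measurable.lintegral_prod_right' (f := fun z : X × Y => ‖f z‖ₑ ^ s) (by fun_prop)
  by_cases hfin : ∫⁻ x, P x ^ (r / s) = ∞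
  · rw [hfin, ENNReal.mul_top (by simp)]; exact le_top
  have hPint : (∫⁻ x, P x) ^ (r / s) ≤ ∫⁻ x, P x ^ (r / s) := jensen_le _ hPm.aemeasurable hq
  have hfs : ∫⁻ z, ‖f z‖ₑ ^ s = ∫⁻ x, P x := by
    rw [Measure.volume_eq_prod, lintegral_prod _ (hf.enorm.pow_const _).aemeasurable]
  have hfi : Integrable f := by
    refine ⟨hf.aestronglyMeasurable, ?_⟩
    rw [hasFiniteIntegral_iff_enorm]
    have h1 : (∫⁻ z, ‖f z‖ₑ) ^ s ≤ ∫⁻ z, ‖f z‖ₑ ^ s := jensen_le _ hf.enorm.aemeasurable hs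
    have h2 : ∫⁻ x, P x < ∞ := by
      refine (ENNReal.rpow_lt_top_iff_of_pos hq0).1 (hPint.trans_lt (lt_top_iff_ne_top.2 hfin))
    rw [hfs] at h1
    exact (ENNReal.rpow_lt_top_iff_of_pos hs0).1 (h1.trans_lt h2)
  have hosc := osc_cv hK hX hH hs hC hf hfi
  set G : X → ℝ≥0∞ := fun x => nY s (fun y => cv K f (x, y)) with hG
  have hcont : Continuous (cv K f) := cv_cont hK hfi
  have hGc : Continuous G := nY_cont hcont hs0
  obtain ⟨b, hb0, hb⟩ := bdd_of_cont hcont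
  have hGb : ∀ x, G x ≤ ENNReal.ofReal b := by
    intro x
    calc G x ≤ (∫⁻ y : Y, (ENNReal.ofReal b) ^ s) ^ (1 / s) := by
          rw [hG]; unfold nY
          refine ENNReal.rpow_le_rpow (lintegral_mono fun y => ENNReal.rpow_le_rpow ?_ hs0.le) (by positivity)
          rw [← ofReal_norm]
          exact ENNReal.ofReal_le_ofReal (hb _)
      _ = _ := by
          simp only [lintegral_const, measure_univ, mul_one]
          rw [← ENNReal.rpow_mul, mul_one_div_cancel hs0.ne', ENNReal.rpow_one]
  have hmain := hFS G _ hGc.measurable (((Mx_meas P).pow_const _).const_mul _) hosc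
    ⟨_, ENNReal.ofReal_ne_top, hGb⟩ (le_Mx_of_cont hX hGc)
  have hGr : ∀ x, (∫⁻ y, ‖cv K f (x, y)‖ₑ ^ s) ^ (r / s) = G x ^ r := by
    intro x
    rw [← nY_pow hs0, ← ENNReal.rpow_mul, mul_div_cancel₀ _ hs0.ne']
  simp_rw [hGr]
  have hHr : ∫⁻ x, (c0 * Mx P x ^ (1 / s)) ^ r ≤ c0 ^ r * (C2 * ∫⁻ x, P x ^ (r / s)) := by
    simp_rw [ENNReal.mul_rpow_of_nonneg _ _ hr0.le, ← ENNReal.rpow_mul, one_div_mul_eq_div]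
    rw [lintegral_const_mul _ ((Mx_meas P).pow_const _)]
    exact mul_le_mul_right (hst P hPm) _
  have hGi : (∫⁻ x, G x) ^ r ≤ C ^ (r / s) * ∫⁻ x, P x ^ (r / s) := by
    have h1 : (∫⁻ x, G x) ^ s ≤ C * ∫⁻ x, P x := by
      calc _ ≤ ∫⁻ x, G x ^ s := jensen_le _ hGc.measurable.aemeasurable hs
        _ = ∫⁻ z, ‖cv K f z‖ₑ ^ s := by
            rw [Measure.volume_eq_prod, lintegral_prod _ (hcont.measurable.enorm.pow_const _).aemeasurable]
            simp_rw [hG, nY_pow hs0]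
        _ ≤ _ := by rw [← hfs]; exact hC f hf
    calc (∫⁻ x, G x) ^ r = ((∫⁻ x, G x) ^ s) ^ (r / s) := by
          rw [← ENNReal.rpow_mul, mul_div_cancel₀ _ hs0.ne']
      _ ≤ (C * ∫⁻ x, P x) ^ (r / s) := by gcongr
      _ = C ^ (r / s) * (∫⁻ x, P x) ^ (r / s) := ENNReal.mul_rpow_of_nonneg _ _ hq0.le
      _ ≤ _ := by gcongr
  calc _ ≤ _ := hmain
    _ ≤ C1 * (c0 ^ r * (C2 * ∫⁻ x, P x ^ (r / s)) + C ^ (r / s) * ∫⁻ x, P x ^ (r / s)) := by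
        gcongr
    _ = (C1 * (c0 ^ r * C2 + C ^ (r / s))) * ∫⁻ x, P x ^ (r / s) := by ring
    _ ≤ _ := by gcongr; exact le_self_add

end Extrap

set_option linter.unusedSectionVars false
set_option linter.unusedVariables false
lemma min_sum_aux (J : ℕ) : ∀ t : ℝ, 0 < t →
    (1 ≤ t → ∑ j ∈ range J, min (2 ^ j * t) (1 / (2 ^ j * t)) ≤ 2 / t) ∧
    (t < 1 → ∑ j ∈ range J, min (2 ^ j * t) (1 / (2 ^ j * t)) ≤ 4 - 2 * t) := by
  induction J with
  | zero =>
    intro t ht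
    simp only [range_zero, sum_empty]
    exact ⟨fun _ => by positivity, fun _ => by linarith⟩
  | succ J ih =>
    intro t ht
    have e : ∑ j ∈ range (J + 1), min (2 ^ j * t) (1 / (2 ^ j * t)) =
        min t (1 / t) + ∑ j ∈ range J, min (2 ^ j * (2 * t)) (1 / (2 ^ j * (2 * t))) := by
      rw [sum_range_succ']
      simp only [pow_zero, one_mul, add_comm (min t (1/t))]
      congr 1
      refine sum_congr rfl fun j _ => ?_
      rw [pow_succ, mul_assoc]
    rw [e]
    obtain ⟨h1, h2⟩ := ih (2 * t) (by linarith)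
    constructor
    · intro h
      have h3 := h1 (by linarith)
      have h4 : min t (1 / t) ≤ 1 / t := min_le_right _ _
      have h5 : 2 / (2 * t) = 1 / t := by field_simp
      have h6 : 2 / t = 1 / t + 1 / t := by ring
      linarith
    · intro h
      have h4 : min t (1 / t) ≤ t := min_le_left _ _
      rcases lt_or_ge (2 * t) 1 with h' | h'
      · have := h2 h'; linarith
      · have h3 := h1 h'
        have h5 : 2 / (2 * t) = 1 / t := by field_simp
        have h6 : 1 / t ≤ 4 - 3 * t := by
          rw [div_le_iff₀ ht]; nlinarith
        linarith

lemma min_sum (J : ℕ) {t : ℝ} (ht : 0 < t) :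
    ∑ j ∈ range J, min (2 ^ j * t) (1 / (2 ^ j * t)) ≤ 4 := by
  obtain ⟨h1, h2⟩ := min_sum_aux J t ht
  rcases lt_or_ge t 1 with h | h
  · linarith [h2 h]
  · refine (h1 h).trans ?_
    rw [div_le_iff₀ ht]; linarith

section Weight
variable {X : Type*} [NormedAddCommGroup X] [MeasureSpace X] [BorelSpace X]
  [SecondCountableTopology X] [IsProbabilityMeasure (volume : Measure X)]
  {n : ℕ} {D : ℝ≥0∞}

/-- weight -/
def Wt (n : ℕ) (N t : ℝ) : ℝ := N ^ n * ((1 + N * t) ^ (n + 1))⁻¹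

lemma Wt_nonneg {n : ℕ} {N t : ℝ} (hN : 0 < N) (ht : 0 ≤ t) : 0 ≤ Wt n N t := by
  unfold Wt; positivity

lemma dyadic_pt (n : ℕ) {t : ℝ} (ht : 0 ≤ t) :
    ENNReal.ofReal (((1 + t) ^ (n + 1))⁻¹) ≤
      ∑' l : ℕ, ENNReal.ofReal (2 ^ (n + 1) * ((2 ^ l) ^ (n + 1))⁻¹) * (if t < 2 ^ l then 1 else 0) := by
  classical
  have hex : ∃ l : ℕ, t < 2 ^ l := pow_unbounded_of_one_lt t (by norm_num)
  refine le_trans ?_ (ENNReal.le_tsum (Nat.find hex))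
  rw [if_pos (Nat.find_spec hex), mul_one]
  refine ENNReal.ofReal_le_ofReal ?_
  have hle : (2:ℝ) ^ (Nat.find hex) ≤ 2 * (1 + t) := by
    rcases Nat.eq_zero_or_pos (Nat.find hex) with h0 | h0
    · rw [h0]; simp; linarith
    · have := Nat.find_min hex (m := Nat.find hex - 1) (by omega)
      push Not at this
      obtain ⟨q, hq⟩ : ∃ q, Nat.find hex = q + 1 := ⟨_, (Nat.succ_pred_eq_of_pos h0).symm⟩
      rw [hq] at this ⊢
      simp only [Nat.add_sub_cancel] at this
      rw [pow_succ]; linarith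
  rw [inv_le_iff_one_le_mul₀ (by positivity), mul_assoc, mul_comm, mul_assoc, ← mul_pow, ← div_eq_inv_mul,
    le_div_iff₀ (by positivity), one_mul]
  exact pow_le_pow_left₀ (by positivity) (by linarith) _

lemma weight_le (hX : HomSp X n D) {N : ℝ} (hN : 0 < N) {Φ : X → ℝ≥0∞} (hΦ : Measurable Φ) (z : X) :
    ∫⁻ u, ENNReal.ofReal (Wt n N ‖z - u‖) * Φ u ≤ ENNReal.ofReal (2 ^ (n + 2)) * D * Mx Φ z := by
  have h1 : ∀ u, ENNReal.ofReal (Wt n N ‖z - u‖) * Φ u ≤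
      ∑' l : ℕ, ENNReal.ofReal (N ^ n * (2 ^ (n + 1) * ((2 ^ l) ^ (n + 1))⁻¹)) *
        (Metric.ball z (2 ^ l / N)).indicator Φ u := by
    intro u
    unfold Wt
    rw [ENNReal.ofReal_mul (by positivity)]
    calc _ ≤ ENNReal.ofReal (N ^ n) * (∑' l : ℕ, ENNReal.ofReal (2 ^ (n + 1) * ((2 ^ l) ^ (n + 1))⁻¹) *
          (if N * ‖z - u‖ < 2 ^ l then 1 else 0)) * Φ u := by
          gcongr; exact dyadic_pt n (by positivity)
      _ = _ := by
          rw [← ENNReal.tsum_mul_left, ← ENNReal.tsum_mul_right]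
          refine tsum_congr fun l => ?_
          rw [ENNReal.ofReal_mul (by positivity : 0 ≤ N ^ n)]
          have : u ∈ Metric.ball z (2 ^ l / N) ↔ N * ‖z - u‖ < 2 ^ l := by
            rw [Metric.mem_ball, dist_comm, dist_eq_norm, lt_div_iff₀ hN, mul_comm]
          by_cases h : N * ‖z - u‖ < 2 ^ l
          · rw [Set.indicator_of_mem (this.2 h), if_pos h]; ring
          · rw [Set.indicator_of_notMem (fun h' => h (this.1 h')), if_neg h]; ring
  calc _ ≤ _ := lintegral_mono h1
    _ = ∑' l : ℕ, ENNReal.ofReal (N ^ n * (2 ^ (n + 1) * ((2 ^ l) ^ (n + 1))⁻¹)) *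
        ∫⁻ u in Metric.ball z (2 ^ l / N), Φ u := by
        rw [lintegral_tsum]
        · refine tsum_congr fun l => ?_
          rw [lintegral_const_mul _ (hΦ.indicator Metric.isOpen_ball.measurableSet),
            lintegral_indicator Metric.isOpen_ball.measurableSet]
        · intro l
          exact ((hΦ.indicator Metric.isOpen_ball.measurableSet).const_mul _).aemeasurable
    _ ≤ ∑' l : ℕ, ENNReal.ofReal (2 ^ (n + 1)) * D * Mx Φ z * (2⁻¹) ^ l := by
        refine ENNReal.tsum_le_tsum fun l => ?_
        have hρ : 0 < 2 ^ l / N := by positivity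
        calc _ ≤ ENNReal.ofReal (N ^ n * (2 ^ (n + 1) * ((2 ^ l) ^ (n + 1))⁻¹)) *
              (Mx Φ z * (D * ENNReal.ofReal ((2 ^ l / N) ^ n))) := by
              refine mul_le_mul_right ((hX.le_Mx Φ hρ (Metric.mem_ball_self hρ)).trans ?_) _
              exact mul_le_mul_right (hX.upper z _ hρ) _
          _ = (ENNReal.ofReal (N ^ n * (2 ^ (n + 1) * ((2 ^ l) ^ (n + 1))⁻¹)) *
              ENNReal.ofReal ((2 ^ l / N) ^ n)) * (D * Mx Φ z) := by ring
          _ = ENNReal.ofReal (2 ^ (n + 1) * (2⁻¹) ^ l) * (D * Mx Φ z) := by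
              rw [← ENNReal.ofReal_mul (by positivity)]
              congr 2
              rw [div_pow, inv_pow]
              field_simp
              ring
          _ = _ := by
              rw [ENNReal.ofReal_mul (by positivity), ENNReal.ofReal_pow (by positivity) l,
                ENNReal.ofReal_inv_of_pos (by norm_num)]
              simp only [ENNReal.ofReal_ofNat]
              ring
    _ = _ := by
        rw [ENNReal.tsum_mul_left, ENNReal.tsum_geometric, ENNReal.one_sub_inv_two, inv_inv,
          pow_succ 2 (n + 1), ENNReal.ofReal_mul (by positivity)]
        simp only [ENNReal.ofReal_ofNat]
        ring
end Weight

section Hor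
variable {X : Type*} [NormedAddCommGroup X] [MeasureSpace X] [BorelSpace X]
  [SecondCountableTopology X] [IsProbabilityMeasure (volume : Measure X)]
  {Y : Type*} [NormedAddCommGroup Y] [MeasureSpace Y] [BorelSpace Y]
  [SecondCountableTopology Y] [IsProbabilityMeasure (volume : Measure Y)]
  {n : ℕ} {D : ℝ≥0∞}

/-- kernel bounds at scale `1/N` -/
structure KB (n : ℕ) (A : ℝ≥0∞) (N : ℝ) (K : X × Y → ℂ) : Prop where
  cont : Continuous K
  size : ∀ x, ∫⁻ y, ‖K (x, y)‖ₑ ≤ A * ENNReal.ofReal (N ^ n * ((1 + N * ‖x‖) ^ (n + 2))⁻¹)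
  diff : ∀ x h, 2 * ‖h‖ ≤ ‖x‖ → ∫⁻ y, ‖K (x + h, y) - K (x, y)‖ₑ ≤
    A * ENNReal.ofReal (N * ‖h‖ * (N ^ n * ((1 + N * ‖x‖) ^ (n + 1))⁻¹))

lemma half_wt {N a b : ℝ} (hN : 0 < N) (ha : 0 ≤ a) (hb : a ≤ 2 * b) (p : ℕ) :
    ((1 + N * b) ^ p)⁻¹ ≤ 2 ^ p * ((1 + N * a) ^ p)⁻¹ := by
  have hb0 : 0 ≤ b := by linarith
  rw [inv_le_iff_one_le_mul₀ (by positivity), mul_right_comm, ← mul_pow, ← div_eq_mul_inv, le_div_iff₀ (by positivity),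
    one_mul]
  refine pow_le_pow_left₀ (by positivity) ?_ _
  nlinarith

lemma KB.ptwise {A : ℝ≥0∞} {N : ℝ} {K : X × Y → ℂ} (hK : KB n A N K) (hN : 0 < N)
    {c x z u : X} {ρ : ℝ} (hρ : 0 < ρ) (hx : x ∈ Metric.ball c ρ) (hz : z ∈ Metric.ball c ρ)
    (hu : u ∉ Metric.ball c (7 * ρ)) :
    ∫⁻ y, ‖K (x - u, y) - K (c - u, y)‖ₑ ≤
      A * ENNReal.ofReal (2 ^ (n + 3) * min (N * ρ) (1 / (N * ρ)) * Wt n N ‖z - u‖) := by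
  rw [Metric.mem_ball, dist_eq_norm] at hx hz hu
  push Not at hu
  rw [norm_sub_rev] at hu
  have hzu : ‖z - u‖ ≤ ‖z - c‖ + ‖c - u‖ := by
    simpa using norm_add_le (z - c) (c - u)
  have hxu : ‖c - u‖ ≤ ‖x - c‖ + ‖x - u‖ := by
    have := norm_sub_le (x - u) (x - c)
    simp only [sub_sub_sub_cancel_left] at this
    linarith
  have hzu' : ‖c - u‖ ≤ ‖z - c‖ + ‖z - u‖ := by
    have := norm_sub_le (z - u) (z - c)
    simp only [sub_sub_sub_cancel_left] at this
    linarith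
  have hc2 : ‖z - u‖ ≤ 2 * ‖c - u‖ := by linarith
  have hx2 : ‖z - u‖ ≤ 2 * ‖x - u‖ := by linarith
  have hz0 : 0 ≤ ‖z - u‖ := norm_nonneg _
  rw [min_def]
  split_ifs with hmin
  · have h1 := hK.diff (c - u) (x - c) (by linarith)
    have : c - u + (x - c) = x - u := by abel
    rw [this] at h1
    refine h1.trans (mul_le_mul_right (ENNReal.ofReal_le_ofReal ?_) _)
    unfold Wt
    calc _ ≤ N * ρ * (N ^ n * (2 ^ (n + 1) * ((1 + N * ‖z - u‖) ^ (n + 1))⁻¹)) := by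
          gcongr
          exact half_wt hN hz0 hc2 _
      _ = 2 ^ (n + 1) * (N * ρ * (N ^ n * ((1 + N * ‖z - u‖) ^ (n + 1))⁻¹)) := by ring
      _ ≤ 2 ^ (n + 3) * (N * ρ * (N ^ n * ((1 + N * ‖z - u‖) ^ (n + 1))⁻¹)) := by
          gcongr <;> norm_num
      _ = _ := by ring
  · have hb : ∀ b : ℝ, ‖z - u‖ ≤ 2 * b → N ^ n * ((1 + N * b) ^ (n + 2))⁻¹ ≤
        2 ^ (n + 2) * (1 / (N * ρ)) * Wt n N ‖z - u‖ := by
      intro b hb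
      calc _ ≤ N ^ n * (2 ^ (n + 2) * ((1 + N * ‖z - u‖) ^ (n + 2))⁻¹) := by
            gcongr; exact half_wt hN hz0 hb _
        _ = 2 ^ (n + 2) * (1 / (1 + N * ‖z - u‖)) * Wt n N ‖z - u‖ := by
            unfold Wt; rw [pow_succ (1 + N * ‖z - u‖) (n + 1), mul_inv, one_div]; ring
        _ ≤ _ := by
            have := Wt_nonneg (n := n) hN hz0
            gcongr
            nlinarith
    calc _ ≤ ∫⁻ y, (‖K (x - u, y)‖ₑ + ‖K (c - u, y)‖ₑ) := lintegral_mono fun y => enorm_sub_le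
      _ = (∫⁻ y, ‖K (x - u, y)‖ₑ) + ∫⁻ y, ‖K (c - u, y)‖ₑ := by
          rw [lintegral_add_left]
          have := hK.cont
          exact (by fun_prop : Continuous fun y => K (x - u, y)).measurable.enorm
      _ ≤ A * ENNReal.ofReal (2 ^ (n + 2) * (1 / (N * ρ)) * Wt n N ‖z - u‖) +
          A * ENNReal.ofReal (2 ^ (n + 2) * (1 / (N * ρ)) * Wt n N ‖z - u‖) := by
          refine add_le_add ((hK.size _).trans ?_) ((hK.size _).trans ?_)
          · exact mul_le_mul_right (ENNReal.ofReal_le_ofReal (hb _ hx2)) _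
          · exact mul_le_mul_right (ENNReal.ofReal_le_ofReal (hb _ hc2)) _
      _ = _ := by
          have := Wt_nonneg (n := n) hN hz0
          rw [← mul_add, ← ENNReal.ofReal_add (by positivity) (by positivity)]
          congr 2; ring

lemma horK_sum (hX : HomSp X n D) {A : ℝ≥0∞} {Kj : ℕ → X × Y → ℂ}
    (hK : ∀ j, KB n A (2 ^ j) (Kj j)) (J : ℕ) (ε : ℕ → ℂ) (hε : ∀ j, ‖ε j‖ ≤ 1) :
    HorK (fun z => ∑ j ∈ range J, ε j * Kj j z)
      (A * ENNReal.ofReal (2 ^ (n + 5)) * (ENNReal.ofReal (2 ^ (n + 2)) * D)) := by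
  intro c ρ hρ x hx z hz Φ hΦ
  set B := Metric.ball c (7 * ρ) with hB
  have hc : ∀ j (p : X), Continuous fun q : X × Y => Kj j (p - q.1, q.2) := by
    intro j p
    have := (hK j).cont
    fun_prop
  have hm : ∀ j, Measurable fun q : X × Y => ‖Kj j (x - q.1, q.2) - Kj j (c - q.1, q.2)‖ₑ :=
    fun j => ((hc j x).sub (hc j c)).measurable.enorm
  have hWm : Measurable fun u => ENNReal.ofReal (Wt n 1 ‖z - u‖) := by unfold Wt; fun_prop
  have hpt : ∀ u, (∫⁻ y, ‖(∑ j ∈ range J, ε j * Kj j (x - u, y)) - ∑ j ∈ range J, ε j * Kj j (c - u, y)‖ₑ) ≤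
      ∑ j ∈ range J, ∫⁻ y, ‖Kj j (x - u, y) - Kj j (c - u, y)‖ₑ := by
    intro u
    rw [← lintegral_finsetSum]
    · refine lintegral_mono fun y => ?_
      rw [← Finset.sum_sub_distrib]
      refine (enorm_sum_le _ _).trans (Finset.sum_le_sum fun j _ => ?_)
      rw [← mul_sub, enorm_mul]
      refine mul_le_of_le_one_left zero_le ?_
      rw [← ofReal_norm]
      exact ENNReal.ofReal_le_one.2 (hε j)
    · intro j _
      exact (hm j).comp (by fun_prop : Measurable fun y : Y => (u, y))
  calc _ ≤ ∫⁻ u in Bᶜ, ∑ j ∈ range J, (∫⁻ y, ‖Kj j (x - u, y) - Kj j (c - u, y)‖ₑ) * Φ u := by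
        refine lintegral_mono fun u => ?_
        dsimp only
        rw [← Finset.sum_mul]
        exact mul_le_mul_left (hpt u) _
    _ = ∑ j ∈ range J, ∫⁻ u in Bᶜ, (∫⁻ y, ‖Kj j (x - u, y) - Kj j (c - u, y)‖ₑ) * Φ u := by
        rw [lintegral_finsetSum]
        intro j _
        exact (Measurable.lintegral_prod_right' (hm j)).mul hΦ
    _ ≤ ∑ j ∈ range J, A * ENNReal.ofReal (2 ^ (n + 3) * min (2 ^ j * ρ) (1 / (2 ^ j * ρ))) *
          (ENNReal.ofReal (2 ^ (n + 2)) * D * Mx Φ z) := by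
        refine Finset.sum_le_sum fun j _ => ?_
        have hN : (0:ℝ) < 2 ^ j := by positivity
        calc _ ≤ ∫⁻ u in Bᶜ, A * ENNReal.ofReal (2 ^ (n + 3) * min (2 ^ j * ρ) (1 / (2 ^ j * ρ))) *
              (ENNReal.ofReal (Wt n (2 ^ j) ‖z - u‖) * Φ u) := by
              refine setLIntegral_mono' Metric.isOpen_ball.measurableSet.compl fun u hu => ?_
              rw [← mul_assoc]
              refine mul_le_mul_left (((hK j).ptwise hN hρ hx hz hu).trans (le_of_eq ?_)) _
              rw [ENNReal.ofReal_mul (by positivity), mul_assoc]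
          _ ≤ ∫⁻ u, A * ENNReal.ofReal (2 ^ (n + 3) * min (2 ^ j * ρ) (1 / (2 ^ j * ρ))) *
              (ENNReal.ofReal (Wt n (2 ^ j) ‖z - u‖) * Φ u) := setLIntegral_le_lintegral _ _
          _ = A * ENNReal.ofReal (2 ^ (n + 3) * min (2 ^ j * ρ) (1 / (2 ^ j * ρ))) *
              ∫⁻ u, (ENNReal.ofReal (Wt n (2 ^ j) ‖z - u‖) * Φ u) := by
              rw [lintegral_const_mul]
              refine Measurable.mul ?_ hΦ
              unfold Wt; fun_prop
          _ ≤ _ := mul_le_mul_right (weight_le hX hN hΦ z) _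
    _ = A * ENNReal.ofReal (2 ^ (n + 3) * ∑ j ∈ range J, min (2 ^ j * ρ) (1 / (2 ^ j * ρ))) *
          (ENNReal.ofReal (2 ^ (n + 2)) * D * Mx Φ z) := by
        rw [← Finset.sum_mul, ← Finset.mul_sum, Finset.mul_sum (R := ℝ),
          ENNReal.ofReal_sum_of_nonneg]
        intro j _
        positivity
    _ ≤ A * ENNReal.ofReal (2 ^ (n + 5)) * (ENNReal.ofReal (2 ^ (n + 2)) * D * Mx Φ z) := by
        gcongr
        calc _ ≤ (2:ℝ) ^ (n + 3) * 4 := by gcongr; exact min_sum J hρ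
          _ = _ := by ring
    _ = _ := by ring
end Hor

set_option linter.unusedSectionVars false
set_option linter.unusedVariables false

lemma circ_ball (x : AddCircle (1:ℝ)) {ρ : ℝ} (hρ : 0 < ρ) :
    ENNReal.ofReal (min 1 ρ) ≤ volume (Metric.ball x ρ) ∧
      volume (Metric.ball x ρ) ≤ ENNReal.ofReal (min 1 (2 * ρ)) := by
  constructor
  · calc _ = volume (Metric.closedBall x (ρ / 2)) := by
          rw [AddCircle.volume_closedBall]; congr 2; ring
      _ ≤ _ := measure_mono (Metric.closedBall_subset_ball (by linarith))
  · rw [← AddCircle.volume_closedBall]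
    exact measure_mono Metric.ball_subset_closedBall

instance : IsProbabilityMeasure (volume : Measure (AddCircle (1:ℝ))) :=
  ⟨by rw [AddCircle.measure_univ]; simp⟩

lemma torus_ball {m : ℕ} (x : Torus m) {ρ : ℝ} (hρ : 0 < ρ) :
    ENNReal.ofReal (min 1 ρ) ^ m ≤ volume (Metric.ball x ρ) ∧
      volume (Metric.ball x ρ) ≤ ENNReal.ofReal (min 1 (2 * ρ)) ^ m := by
  rw [ball_pi x hρ, volume_pi_pi]
  constructor
  · calc _ = ∏ i : Fin m, ENNReal.ofReal (min 1 ρ) := by simp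
      _ ≤ _ := Finset.prod_le_prod' fun i _ => (circ_ball (x i) hρ).1
  · calc _ ≤ ∏ i : Fin m, ENNReal.ofReal (min 1 (2 * ρ)) :=
          Finset.prod_le_prod' fun i _ => (circ_ball (x i) hρ).2
      _ = _ := by simp

lemma homSp_of {X : Type*} [NormedAddCommGroup X] [MeasureSpace X] {n : ℕ}
    (hb : ∀ x : X, ‖x‖ < 1)
    (h : ∀ (x : X) (ρ : ℝ), 0 < ρ → ENNReal.ofReal (min 1 ρ) ^ n ≤ volume (Metric.ball x ρ) ∧
      volume (Metric.ball x ρ) ≤ ENNReal.ofReal (min 1 (2 * ρ)) ^ n) :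
    HomSp X n (ENNReal.ofReal (14 ^ n)) where
  one_le := by
    rw [ENNReal.one_le_ofReal]; exact one_le_pow₀ (by norm_num)
  ne_top := ENNReal.ofReal_ne_top
  pos x ρ hρ := by
    refine (lt_of_lt_of_le ?_ (h x ρ hρ).1).ne'
    refine ENNReal.pow_pos ?_ _
    rw [ENNReal.ofReal_pos]; positivity
  dbl x y ρ hρ := by
    refine (h x (7 * ρ) (by linarith)).2.trans (le_trans ?_ (mul_le_mul_right (h y ρ hρ).1 _))
    rw [ENNReal.ofReal_pow (by norm_num), ← mul_pow, ← ENNReal.ofReal_mul (by norm_num)]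
    gcongr
    rcases le_total 1 ρ with h1 | h1
    · rw [min_eq_left h1]; linarith [min_le_left 1 (2 * (7 * ρ))]
    · rw [min_eq_right h1]; linarith [min_le_right 1 (2 * (7 * ρ))]
  bdd := hb
  upper x ρ hρ := by
    refine (h x ρ hρ).2.trans ?_
    rw [← ENNReal.ofReal_mul (by positivity), ← mul_pow, ← ENNReal.ofReal_pow (by positivity)]
    gcongr
    linarith [min_le_right 1 (2 * ρ)]

lemma circ_norm (x : AddCircle (1:ℝ)) : ‖x‖ ≤ 1 / 2 := by
  have := AddCircle.norm_le_half_period (1:ℝ) (x := x) (by norm_num)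
  simpa using this

lemma torus_norm {m : ℕ} (x : Torus m) : ‖x‖ < 1 := by
  refine lt_of_le_of_lt ((pi_norm_le_iff_of_nonneg (by norm_num)).2 fun i => circ_norm (x i)) (by norm_num)

lemma homSp_torus (m : ℕ) : HomSp (Torus m) m (ENNReal.ofReal (14 ^ m)) :=
  homSp_of torus_norm fun x ρ hρ => torus_ball x hρ

lemma homSp_prod (m k : ℕ) : HomSp (Torus m × Torus k) (m + k) (ENNReal.ofReal (14 ^ (m + k))) := by
  refine homSp_of (fun x => ?_) fun x ρ hρ => ?_
  · exact max_lt (torus_norm x.1) (torus_norm x.2)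
  · obtain ⟨x, y⟩ := x
    rw [← ball_prod_same, Measure.volume_eq_prod, Measure.prod_prod, pow_add, pow_add]
    exact ⟨mul_le_mul' (torus_ball x hρ).1 (torus_ball y hρ).1, mul_le_mul' (torus_ball x hρ).2 (torus_ball y hρ).2⟩

instance torusHaar (m k : ℕ) : (volume : Measure (Torus m × Torus k)).IsAddHaarMeasure :=
  Measure.prod.instIsAddHaarMeasure (volume : Measure (Torus m)) (volume : Measure (Torus k))

set_option linter.unusedSectionVars false
set_option linter.unusedVariables false

/-- frequency lattice -/
abbrev Lam (m k : ℕ) := (Fin m → ℤ) × (Fin k → ℤ)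
/-- product torus -/
abbrev Zt (m k : ℕ) := Torus m × Torus k
/-- frequency space -/
abbrev Eu (m k : ℕ) := (Fin m → ℝ) × (Fin k → ℝ)

section Chars
variable {m k : ℕ}

/-- characters of the product torus -/
def ch (ξ : Lam m k) (z : Zt m k) : ℂ := eChar ξ.1 z.1 * eChar ξ.2 z.2

lemma four_zadd (n : ℤ) (x y : AddCircle (1:ℝ)) : fourier n (x + y) = fourier n x * fourier n y := by
  simp [fourier_apply, smul_add, AddCircle.toCircle_add]

lemma eChar_add (ξ η : Fin m → ℤ) (z : Torus m) : eChar (ξ + η) z = eChar ξ z * eChar η z := by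
  unfold eChar
  rw [← Finset.prod_mul_distrib]
  simp

lemma eChar_zadd (ξ : Fin m → ℤ) (z w : Torus m) : eChar ξ (z + w) = eChar ξ z * eChar ξ w := by
  unfold eChar
  rw [← Finset.prod_mul_distrib]
  simp only [Pi.add_apply, four_zadd]

lemma eChar_norm (ξ : Fin m → ℤ) (z : Torus m) : ‖eChar ξ z‖ = 1 := by
  unfold eChar
  rw [norm_prod]
  simp only [fourier_apply, Circle.norm_coe, Finset.prod_const_one]

lemma eChar_zero (z : Torus m) : eChar 0 z = 1 := by
  unfold eChar; simp

lemma eChar_neg (ξ : Fin m → ℤ) (z : Torus m) : eChar (-ξ) z = conj (eChar ξ z) := by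
  unfold eChar
  rw [map_prod]
  simp

lemma eChar_zneg (ξ : Fin m → ℤ) (z : Torus m) : eChar ξ (-z) = conj (eChar ξ z) := by
  rw [← eChar_neg]
  unfold eChar
  simp [fourier_apply]

lemma eChar_cont (ξ : Fin m → ℤ) : Continuous (eChar ξ) := by
  unfold eChar; fun_prop

lemma ch_add (ξ η : Lam m k) (z : Zt m k) : ch (ξ + η) z = ch ξ z * ch η z := by
  simp only [ch, Prod.fst_add, Prod.snd_add, eChar_add]; ring

lemma ch_zadd (ξ : Lam m k) (z w : Zt m k) : ch ξ (z + w) = ch ξ z * ch ξ w := by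
  simp only [ch, Prod.fst_add, Prod.snd_add, eChar_zadd]; ring

lemma ch_norm (ξ : Lam m k) (z : Zt m k) : ‖ch ξ z‖ = 1 := by
  simp [ch, eChar_norm]

lemma ch_zero (z : Zt m k) : ch 0 z = 1 := by simp [ch, eChar_zero]

lemma ch_neg (ξ : Lam m k) (z : Zt m k) : ch (-ξ) z = conj (ch ξ z) := by
  simp [ch, eChar_neg]

lemma ch_zneg (ξ : Lam m k) (z : Zt m k) : ch ξ (-z) = conj (ch ξ z) := by
  simp [ch, eChar_zneg]

@[fun_prop] lemma ch_cont (ξ : Lam m k) : Continuous (ch ξ) := by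
  have := eChar_cont ξ.1
  have := eChar_cont ξ.2
  unfold ch
  fun_prop

lemma ch_zsub (ξ : Lam m k) (z w : Zt m k) : ch ξ (z - w) = ch ξ z * conj (ch ξ w) := by
  rw [sub_eq_add_neg, ch_zadd, ch_zneg]

lemma fcoef_eq (f : Zt m k → ℂ) (ξ : Lam m k) : fcoef f ξ = ∫ z, f z * conj (ch ξ z) := rfl

lemma circ_lift (x : AddCircle (1:ℝ)) : ∃ t : ℝ, (t : AddCircle (1:ℝ)) = x ∧ |t| = ‖x‖ ∧ |t| ≤ 1 / 2 := by
  induction x using QuotientAddGroup.induction_on with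
  | H t =>
  refine ⟨t - round t, ?_, ?_, abs_sub_round t⟩
  · have : ((round t : ℝ) : AddCircle (1:ℝ)) = 0 := by
      rw [AddCircle.coe_eq_zero_iff]
      exact ⟨round t, by simp⟩
    rw [AddCircle.coe_sub, this, sub_zero]
  · exact (UnitAddCircle.norm_eq (x := t)).symm

lemma circ_low (x : AddCircle (1:ℝ)) : 4 * ‖x‖ ≤ ‖fourier 1 x - 1‖ := by
  obtain ⟨t, rfl, ht, ht2⟩ := circ_lift x
  rw [← ht, fourier_coe_apply]
  have e : (2 * (π:ℂ) * I * ((1:ℤ):ℂ) * (t:ℂ) / ((1:ℝ):ℂ)) = I * ((2 * π * t : ℝ) : ℂ) := by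
    push_cast; ring
  rw [e, norm_exp_I_mul_ofReal_sub_one, norm_mul]
  have h1 : |π * t| ≤ π / 2 := by
    rw [abs_mul, abs_of_pos Real.pi_pos]
    nlinarith [Real.pi_pos]
  have h2 := Real.mul_abs_le_abs_sin h1
  rw [abs_mul, abs_of_pos Real.pi_pos, ← mul_assoc, div_mul_cancel₀ _ Real.pi_pos.ne'] at h2
  have e2 : 2 * π * t / 2 = π * t := by ring
  rw [e2]
  simp only [Real.norm_eq_abs, abs_two]
  linarith

/-- frequency box -/
def bx (m k L : ℕ) : Finset (Lam m k) :=
  _root_.box m L ×ˢ _root_.box k L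

lemma mem_bx {L : ℕ} {ξ : Lam m k} : ξ ∈ bx m k L ↔ (∀ i, |ξ.1 i| ≤ L) ∧ ∀ i, |ξ.2 i| ≤ L := by
  simp only [bx, _root_.box, Finset.mem_product, Finset.mem_Icc, Pi.le_def, abs_le]
  constructor
  · rintro ⟨⟨h1, h2⟩, h3, h4⟩; exact ⟨fun i => ⟨h1 i, h2 i⟩, fun i => ⟨h3 i, h4 i⟩⟩
  · rintro ⟨h1, h2⟩; exact ⟨⟨fun i => (h1 i).1, fun i => (h1 i).2⟩, fun i => (h2 i).1, fun i => (h2 i).2⟩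

lemma card_bx (L : ℕ) : (bx m k L).card = (2 * L + 1) ^ (m + k) := by
  unfold bx _root_.box
  rw [Finset.card_product, Pi.card_Icc, Pi.card_Icc]
  simp only [Int.card_Icc, Finset.prod_const, Finset.card_univ, Fintype.card_fin, pow_add]
  have : ((L:ℤ) + 1 - -L).toNat = 2 * L + 1 := by omega
  rw [this]

/-- trigonometric polynomial with coefficients `a` -/
def Ker (a : Lam m k → ℂ) (z : Zt m k) : ℂ := ∑' ξ, a ξ * ch ξ z

/-- support condition -/
def Spt (L : ℕ) (a : Lam m k → ℂ) : Prop := ∀ ξ, a ξ ≠ 0 → ξ ∈ bx m k L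

lemma Spt.ker {L : ℕ} {a : Lam m k → ℂ} (h : Spt L a) (z : Zt m k) :
    Ker a z = ∑ ξ ∈ bx m k L, a ξ * ch ξ z := by
  unfold Ker
  refine tsum_eq_sum fun ξ hξ => ?_
  have : a ξ = 0 := by by_contra h'; exact hξ (h ξ h')
  rw [this, zero_mul]

lemma Spt.cont {L : ℕ} {a : Lam m k → ℂ} (h : Spt L a) : Continuous (Ker a) := by
  have : Ker a = fun z => ∑ ξ ∈ bx m k L, a ξ * ch ξ z := funext h.ker
  rw [this]
  fun_prop

lemma Spt.bound {L : ℕ} {a : Lam m k → ℂ} (h : Spt L a) {c : ℝ} (hc : ∀ ξ, ‖a ξ‖ ≤ c) (z : Zt m k) :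
    ‖Ker a z‖ ≤ (2 * L + 1) ^ (m + k) * c := by
  rw [h.ker]
  calc _ ≤ ∑ ξ ∈ bx m k L, ‖a ξ * ch ξ z‖ := norm_sum_le _ _
    _ ≤ ∑ ξ ∈ bx m k L, c := Finset.sum_le_sum fun ξ _ => by rw [norm_mul, ch_norm, mul_one]; exact hc ξ
    _ = _ := by rw [Finset.sum_const, card_bx, nsmul_eq_mul]; push_cast; ring

lemma Spt.summable {L : ℕ} {a : Lam m k → ℂ} (h : Spt L a) (z : Zt m k) :
    Summable fun ξ => a ξ * ch ξ z := by
  refine summable_of_hasFiniteSupport ((bx m k L).finite_toSet.subset fun ξ hξ => ?_)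
  exact h ξ (left_ne_zero_of_mul hξ)

/-- difference operator on coefficients -/
def dl (b : Lam m k) (a : Lam m k → ℂ) (ξ : Lam m k) : ℂ := a (ξ - b) - a ξ

lemma Spt.mono {L L' : ℕ} {a : Lam m k → ℂ} (h : Spt L a) (hL : L ≤ L') : Spt L' a := by
  intro ξ hξ
  have := h ξ hξ
  rw [mem_bx] at this ⊢
  exact ⟨fun i => (this.1 i).trans (by exact_mod_cast hL), fun i => (this.2 i).trans (by exact_mod_cast hL)⟩

lemma Spt.shift {L : ℕ} {a : Lam m k → ℂ} (h : Spt L a) {b : Lam m k} (hb : b ∈ bx m k 1) :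
    Spt (L + 1) fun ξ => a (ξ - b) := by
  intro ξ hξ
  have := h _ hξ
  rw [mem_bx] at this hb ⊢
  constructor
  · intro i
    have h1 := this.1 i
    have h2 := hb.1 i
    simp only [Prod.fst_sub, Pi.sub_apply, abs_le, Nat.cast_add, Nat.cast_one] at h1 h2 ⊢
    omega
  · intro i
    have h1 := this.2 i
    have h2 := hb.2 i
    simp only [Prod.snd_sub, Pi.sub_apply, abs_le, Nat.cast_add, Nat.cast_one] at h1 h2 ⊢
    omega

lemma Spt.dl {L : ℕ} {a : Lam m k → ℂ} (h : Spt L a) {b : Lam m k} (hb : b ∈ bx m k 1) :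
    Spt (L + 1) (dl b a) := by
  intro ξ hξ
  by_cases h0 : a ξ = 0
  · refine h.shift hb ξ fun h1 => hξ ?_
    simp only [_root_.dl, h0, h1, sub_zero]
  · exact h.mono (Nat.le_succ L) ξ h0

lemma ker_dl {L : ℕ} {a : Lam m k → ℂ} (h : Spt L a) {b : Lam m k} (hb : b ∈ bx m k 1) (z : Zt m k) :
    Ker (dl b a) z = (ch b z - 1) * Ker a z := by
  unfold Ker dl
  simp_rw [sub_mul]
  rw [((h.shift hb).summable z).tsum_sub (h.summable z), one_mul]
  congr 1
  rw [← (Equiv.addRight b).tsum_eq, ← tsum_mul_left]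
  refine tsum_congr fun ξ => ?_
  simp only [Equiv.coe_addRight, add_sub_cancel_right, ch_add]
  ring

lemma dl_iter {L : ℕ} {a : Lam m k → ℂ} (h : Spt L a) {b : Lam m k} (hb : b ∈ bx m k 1) (M : ℕ) :
    Spt (L + M) ((dl b)^[M] a) ∧ ∀ z, Ker ((dl b)^[M] a) z = (ch b z - 1) ^ M * Ker a z := by
  induction M with
  | zero => exact ⟨h, fun z => by simp⟩
  | succ M ih =>
    rw [Function.iterate_succ_apply']
    refine ⟨ih.1.dl hb, fun z => ?_⟩
    rw [ker_dl ih.1 hb, ih.2, pow_succ]; ring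

/-- smooth symbols supported in the ball of radius two -/
structure SC (χ : Eu m k → ℝ) : Prop where
  smooth : ContDiff ℝ (⊤ : ℕ∞) χ
  supp : ∀ v, 2 < ‖v‖ → χ v = 0

/-- difference operator on symbols -/
def Dl (h : ℝ) (w : Eu m k) (χ : Eu m k → ℝ) (v : Eu m k) : ℝ := χ (v - h • w) - χ v

lemma SC.bdd {χ : Eu m k → ℝ} (hχ : SC χ) : ∃ C, 0 ≤ C ∧ ∀ v, |χ v| ≤ C := by
  obtain ⟨C, hC⟩ := (isCompact_closedBall (0 : Eu m k) 2).exists_bound_of_continuousOn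
    (f := χ) hχ.smooth.continuous.continuousOn
  refine ⟨C, (norm_nonneg _).trans (hC 0 (by simp)), fun v => ?_⟩
  by_cases hv : ‖v‖ ≤ 2
  · exact hC v (by simpa using hv)
  · rw [hχ.supp v (not_le.1 hv)]
    simpa using (norm_nonneg _).trans (hC 0 (by simp))

lemma SC.dir {χ : Eu m k → ℝ} (hχ : SC χ) (w : Eu m k) : SC (fun v => fderiv ℝ χ v w) := by
  refine ⟨?_, fun v hv => ?_⟩
  · have := hχ.smooth.fderiv_right (m := (⊤ : ℕ∞)) (by simp)
    exact this.clm_apply contDiff_const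
  · have : χ =ᶠ[nhds v] fun _ => 0 := by
      have : {u : Eu m k | 2 < ‖u‖} ∈ nhds v := (isOpen_lt continuous_const continuous_norm).mem_nhds hv
      filter_upwards [this] with u hu using hχ.supp u hu
    rw [this.fderiv_eq]; simp

lemma Dl_deriv {w : Eu m k} {χ χ' : Eu m k → ℝ} (h : ℝ)
    (hd : ∀ v t, HasDerivAt (fun t : ℝ => χ (v + t • w)) (χ' (v + t • w)) t) (M : ℕ) :
    ∀ v t, HasDerivAt (fun t : ℝ => (Dl h w)^[M] χ (v + t • w)) ((Dl h w)^[M] χ' (v + t • w)) t := by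
  induction M with
  | zero => exact hd
  | succ M ih =>
    intro v t
    simp only [Function.iterate_succ_apply']
    unfold Dl
    refine HasDerivAt.sub ?_ (ih v t)
    have := ih (v - h • w) t
    have e : ∀ t : ℝ, v - h • w + t • w = v + t • w - h • w := fun t => by abel
    simp only [e] at this
    exact this

lemma SC.Dl_bound {w : Eu m k} (M : ℕ) : ∀ {χ : Eu m k → ℝ}, SC χ →
    ∃ C : ℝ, 0 ≤ C ∧ ∀ h : ℝ, 0 ≤ h → ∀ v, |(Dl h w)^[M] χ v| ≤ C * h ^ M := by
  induction M with
  | zero => 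
    intro χ hχ
    obtain ⟨C, h0, h⟩ := hχ.bdd
    exact ⟨C, h0, fun t ht v => by simpa using h v⟩
  | succ M ih =>
    intro χ hχ
    obtain ⟨C, hC0, hC⟩ := ih (hχ.dir w)
    refine ⟨C, hC0, fun h hh v => ?_⟩
    have hd : ∀ v t, HasDerivAt (fun t : ℝ => χ (v + t • w)) (fderiv ℝ χ (v + t • w) w) t := by
      intro v t
      have h1 : HasFDerivAt χ (fderiv ℝ χ (v + t • w)) (v + t • w) :=
        (hχ.smooth.differentiable (by simp) _).hasFDerivAt
      have h2 : HasDerivAt (fun t : ℝ => v + t • w) w t := by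
        simpa using ((hasDerivAt_id t).smul_const w).const_add v
      exact h1.comp_hasDerivAt t h2
    have hdM := Dl_deriv (χ := χ) (χ' := fun v => fderiv ℝ χ v w) (w := w) h hd M
    rw [Function.iterate_succ_apply']
    unfold Dl
    have hmv := (convex_univ (𝕜 := ℝ) (E := ℝ)).norm_image_sub_le_of_norm_hasDerivWithin_le
      (f := fun t : ℝ => (Dl h w)^[M] χ (v + t • w))
      (f' := fun t => (Dl h w)^[M] (fun v => fderiv ℝ χ v w) (v + t • w)) (C := C * h ^ M) (x := 0) (y := -h)
      (fun t _ => (hdM v t).hasDerivWithinAt) (fun t _ => hC h hh _) (Set.mem_univ _) (Set.mem_univ _)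
    simp only [neg_smul, zero_smul, add_zero, ← sub_eq_add_neg, Real.norm_eq_abs, sub_zero, abs_neg,
      abs_of_nonneg hh] at hmv
    calc _ ≤ _ := hmv
      _ = _ := by ring

/-- coefficients from a rescaled symbol -/
def sy (χ : Eu m k → ℝ) (N : ℝ) (ξ : Lam m k) : ℂ := (χ (N⁻¹ • latCoe ξ) : ℂ)

lemma latCoe_sub (ξ η : Lam m k) : latCoe (ξ - η) = latCoe ξ - latCoe η := by
  ext i <;> simp [latCoe]

lemma sy_iter (χ : Eu m k → ℝ) (N : ℝ) (b : Lam m k) (M : ℕ) :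
    (dl b)^[M] (sy χ N) = sy ((Dl N⁻¹ (latCoe b))^[M] χ) N := by
  induction M with
  | zero => rfl
  | succ M ih =>
    rw [Function.iterate_succ_apply', Function.iterate_succ_apply', ih]
    ext ξ
    simp only [dl, sy, Dl, latCoe_sub, smul_sub]
    push_cast; rfl

lemma SC.spt {χ : Eu m k → ℝ} (hχ : SC χ) {N : ℝ} (hN : 1 ≤ N) : Spt ⌈2 * N⌉₊ (sy χ N) := by
  intro ξ hξ
  have hN0 : 0 < N := by linarith
  have h1 : ‖N⁻¹ • latCoe ξ‖ ≤ 2 := by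
    by_contra hcon
    exact hξ (by simp [sy, hχ.supp _ (not_le.1 hcon)])
  rw [norm_smul, norm_inv, Real.norm_of_nonneg hN0.le, ← div_eq_inv_mul, div_le_iff₀ hN0] at h1
  have h2 : 2 * N ≤ ⌈2 * N⌉₊ := Nat.le_ceil _
  have h3 := (norm_prod_le_iff.1 (h1.trans h2))
  rw [mem_bx]
  constructor
  · intro i
    have := (norm_le_pi_norm (latCoe ξ).1 i).trans h3.1
    simp only [latCoe, Real.norm_eq_abs] at this
    exact_mod_cast this
  · intro i
    have := (norm_le_pi_norm (latCoe ξ).2 i).trans h3.2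
    simp only [latCoe, Real.norm_eq_abs] at this
    exact_mod_cast this

end Chars

set_option linter.unusedSectionVars false
set_option linter.unusedVariables false

section KerBounds
variable {m k : ℕ}

lemma exists_coord (z : Zt m k) : ∃ b ∈ bx m k 1, 4 * ‖z‖ ≤ ‖ch b z - 1‖ := by
  by_contra hcon
  push Not at hcon
  have h0 : 0 < ‖z‖ := by
    have := hcon 0 (by rw [mem_bx]; simp)
    simp [ch_zero] at this
    simpa using this
  have h1 : ∀ i, ‖z.1 i‖ < ‖z‖ := by
    intro i
    have := hcon (Pi.single i 1, 0) (by
      rw [mem_bx]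
      refine ⟨fun j => ?_, fun j => by simp⟩
      by_cases hj : j = i
      · subst hj; simp
      · simp [hj])
    have e : ch (Pi.single i 1, (0 : Fin k → ℤ)) z = fourier 1 (z.1 i) := by
      simp only [ch, eChar_zero, mul_one]
      unfold eChar
      rw [Finset.prod_eq_single i]
      · simp
      · intro j _ hj; simp [hj]
      · simp
    rw [e] at this
    linarith [circ_low (z.1 i)]
  have h2 : ∀ i, ‖z.2 i‖ < ‖z‖ := by
    intro i
    have := hcon (0, Pi.single i 1) (by
      rw [mem_bx]
      refine ⟨fun j => by simp, fun j => ?_⟩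
      by_cases hj : j = i
      · subst hj; simp
      · simp [hj])
    have e : ch ((0 : Fin m → ℤ), Pi.single i 1) z = fourier 1 (z.2 i) := by
      simp only [ch, eChar_zero, one_mul]
      unfold eChar
      rw [Finset.prod_eq_single i]
      · simp
      · intro j _ hj; simp [hj]
      · simp
    rw [e] at this
    linarith [circ_low (z.2 i)]
  have h3 : ‖z.1‖ < ‖z‖ := (pi_norm_lt_iff h0).2 h1
  have h4 : ‖z.2‖ < ‖z‖ := (pi_norm_lt_iff h0).2 h2
  have h5 : ‖z‖ = max ‖z.1‖ ‖z.2‖ := rfl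
  exact absurd (max_lt h3 h4) (by rw [← h5]; exact lt_irrefl _)

lemma ker_dir {χ : Eu m k → ℝ} (hχ : SC χ) {b : Lam m k} (hb : b ∈ bx m k 1) (M : ℕ) :
    ∃ C : ℝ, 0 ≤ C ∧ ∀ N : ℝ, 1 ≤ N → ∀ z, (N * ‖ch b z - 1‖) ^ M * ‖Ker (sy χ N) z‖ ≤ C * N ^ (m + k) := by
  obtain ⟨C, hC0, hC⟩ := hχ.Dl_bound (w := latCoe b) M
  refine ⟨(7 + 2 * M) ^ (m + k) * C, by positivity, fun N hN z => ?_⟩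
  have hN0 : 0 < N := by linarith
  obtain ⟨h1, h2⟩ := dl_iter (hχ.spt hN) hb M
  have h3 := h1.bound (c := C * N⁻¹ ^ M) (fun ξ => by
    rw [sy_iter, sy, Complex.norm_real]
    exact hC _ (by positivity) _) z
  rw [h2, norm_mul, norm_pow] at h3
  have h4 : (2 * ((⌈2 * N⌉₊ + M : ℕ) : ℝ) + 1) ≤ (7 + 2 * M) * N := by
    have := (Nat.ceil_lt_add_one (a := 2 * N) (by positivity)).le
    push_cast
    have hM : (0:ℝ) ≤ M := by positivity
    nlinarith
  calc (N * ‖ch b z - 1‖) ^ M * ‖Ker (sy χ N) z‖ = N ^ M * (‖ch b z - 1‖ ^ M * ‖Ker (sy χ N) z‖) := by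
        rw [mul_pow]; ring
    _ ≤ N ^ M * ((2 * ((⌈2 * N⌉₊ + M : ℕ) : ℝ) + 1) ^ (m + k) * (C * N⁻¹ ^ M)) := by gcongr
    _ ≤ N ^ M * (((7 + 2 * M) * N) ^ (m + k) * (C * N⁻¹ ^ M)) := by gcongr
    _ = (7 + 2 * M) ^ (m + k) * C * N ^ (m + k) * (N ^ M * N⁻¹ ^ M) := by rw [mul_pow]; ring
    _ = _ := by rw [← mul_pow, mul_inv_cancel₀ hN0.ne', one_pow, mul_one]

lemma ker_size {χ : Eu m k → ℝ} (hχ : SC χ) (M : ℕ) :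
    ∃ C : ℝ, 0 ≤ C ∧ ∀ N : ℝ, 1 ≤ N → ∀ z,
      ‖Ker (sy χ N) z‖ ≤ C * (N ^ (m + k) * ((1 + N * ‖z‖) ^ M)⁻¹) := by
  have hz : (0 : Lam m k) ∈ bx m k 1 := by rw [mem_bx]; simp
  obtain ⟨C0, hC00, hC0⟩ := ker_dir hχ hz 0
  have := fun b : bx m k 1 => ker_dir hχ b.2 M
  choose C hC1 hC using this
  refine ⟨2 ^ M * (C0 + ∑ b, C b), ?_, fun N hN z => ?_⟩
  · have := Finset.sum_nonneg fun b (_ : b ∈ (Finset.univ : Finset (bx m k 1))) => hC1 b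
    positivity
  have hN0 : 0 < N := by linarith
  obtain ⟨b, hb, hbz⟩ := exists_coord z
  have h1 := hC ⟨b, hb⟩ N hN z
  have h2 := hC0 N hN z
  rw [pow_zero, one_mul] at h2
  have h3 : C ⟨b, hb⟩ ≤ ∑ b, C b := Finset.single_le_sum (f := C) (fun b _ => hC1 b) (Finset.mem_univ _)
  have h4 : (N * ‖z‖) ^ M * ‖Ker (sy χ N) z‖ ≤ (∑ b, C b) * N ^ (m + k) := by
    calc _ ≤ (N * ‖ch b z - 1‖) ^ M * ‖Ker (sy χ N) z‖ := by
          gcongr; linarith [norm_nonneg z]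
      _ ≤ _ := h1
      _ ≤ _ := by gcongr
  rw [← mul_assoc, ← div_eq_mul_inv, le_div_iff₀ (by positivity)]
  have h5 : (1 + N * ‖z‖) ^ M ≤ 2 ^ M * (1 + (N * ‖z‖) ^ M) := by
    calc _ ≤ 2 ^ (M - 1) * (1 ^ M + (N * ‖z‖) ^ M) := add_pow_le zero_le_one (by positivity) M
      _ ≤ _ := by
        rw [one_pow]
        gcongr
        · norm_num
        · omega
  calc _ ≤ ‖Ker (sy χ N) z‖ * (2 ^ M * (1 + (N * ‖z‖) ^ M)) := by gcongr
    _ = 2 ^ M * (‖Ker (sy χ N) z‖ + (N * ‖z‖) ^ M * ‖Ker (sy χ N) z‖) := by ring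
    _ ≤ 2 ^ M * (C0 * N ^ (m + k) + (∑ b, C b) * N ^ (m + k)) := by gcongr
    _ = _ := by ring

/-- coordinates -/
def co (i : Fin m ⊕ Fin k) (v : Eu m k) : ℝ := Sum.elim v.1 v.2 i

lemma co_contDiff (i : Fin m ⊕ Fin k) : ContDiff ℝ (⊤ : ℕ∞) (co i : Eu m k → ℝ) := by
  unfold co
  rcases i with i | i
  · simp only [Sum.elim_inl]; fun_prop
  · simp only [Sum.elim_inr]; fun_prop

lemma co_le (i : Fin m ⊕ Fin k) (v : Eu m k) : |co i v| ≤ ‖v‖ := by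
  rcases i with i | i
  · exact (norm_le_pi_norm v.1 i).trans (norm_fst_le v)
  · exact (norm_le_pi_norm v.2 i).trans (norm_snd_le v)

lemma co_smul (i : Fin m ⊕ Fin k) (c : ℝ) (v : Eu m k) : co i (c • v) = c * co i v := by
  rcases i with i | i <;> simp [co]

lemma SC.co {χ : Eu m k → ℝ} (hχ : SC χ) (i : Fin m ⊕ Fin k) : SC (fun v => co i v * χ v) :=
  ⟨(co_contDiff i).mul hχ.smooth, fun v hv => by rw [hχ.supp v hv, mul_zero]⟩

/-- covering map -/
def pr (v : Eu m k) : Zt m k := (fun i => (v.1 i : AddCircle (1:ℝ)), fun i => (v.2 i : AddCircle (1:ℝ)))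

lemma circ_coe_le (t : ℝ) : ‖(t : AddCircle (1:ℝ))‖ ≤ |t| := by
  rw [UnitAddCircle.norm_eq]
  simpa using round_le t 0

lemma pr_le (v : Eu m k) : ‖pr v‖ ≤ ‖v‖ := by
  rw [norm_prod_le_iff]
  constructor
  · rw [pi_norm_le_iff_of_nonneg (norm_nonneg _)]
    exact fun i => (circ_coe_le _).trans ((norm_le_pi_norm v.1 i).trans (norm_fst_le v))
  · rw [pi_norm_le_iff_of_nonneg (norm_nonneg _)]
    exact fun i => (circ_coe_le _).trans ((norm_le_pi_norm v.2 i).trans (norm_snd_le v))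

lemma pr_surj (z : Zt m k) : ∃ v, pr v = z ∧ ‖v‖ ≤ ‖z‖ := by
  have h1 := fun i => circ_lift (z.1 i)
  have h2 := fun i => circ_lift (z.2 i)
  choose a ha ha' _ using h1
  choose b hb hb' _ using h2
  refine ⟨(a, b), ?_, ?_⟩
  · ext i
    · exact ha i
    · exact hb i
  · rw [norm_prod_le_iff]
    constructor
    · rw [pi_norm_le_iff_of_nonneg (norm_nonneg _)]
      exact fun i => by
        rw [Real.norm_eq_abs, ha']
        exact (norm_le_pi_norm z.1 i).trans (norm_fst_le z)
    · rw [pi_norm_le_iff_of_nonneg (norm_nonneg _)]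
      exact fun i => by
        rw [Real.norm_eq_abs, hb']
        exact (norm_le_pi_norm z.2 i).trans (norm_snd_le z)

lemma ch_pr (ξ : Lam m k) (v : Eu m k) :
    ch ξ (pr v) = Complex.exp (2 * π * I * ∑ i, ((co i (latCoe ξ) * co i v : ℝ) : ℂ)) := by
  rw [Fintype.sum_sum_type, mul_add, Complex.exp_add, Finset.mul_sum, Finset.mul_sum, Complex.exp_sum,
    Complex.exp_sum]
  unfold ch eChar pr
  congr 1
  · refine Finset.prod_congr rfl fun i _ => ?_
    rw [fourier_coe_apply]
    congr 1
    simp [co, latCoe]; ring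
  · refine Finset.prod_congr rfl fun i _ => ?_
    rw [fourier_coe_apply]
    congr 1
    simp [co, latCoe]; ring

lemma ch_path (ξ : Lam m k) (z : Zt m k) (v : Eu m k) (t : ℝ) :
    HasDerivAt (fun t : ℝ => ch ξ (z + pr (t • v)))
      ((2 * π * I * ∑ i, ((co i (latCoe ξ) * co i v : ℝ) : ℂ)) * ch ξ (z + pr (t • v))) t := by
  have e : ∀ t : ℝ, ch ξ (z + pr (t • v)) =
      ch ξ z * Complex.exp ((t : ℂ) * (2 * π * I * ∑ i, ((co i (latCoe ξ) * co i v : ℝ) : ℂ))) := by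
    intro t
    rw [ch_zadd, ch_pr]
    congr 2
    simp only [co_smul, Finset.mul_sum]
    refine Finset.sum_congr rfl fun i _ => ?_
    push_cast; ring
  simp only [e]
  generalize (2 * π * I * ∑ i, ((co i (latCoe ξ) * co i v : ℝ) : ℂ)) = c
  have h1 : HasDerivAt (fun t : ℝ => (t : ℂ) * c) c t := by
    simpa using (Complex.ofRealCLM.hasDerivAt (x := t)).mul_const c
  have h2 := (h1.cexp).const_mul (ch ξ z)
  refine h2.congr_deriv ?_
  ring

lemma ker_path {χ : Eu m k → ℝ} (hχ : SC χ) {N : ℝ} (hN : 1 ≤ N) (z : Zt m k) (v : Eu m k) (t : ℝ) :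
    HasDerivAt (fun t : ℝ => Ker (sy χ N) (z + pr (t • v)))
      (2 * π * I * N * ∑ i, (co i v : ℂ) * Ker (sy (fun u => co i u * χ u) N) (z + pr (t • v))) t := by
  have hN0 : (N : ℂ) ≠ 0 := by exact_mod_cast (by linarith : N ≠ 0)
  have h0 := hχ.spt hN
  simp only [h0.ker, ((hχ.co _).spt hN).ker]
  have := HasDerivAt.fun_sum (u := bx m k ⌈2 * N⌉₊) (x := t)
    (A := fun ξ t => sy χ N ξ * ch ξ (z + pr (t • v))) (fun ξ _ => (ch_path ξ z v t).const_mul (sy χ N ξ))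
  refine this.congr_deriv (Eq.symm ?_)
  simp only [Finset.mul_sum]
  rw [Finset.sum_comm]
  refine Finset.sum_congr rfl fun ξ _ => ?_
  rw [Finset.sum_mul, Finset.mul_sum]
  refine Finset.sum_congr rfl fun i _ => ?_
  simp only [sy, co_smul]
  push_cast
  field_simp

lemma ker_diff {χ : Eu m k → ℝ} (hχ : SC χ) (M : ℕ) :
    ∃ C : ℝ, 0 ≤ C ∧ ∀ N : ℝ, 1 ≤ N → ∀ z h, 2 * ‖h‖ ≤ ‖z‖ →
      ‖Ker (sy χ N) (z + h) - Ker (sy χ N) z‖ ≤ C * (N * ‖h‖ * (N ^ (m + k) * ((1 + N * ‖z‖) ^ M)⁻¹)) := by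
  have := fun i : Fin m ⊕ Fin k => ker_size (hχ.co i) M
  choose C hC0 hC using this
  have hS0 : 0 ≤ ∑ i, C i := Finset.sum_nonneg fun i _ => hC0 i
  refine ⟨2 * π * (∑ i, C i) * 2 ^ M, by positivity, fun N hN z h hzh => ?_⟩
  have hN0 : 0 < N := by linarith
  obtain ⟨v, rfl, hv⟩ := pr_surj h
  set B : ℝ := 2 * π * (∑ i, C i) * 2 ^ M * (N * ‖pr v‖ * (N ^ (m + k) * ((1 + N * ‖z‖) ^ M)⁻¹)) with hB
  have key := norm_image_sub_le_of_norm_deriv_le_segment_01'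
    (f := fun t : ℝ => Ker (sy χ N) (z + pr (t • v)))
    (f' := fun t => 2 * π * I * N * ∑ i, (co i v : ℂ) * Ker (sy (fun u => co i u * χ u) N) (z + pr (t • v)))
    (C := B) (fun t _ => (ker_path hχ hN z v t).hasDerivWithinAt) (fun t ht => ?_)
  · have e0 : pr ((0:ℝ) • v) = 0 := by ext i <;> simp [pr]
    simpa only [one_smul, e0, add_zero] using key
  · have hz : ‖z‖ ≤ 2 * ‖z + pr (t • v)‖ := by
      have h1 : ‖pr (t • v)‖ ≤ ‖pr v‖ := by
        refine (pr_le _).trans ?_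
        rw [norm_smul, Real.norm_of_nonneg ht.1]
        nlinarith [norm_nonneg v, ht.2]
      have h2 := norm_sub_le (z + pr (t • v)) (pr (t • v))
      rw [add_sub_cancel_right] at h2
      linarith
    have h3 := half_wt hN0 (norm_nonneg z) hz M
    have h4 : ‖∑ i, (co i v : ℂ) * Ker (sy (fun u => co i u * χ u) N) (z + pr (t • v))‖ ≤
        ∑ i, ‖pr v‖ * (C i * (N ^ (m + k) * (2 ^ M * ((1 + N * ‖z‖) ^ M)⁻¹))) := by
      refine (norm_sum_le _ _).trans (Finset.sum_le_sum fun i _ => ?_)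
      rw [norm_mul, Complex.norm_real]
      gcongr
      · exact (co_le i v).trans hv
      · refine (hC i N hN _).trans ?_
        have := hC0 i
        gcongr
    have h5 : ‖(2 * π * I * N : ℂ)‖ = 2 * π * N := by
      simp [abs_of_pos Real.pi_pos, abs_of_pos hN0]
    rw [norm_mul, h5]
    calc _ ≤ 2 * π * N * (∑ i, ‖pr v‖ * (C i * (N ^ (m + k) * (2 ^ M * ((1 + N * ‖z‖) ^ M)⁻¹)))) := by gcongr
      _ = B := by
        rw [← Finset.mul_sum, ← Finset.sum_mul, hB]; ring

end KerBounds

set_option linter.unusedSectionVars false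
set_option linter.unusedVariables false

section LPKer
variable {m k : ℕ}

lemma norm_le_eLen (v : Eu m k) : ‖v‖ ≤ eLen v := by
  rw [norm_prod_le_iff]
  have h0 : 0 ≤ eLen v := Real.sqrt_nonneg _
  have n1 : 0 ≤ ∑ i, v.1 i ^ 2 := Finset.sum_nonneg fun i _ => sq_nonneg _
  have n2 : 0 ≤ ∑ i, v.2 i ^ 2 := Finset.sum_nonneg fun i _ => sq_nonneg _
  constructor
  · rw [pi_norm_le_iff_of_nonneg h0]
    intro i
    refine Real.abs_le_sqrt ?_
    have := Finset.single_le_sum (f := fun i => v.1 i ^ 2) (fun i _ => sq_nonneg _) (Finset.mem_univ i)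
    linarith
  · rw [pi_norm_le_iff_of_nonneg h0]
    intro i
    refine Real.abs_le_sqrt ?_
    have := Finset.single_le_sum (f := fun i => v.2 i ^ 2) (fun i _ => sq_nonneg _) (Finset.mem_univ i)
    linarith

lemma eLen_smul (c : ℝ) (v : Eu m k) : eLen (c • v) = |c| * eLen v := by
  unfold eLen
  have : (∑ i, (c • v).1 i ^ 2) + ∑ i, (c • v).2 i ^ 2 = c ^ 2 * ((∑ i, v.1 i ^ 2) + ∑ i, v.2 i ^ 2) := by
    simp only [Prod.smul_fst, Prod.smul_snd, Pi.smul_apply, smul_eq_mul, mul_pow, mul_add, Finset.mul_sum]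
  rw [this, Real.sqrt_mul (sq_nonneg c), Real.sqrt_sq_eq_abs]

variable {φ : Eu m k → ℝ}

lemma IsLPCutoff.sc (hφ : IsLPCutoff φ) : SC φ :=
  ⟨hφ.smooth, fun v hv => hφ.eq_zero v (hv.le.trans (norm_le_eLen v))⟩

/-- annular cutoff -/
def psi0 (φ : Eu m k → ℝ) (v : Eu m k) : ℝ := φ v - φ ((2:ℝ) • v)

lemma IsLPCutoff.sc_psi (hφ : IsLPCutoff φ) : SC (psi0 φ) := by
  have h := hφ.sc
  refine ⟨h.smooth.sub (h.smooth.comp (contDiff_const_smul _)), fun v hv => ?_⟩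
  unfold psi0
  rw [h.supp v hv, h.supp, sub_zero]
  rw [norm_smul]
  norm_num
  linarith

/-- symbols as complex functions -/
def ps (φ : Eu m k → ℝ) (j : ℕ) (ξ : Lam m k) : ℂ := (psiCut φ j ξ : ℂ)

lemma ps_zero : ps φ 0 = sy φ 1 := by
  ext ξ; simp [ps, psiCut, sy]

lemma ps_succ (j : ℕ) : ps φ (j + 1) = sy (psi0 φ) (2 ^ (j + 1)) := by
  ext ξ
  simp only [ps, psiCut, sy, psi0, Nat.succ_ne_zero, if_false, add_tsub_cancel_right, smul_smul]
  congr 3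
  rw [pow_succ, mul_inv, mul_comm (2:ℝ), mul_assoc]
  norm_num

lemma IsLPCutoff.spt (hφ : IsLPCutoff φ) (j : ℕ) : Spt (2 ^ (j + 1)) (ps φ j) := by
  have e : ∀ j : ℕ, ⌈(2:ℝ) * 2 ^ j⌉₊ = 2 ^ (j + 1) := by
    intro j
    rw [show (2:ℝ) * 2 ^ j = ((2 ^ (j + 1) : ℕ) : ℝ) by push_cast; ring, Nat.ceil_natCast]
  rcases j with _ | j
  · rw [ps_zero]
    have := hφ.sc.spt le_rfl
    simpa using this
  · rw [ps_succ, ← e (j + 1)]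
    exact hφ.sc_psi.spt (one_le_pow₀ one_le_two)

/-- Littlewood-Paley kernels -/
def pk (φ : Eu m k → ℝ) (j : ℕ) : Zt m k → ℂ := Ker (ps φ j)

lemma IsLPCutoff.pk_cont (hφ : IsLPCutoff φ) (j : ℕ) : Continuous (pk φ j) := (hφ.spt j).cont

lemma IsLPCutoff.pk_size (hφ : IsLPCutoff φ) (M : ℕ) : ∃ C : ℝ, 0 ≤ C ∧ ∀ j z,
    ‖pk φ j z‖ ≤ C * ((2 ^ j) ^ (m + k) * ((1 + 2 ^ j * ‖z‖) ^ M)⁻¹) := by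
  obtain ⟨C, hC0, hC⟩ := ker_size hφ.sc M
  obtain ⟨C', hC0', hC'⟩ := ker_size hφ.sc_psi M
  refine ⟨C + C', by positivity, fun j z => ?_⟩
  rcases j with _ | j
  · rw [pk, ps_zero, pow_zero]
    refine (hC 1 le_rfl z).trans ?_
    gcongr; linarith
  · rw [pk, ps_succ]
    refine (hC' (2 ^ (j + 1)) (one_le_pow₀ one_le_two) z).trans ?_
    gcongr; linarith

lemma IsLPCutoff.pk_diff (hφ : IsLPCutoff φ) (M : ℕ) : ∃ C : ℝ, 0 ≤ C ∧ ∀ j z h, 2 * ‖h‖ ≤ ‖z‖ →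
    ‖pk φ j (z + h) - pk φ j z‖ ≤ C * (2 ^ j * ‖h‖ * ((2 ^ j) ^ (m + k) * ((1 + 2 ^ j * ‖z‖) ^ M)⁻¹)) := by
  obtain ⟨C, hC0, hC⟩ := ker_diff hφ.sc M
  obtain ⟨C', hC0', hC'⟩ := ker_diff hφ.sc_psi M
  refine ⟨C + C', by positivity, fun j z h hz => ?_⟩
  rcases j with _ | j
  · rw [pk, ps_zero, pow_zero]
    refine (hC 1 le_rfl z h hz).trans ?_
    gcongr; linarith
  · rw [pk, ps_succ]
    refine (hC' (2 ^ (j + 1)) (one_le_pow₀ one_le_two) z h hz).trans ?_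
    gcongr; linarith

lemma enorm_le_of {a : ℂ} {b : ℝ} (h : ‖a‖ ≤ b) : ‖a‖ₑ ≤ ENNReal.ofReal b := by
  rw [← ofReal_norm]; exact ENNReal.ofReal_le_ofReal h

lemma IsLPCutoff.kb_full (hφ : IsLPCutoff φ) : ∃ A : ℝ≥0∞, A ≠ ∞ ∧ ∀ j,
    KB (X := Zt m k) (Y := Torus 0) (m + k) A (2 ^ j) (fun p => pk φ j p.1) := by
  obtain ⟨C, hC0, hC⟩ := hφ.pk_size (m + k + 2)
  obtain ⟨C', hC0', hC'⟩ := hφ.pk_diff (m + k + 1)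
  refine ⟨ENNReal.ofReal (C + C'), ENNReal.ofReal_ne_top, fun j => ⟨(hφ.pk_cont j).comp continuous_fst, ?_, ?_⟩⟩
  · intro x
    simp only []
    rw [lintegral_const, measure_univ, mul_one, ← ENNReal.ofReal_mul (by positivity)]
    refine enorm_le_of ((hC j x).trans ?_)
    gcongr; linarith
  · intro x h hh
    simp only []
    rw [lintegral_const, measure_univ, mul_one, ← ENNReal.ofReal_mul (by positivity)]
    refine enorm_le_of ((hC' j x h hh).trans ?_)
    gcongr; linarith

lemma split_wt {N a b : ℝ} (hN : 0 < N) (ha : 0 ≤ a) (hb : 0 ≤ b) (p q : ℕ) :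
    N ^ (m + k) * ((1 + N * max a b) ^ (p + q))⁻¹ ≤ (N ^ m * ((1 + N * a) ^ p)⁻¹) * (N ^ k * ((1 + N * b) ^ q)⁻¹) := by
  have h1 : ((1 + N * max a b) ^ (p + q))⁻¹ ≤ ((1 + N * a) ^ p)⁻¹ * ((1 + N * b) ^ q)⁻¹ := by
    rw [← mul_inv]
    refine inv_anti₀ (by positivity) ?_
    rw [pow_add]
    gcongr
    · exact le_max_left _ _
    · exact le_max_right _ _
  calc _ ≤ N ^ (m + k) * (((1 + N * a) ^ p)⁻¹ * ((1 + N * b) ^ q)⁻¹) := by gcongr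
    _ = _ := by rw [pow_add]; ring

lemma int_wt (k : ℕ) {N : ℝ} (hN : 0 < N) : ∫⁻ y : Torus k, ENNReal.ofReal (N ^ k * ((1 + N * ‖y‖) ^ (k + 1))⁻¹) ≤
    ENNReal.ofReal (2 ^ (k + 2)) * ENNReal.ofReal (14 ^ k) := by
  have h := weight_le (homSp_torus k) hN (Φ := fun _ => 1) measurable_const 0
  simp only [zero_sub, norm_neg, mul_one, Wt] at h
  refine h.trans ?_
  have h1 : Mx (fun _ : Torus k => (1:ℝ≥0∞)) 0 ≤ 1 := Mx_one_le (homSp_torus k) 0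
  calc _ ≤ ENNReal.ofReal (2 ^ (k + 2)) * ENNReal.ofReal (14 ^ k) * 1 := by gcongr
    _ = _ := mul_one _

lemma IsLPCutoff.kb_mix (hφ : IsLPCutoff φ) : ∃ A : ℝ≥0∞, A ≠ ∞ ∧ ∀ j,
    KB (X := Torus m) (Y := Torus k) m A (2 ^ j) (pk φ j) := by
  obtain ⟨C, hC0, hC⟩ := hφ.pk_size (m + 2 + (k + 1))
  obtain ⟨C', hC0', hC'⟩ := hφ.pk_diff (m + 1 + (k + 1))
  refine ⟨ENNReal.ofReal (C + C') * (ENNReal.ofReal (2 ^ (k + 2)) * ENNReal.ofReal (14 ^ k)),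
    by finiteness, fun j => ⟨hφ.pk_cont j, ?_, ?_⟩⟩
  · intro x
    have hN : (0:ℝ) < 2 ^ j := by positivity
    calc _ ≤ ∫⁻ y : Torus k, ENNReal.ofReal ((C + C') * ((2 ^ j) ^ m * ((1 + 2 ^ j * ‖x‖) ^ (m + 2))⁻¹)) *
          ENNReal.ofReal ((2 ^ j) ^ k * ((1 + 2 ^ j * ‖y‖) ^ (k + 1))⁻¹) := by
          refine lintegral_mono fun y => ?_
          rw [← ENNReal.ofReal_mul (by positivity)]
          refine enorm_le_of ((hC j (x, y)).trans ?_)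
          calc _ ≤ C * (((2 ^ j) ^ m * ((1 + 2 ^ j * ‖x‖) ^ (m + 2))⁻¹) * ((2 ^ j) ^ k * ((1 + 2 ^ j * ‖y‖) ^ (k + 1))⁻¹)) := by
                refine mul_le_mul_of_nonneg_left ?_ hC0
                exact split_wt hN (norm_nonneg x) (norm_nonneg y) (m + 2) (k + 1)
            _ ≤ (C + C') * (((2 ^ j) ^ m * ((1 + 2 ^ j * ‖x‖) ^ (m + 2))⁻¹) * ((2 ^ j) ^ k * ((1 + 2 ^ j * ‖y‖) ^ (k + 1))⁻¹)) := by
                gcongr; linarith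
            _ = _ := by ring
      _ ≤ ENNReal.ofReal ((C + C') * ((2 ^ j) ^ m * ((1 + 2 ^ j * ‖x‖) ^ (m + 2))⁻¹)) *
          (ENNReal.ofReal (2 ^ (k + 2)) * ENNReal.ofReal (14 ^ k)) := by
          rw [lintegral_const_mul' _ _ ENNReal.ofReal_ne_top]
          gcongr
          exact int_wt k hN
      _ = _ := by rw [ENNReal.ofReal_mul (by positivity)]; ring
  · intro x h hh
    have hN : (0:ℝ) < 2 ^ j := by positivity
    calc _ ≤ ∫⁻ y : Torus k, ENNReal.ofReal ((C + C') * (2 ^ j * ‖h‖ * ((2 ^ j) ^ m * ((1 + 2 ^ j * ‖x‖) ^ (m + 1))⁻¹))) *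
          ENNReal.ofReal ((2 ^ j) ^ k * ((1 + 2 ^ j * ‖y‖) ^ (k + 1))⁻¹) := by
          refine lintegral_mono fun y => ?_
          rw [← ENNReal.ofReal_mul (by positivity)]
          have e0 : ‖((h, 0) : Zt m k)‖ = ‖h‖ := by
            change max ‖h‖ ‖(0 : Torus k)‖ = ‖h‖
            rw [norm_zero]; exact max_eq_left (norm_nonneg _)
          have := hC' j (x, y) (h, 0) (by rw [e0]; exact hh.trans (le_max_left _ _))
          rw [e0, Prod.mk_add_mk, add_zero] at this
          refine enorm_le_of (this.trans ?_)
          calc _ ≤ C' * (2 ^ j * ‖h‖ * (((2 ^ j) ^ m * ((1 + 2 ^ j * ‖x‖) ^ (m + 1))⁻¹) * ((2 ^ j) ^ k * ((1 + 2 ^ j * ‖y‖) ^ (k + 1))⁻¹))) := by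
                refine mul_le_mul_of_nonneg_left (mul_le_mul_of_nonneg_left ?_ (by positivity)) hC0'
                exact split_wt hN (norm_nonneg x) (norm_nonneg y) (m + 1) (k + 1)
            _ ≤ (C + C') * (2 ^ j * ‖h‖ * (((2 ^ j) ^ m * ((1 + 2 ^ j * ‖x‖) ^ (m + 1))⁻¹) * ((2 ^ j) ^ k * ((1 + 2 ^ j * ‖y‖) ^ (k + 1))⁻¹))) := by
                gcongr; linarith
            _ = _ := by ring
      _ ≤ ENNReal.ofReal ((C + C') * (2 ^ j * ‖h‖ * ((2 ^ j) ^ m * ((1 + 2 ^ j * ‖x‖) ^ (m + 1))⁻¹))) *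
          (ENNReal.ofReal (2 ^ (k + 2)) * ENNReal.ofReal (14 ^ k)) := by
          rw [lintegral_const_mul' _ _ ENNReal.ofReal_ne_top]
          gcongr
          exact int_wt k hN
      _ = _ := by rw [ENNReal.ofReal_mul (by positivity)]; ring

end LPKer

set_option linter.unusedSectionVars false
set_option linter.unusedVariables false

section Mixed
variable {X : Type*} [MeasureSpace X] {Y : Type*} [MeasureSpace Y]
  [IsProbabilityMeasure (volume : Measure X)] [IsProbabilityMeasure (volume : Measure Y)]

/-- inner norm -/
def iN (s : ℝ) (u : X × Y → ℝ≥0∞) (x : X) : ℝ≥0∞ := (∫⁻ y, u (x, y) ^ s) ^ (1 / s)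

/-- mixed norm of an extended nonnegative function -/
def MN (r s : ℝ) (u : X × Y → ℝ≥0∞) : ℝ≥0∞ := (∫⁻ x, iN s u x ^ r) ^ (1 / r)

lemma iN_meas {s : ℝ} {u : X × Y → ℝ≥0∞} (hu : Measurable u) : Measurable (iN s u) :=
  ((hu.pow_const s).lintegral_prod_right').pow_const _

lemma iN_pow {s : ℝ} (hs : 0 < s) (u : X × Y → ℝ≥0∞) (x : X) : iN s u x ^ s = ∫⁻ y, u (x, y) ^ s := by
  rw [iN, ← ENNReal.rpow_mul, one_div_mul_cancel hs.ne', ENNReal.rpow_one]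

lemma MN_pow {r s : ℝ} (hr : 0 < r) (u : X × Y → ℝ≥0∞) : MN r s u ^ r = ∫⁻ x, iN s u x ^ r := by
  rw [MN, ← ENNReal.rpow_mul, one_div_mul_cancel hr.ne', ENNReal.rpow_one]

lemma MN_pow' {r s : ℝ} (hr : 0 < r) (hs : 0 < s) (u : X × Y → ℝ≥0∞) :
    MN r s u ^ r = ∫⁻ x, (∫⁻ y, u (x, y) ^ s) ^ (r / s) := by
  rw [MN_pow hr]
  congr 1; ext x
  rw [iN, ← ENNReal.rpow_mul]
  congr 1; field_simp

lemma MN_diag {s : ℝ} (hs : 0 < s) {u : X × Y → ℝ≥0∞} (hu : Measurable u) :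
    MN s s u ^ s = ∫⁻ z, u z ^ s := by
  rw [MN_pow hs, Measure.volume_eq_prod, lintegral_prod _ (by fun_prop)]
  simp only [iN_pow hs]

lemma iN_mono {s : ℝ} (hs : 0 < s) {u v : X × Y → ℝ≥0∞} {x : X} (h : ∀ᵐ y, u (x, y) ≤ v (x, y)) : iN s u x ≤ iN s v x := by
  unfold iN
  gcongr ?_ ^ _
  refine lintegral_mono_ae ?_
  filter_upwards [h] with y hy
  gcongr

lemma MN_mono_ae {r s : ℝ} (hr : 0 < r) (hs : 0 < s) {u v : X × Y → ℝ≥0∞} (h : ∀ᵐ z, u z ≤ v z) : MN r s u ≤ MN r s v := by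
  unfold MN
  gcongr ?_ ^ _
  rw [Measure.volume_eq_prod] at h
  refine lintegral_mono_ae ?_
  filter_upwards [Measure.ae_ae_of_ae_prod h] with x hx
  have := iN_mono hs hx
  gcongr

lemma MN_mono {r s : ℝ} (hr : 0 < r) (hs : 0 < s) {u v : X × Y → ℝ≥0∞} (h : ∀ z, u z ≤ v z) : MN r s u ≤ MN r s v :=
  MN_mono_ae hr hs (Filter.Eventually.of_forall h)

lemma MN_congr_ae {r s : ℝ} (hr : 0 < r) (hs : 0 < s) {u v : X × Y → ℝ≥0∞} (h : ∀ᵐ z, u z = v z) : MN r s u = MN r s v :=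
  le_antisymm (MN_mono_ae hr hs (h.mono fun _ h => h.le)) (MN_mono_ae hr hs (h.mono fun _ h => h.ge))

lemma iN_const_mul {s : ℝ} (hs : 0 < s) (c : ℝ≥0∞) {u : X × Y → ℝ≥0∞} (hu : Measurable u) (x : X) :
    iN s (fun z => c * u z) x = c * iN s u x := by
  unfold iN
  simp only [ENNReal.mul_rpow_of_nonneg _ _ hs.le]
  rw [lintegral_const_mul _ (by fun_prop), ENNReal.mul_rpow_of_nonneg _ _ (by positivity), ← ENNReal.rpow_mul,
    mul_one_div_cancel hs.ne', ENNReal.rpow_one]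

lemma MN_const_mul {r s : ℝ} (hr : 0 < r) (hs : 0 < s) (c : ℝ≥0∞) {u : X × Y → ℝ≥0∞} (hu : Measurable u) :
    MN r s (fun z => c * u z) = c * MN r s u := by
  unfold MN
  simp only [iN_const_mul hs c hu, ENNReal.mul_rpow_of_nonneg _ _ hr.le]
  rw [lintegral_const_mul _ ((iN_meas hu).pow_const _), ENNReal.mul_rpow_of_nonneg _ _ (by positivity), ← ENNReal.rpow_mul,
    mul_one_div_cancel hr.ne', ENNReal.rpow_one]

lemma iN_add {s : ℝ} (hs : 1 ≤ s) {u v : X × Y → ℝ≥0∞} (hu : Measurable u) (hv : Measurable v) (x : X) :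
    iN s (fun z => u z + v z) x ≤ iN s u x + iN s v x :=
  ENNReal.lintegral_Lp_add_le (f := fun y => u (x, y)) (g := fun y => v (x, y))
    (hu.comp measurable_prodMk_left).aemeasurable (hv.comp measurable_prodMk_left).aemeasurable hs

lemma MN_add {r s : ℝ} (hr : 1 ≤ r) (hs : 1 ≤ s) {u v : X × Y → ℝ≥0∞} (hu : Measurable u) (hv : Measurable v) :
    MN r s (fun z => u z + v z) ≤ MN r s u + MN r s v := by
  refine le_trans ?_ (ENNReal.lintegral_Lp_add_le (f := iN s u) (g := iN s v)
    (iN_meas hu).aemeasurable (iN_meas hv).aemeasurable hr)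
  unfold MN
  gcongr ?_ ^ _
  refine lintegral_mono fun x => ?_
  have := iN_add hs hu hv x
  simp only [Pi.add_apply]
  gcongr

lemma MN_zero {r s : ℝ} (hr : 0 < r) (hs : 0 < s) : MN r s (fun _ : X × Y => 0) = 0 := by
  unfold MN iN
  simp [hr, hs]

lemma MN_sum {r s : ℝ} (hr : 1 ≤ r) (hs : 1 ≤ s) {ι : Type*} (S : Finset ι) {u : ι → X × Y → ℝ≥0∞}
    (hu : ∀ i, Measurable (u i)) : MN r s (fun z => ∑ i ∈ S, u i z) ≤ ∑ i ∈ S, MN r s (u i) := by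
  classical
  induction S using Finset.induction_on with
  | empty => simp [MN_zero (X := X) (Y := Y) (by linarith : 0 < r) (by linarith : 0 < s)]
  | insert a S ha ih =>
    simp only [Finset.sum_insert ha]
    exact (MN_add hr hs (hu a) (Finset.measurable_fun_sum _ fun i _ => hu i)).trans (by gcongr)

lemma MN_holder {r r' s s' : ℝ} (hr : r.HolderConjugate r') (hs : s.HolderConjugate s') {u v : X × Y → ℝ≥0∞}
    (hu : Measurable u) (hv : Measurable v) : ∫⁻ z, u z * v z ≤ MN r s u * MN r' s' v := by
  rw [Measure.volume_eq_prod, lintegral_prod _ (by fun_prop)]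
  refine le_trans (lintegral_mono fun x => ?_) (ENNReal.lintegral_mul_le_Lp_mul_Lq volume hr
    (f := iN s u) (g := iN s' v) (iN_meas hu).aemeasurable (iN_meas hv).aemeasurable)
  exact ENNReal.lintegral_mul_le_Lp_mul_Lq volume hs (f := fun y => u (x, y)) (g := fun y => v (x, y))
    (hu.comp measurable_prodMk_left).aemeasurable (hv.comp measurable_prodMk_left).aemeasurable

lemma MN_one {r s : ℝ} : MN r s (fun _ : X × Y => 1) = 1 := by
  simp [MN, iN]

lemma L1_le_MN {r s : ℝ} (hr : 1 < r) (hs : 1 < s) {u : X × Y → ℝ≥0∞} (hu : Measurable u) :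
    ∫⁻ z, u z ≤ MN r s u := by
  have := MN_holder (Real.HolderConjugate.conjExponent hr) (Real.HolderConjugate.conjExponent hs) hu (measurable_const (a := 1))
  simpa [MN_one] using this

lemma MN_iSup {r s : ℝ} (hr : 0 < r) (hs : 0 < s) {u : ℕ → X × Y → ℝ≥0∞} (hu : ∀ i, Measurable (u i))
    (hm : Monotone u) {B : ℝ≥0∞} (hB : ∀ i, MN r s (u i) ≤ B) : MN r s (fun z => ⨆ i, u i z) ≤ B := by
  have e1 : ∀ x, iN s (fun z => ⨆ i, u i z) x = ⨆ i, iN s (u i) x := by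
    intro x
    unfold iN
    have : ∀ y, (⨆ i, u i (x, y)) ^ s = ⨆ i, u i (x, y) ^ s := fun y =>
      (ENNReal.orderIsoRpow s hs).map_iSup _
    simp only [this]
    rw [lintegral_iSup (fun i => by have := hu i; fun_prop) (fun i j hij y => by
      have := hm hij (x, y)
      simp only
      gcongr)]
    exact (ENNReal.orderIsoRpow (1 / s) (by positivity)).map_iSup _
  unfold MN
  have : ∀ x, (⨆ i, iN s (u i) x) ^ r = ⨆ i, iN s (u i) x ^ r := fun x =>
      (ENNReal.orderIsoRpow r hr).map_iSup _
  simp only [e1, this]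
  rw [lintegral_iSup (fun i => (iN_meas (hu i)).pow_const _) (fun i j hij x => by
      have := iN_mono hs (u := u i) (v := u j) (x := x) (Filter.Eventually.of_forall fun y => hm hij (x, y))
      simp only
      gcongr)]
  rw [show (⨆ i, ∫⁻ x, iN s (u i) x ^ r) ^ (1 / r) = ⨆ i, (∫⁻ x, iN s (u i) x ^ r) ^ (1 / r) from
    (ENNReal.orderIsoRpow (1 / r) (by positivity)).map_iSup _]
  exact iSup_le hB

lemma MN_liminf {r s : ℝ} (hr : 0 < r) (hs : 0 < s) {u : ℕ → X × Y → ℝ≥0∞} (hu : ∀ i, Measurable (u i))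
    {B : ℝ≥0∞} (hB : ∀ i, MN r s (u i) ≤ B) : MN r s (fun z => Filter.liminf (fun i => u i z) Filter.atTop) ≤ B := by
  simp only [Filter.liminf_eq_iSup_iInf_of_nat]
  refine MN_iSup hr hs (u := fun n z => ⨅ i, ⨅ (_ : i ≥ n), u i z) (fun n => ?_) ?_ fun n => ?_
  · exact Measurable.iInf fun i => Measurable.iInf fun _ => hu i
  · intro a b hab z
    refine le_iInf fun i => le_iInf fun hi => ?_
    exact iInf_le_of_le i (iInf_le _ (hab.trans hi))
  · exact (MN_mono hr hs fun z => iInf_le_of_le n (iInf_le _ le_rfl)).trans (hB n)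

end Mixed

set_option linter.unusedSectionVars false
set_option linter.unusedVariables false

section Dual
variable {m k : ℕ}

/-- the dual function -/
lemma dual_fun {r r' s s' : ℝ} (hr : r.HolderConjugate r') (hs : s.HolderConjugate s') {F : Zt m k → ℂ}
    (hF : Continuous F) : ∃ g : Zt m k → ℂ, Measurable g ∧ MN r' s' (fun z => ‖g z‖ₑ) ≤ MN r s (fun z => ‖F z‖ₑ) ^ (r - 1) ∧
      MN r s (fun z => ‖F z‖ₑ) ≠ ∞ ∧
      MN r s (fun z => ‖F z‖ₑ) ^ r = ‖∫ z, F z * g z‖ₑ ∧ ∀ z, ∃ c : ℝ, 0 ≤ c ∧ F z * g z = c := by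
  obtain ⟨B, hB⟩ := isCompact_univ.exists_bound_of_continuousOn hF.continuousOn
  have hB' : ∀ z, ‖F z‖ₑ ≤ ENNReal.ofReal B := fun z => enorm_le_of (hB z trivial)
  have hr0 := hr.pos
  have hs0 := hs.pos
  have hr1 := hr.lt
  have hs1 := hs.lt
  have hFm : Measurable fun z => ‖F z‖ₑ := hF.measurable.enorm
  set u : Zt m k → ℝ≥0∞ := fun z => ‖F z‖ₑ with hu
  have hiN : ∀ x, iN s u x ≠ ∞ := by
    intro x
    refine ne_top_of_le_ne_top (b := iN s (fun _ : Zt m k => ENNReal.ofReal B) x) ?_ (iN_mono hs0 (Filter.Eventually.of_forall fun y => hB' _))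
    simp only [iN, lintegral_const, measure_univ, mul_one]
    finiteness
  have hMN : MN r s u ≠ ∞ := by
    refine ne_top_of_le_ne_top (b := MN r s (fun _ : Zt m k => ENNReal.ofReal B)) ?_ (MN_mono hr0 hs0 hB')
    simp only [MN, iN, lintegral_const, measure_univ, mul_one]
    finiteness
  set ω : Torus m → ℝ := fun x => (iN s u x).toReal ^ (r - s) with hω
  have hω0 : ∀ x, 0 ≤ ω x := fun x => Real.rpow_nonneg ENNReal.toReal_nonneg _
  have hωm : Measurable ω := ((iN_meas hFm).ennreal_toReal).pow_const _
  set g : Zt m k → ℂ := fun z => conj (F z) * ((‖F z‖ ^ (s - 2) * ω z.1 : ℝ) : ℂ) with hg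
  have hgm : Measurable g := by
    have := hF.measurable
    have h2 : Measurable fun z : Zt m k => conj (F z) := Complex.continuous_conj.measurable.comp this
    have h3 : Measurable fun z : Zt m k => ((‖F z‖ ^ (s - 2) * ω z.1 : ℝ) : ℂ) := by fun_prop
    exact h2.mul h3
  have hgn : ∀ z, ‖g z‖ₑ = u z ^ (s - 1) * ENNReal.ofReal (ω z.1) := by
    intro z
    simp only [hg, hu, ← ofReal_norm]
    rw [ENNReal.ofReal_rpow_of_nonneg (norm_nonneg _) (by linarith), ← ENNReal.ofReal_mul (by positivity)]
    congr 1
    rw [norm_mul, RCLike.norm_conj, Complex.norm_real, Real.norm_of_nonneg (mul_nonneg (by positivity) (hω0 _)), ← mul_assoc]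
    congr 1
    rcases eq_or_lt_of_le (norm_nonneg (F z)) with h | h
    · rw [← h, zero_mul, Real.zero_rpow (by linarith)]
    · rw [show s - 1 = 1 + (s - 2) by ring, Real.rpow_add h, Real.rpow_one]
  have hFg : ∀ z, F z * g z = ((‖F z‖ ^ s * ω z.1 : ℝ) : ℂ) := by
    intro z
    simp only [hg, ← mul_assoc, Complex.mul_conj]
    rw [Complex.normSq_eq_norm_sq]
    norm_cast
    rw [← mul_assoc]
    congr 1
    rcases eq_or_lt_of_le (norm_nonneg (F z)) with h | h
    · rw [← h, Real.zero_rpow (x := s) hs0.ne']; simp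
    · rw [show s = 2 + (s - 2) by ring, Real.rpow_add h]; norm_num
  have hωN : ∀ x, ∀ t : ℝ, 0 < t - (r - s) → 0 < t → ENNReal.ofReal (ω x) * iN s u x ^ (t - (r - s)) = iN s u x ^ t := by
    intro x t ht ht0
    rcases eq_or_ne (iN s u x) 0 with h | h
    · rw [h, ENNReal.zero_rpow_of_pos ht, ENNReal.zero_rpow_of_pos ht0, mul_zero]
    · have h1 : ENNReal.ofReal (ω x) = iN s u x ^ (r - s) := by
        simp only [hω]
        rw [ENNReal.toReal_rpow, ENNReal.ofReal_toReal]
        exact ENNReal.rpow_ne_top_of_ne_zero h (hiN x)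
      rw [h1, ← ENNReal.rpow_add _ _ h (hiN x)]
      congr 1; ring
  refine ⟨g, hgm, ?_, hMN, ?_, fun z => ⟨_, by have := hω0 z.1; positivity, hFg z⟩⟩
  · have h1 : ∀ x, iN s' (fun z => ‖g z‖ₑ) x = iN s u x ^ (r - 1) := by
      intro x
      rw [show iN s' (fun z => ‖g z‖ₑ) x = (∫⁻ y, ‖g (x, y)‖ₑ ^ s') ^ (1 / s') from rfl]
      simp only [hgn]
      simp only [ENNReal.mul_rpow_of_nonneg _ _ hs.symm.nonneg, ← ENNReal.rpow_mul]
      rw [lintegral_mul_const _ (by fun_prop), ENNReal.mul_rpow_of_nonneg _ _ (by have := hs.symm.pos; positivity), ← ENNReal.rpow_mul,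
        mul_one_div_cancel hs.symm.ne_zero, ENNReal.rpow_one, hs.sub_one_mul_conj, ← iN_pow hs0, ← ENNReal.rpow_mul,
        mul_comm]
      have e : s * (1 / s') = r - 1 - (r - s) := by
        have := hs.sub_one_mul_conj
        have h0 := hs.symm.ne_zero
        field_simp
        linarith
      rw [e]
      exact hωN x (r - 1) (by linarith) (by linarith)
    unfold MN
    simp only [h1, ← ENNReal.rpow_mul, hr.sub_one_mul_conj]
    apply le_of_eq
    congr 1
    have := hr.sub_one_mul_conj
    have h0 := hr.symm.ne_zero
    field_simp
    linarith
  · have h2 : MN r s u ^ r = ∫⁻ z : Zt m k, ENNReal.ofReal (‖F z‖ ^ s * ω z.1) := by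
      rw [MN_pow hr0, Measure.volume_eq_prod, lintegral_prod _ (by fun_prop)]
      congr 1; ext x
      rw [← hωN x r (by linarith) hr0, show r - (r - s) = s by ring, iN_pow hs0, mul_comm,
        ← lintegral_mul_const _ (by fun_prop)]
      congr 1; ext y
      rw [ENNReal.ofReal_mul (by positivity), ← ENNReal.ofReal_rpow_of_nonneg (norm_nonneg _) hs0.le, ofReal_norm]
    simp only [hFg]
    have h0 : ∀ z : Zt m k, 0 ≤ ‖F z‖ ^ s * ω z.1 := fun z => by have := hω0 z.1; positivity
    have hIntF : Integrable fun z : Zt m k => ‖F z‖ ^ s * ω z.1 := by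
      refine ⟨Measurable.aestronglyMeasurable (by fun_prop), ?_⟩
      rw [hasFiniteIntegral_iff_ofReal (Filter.Eventually.of_forall h0), ← h2]
      exact ENNReal.rpow_lt_top_of_nonneg hr0.le hMN
    rw [integral_complex_ofReal, ← ofReal_norm, Complex.norm_real, Real.norm_of_nonneg (integral_nonneg h0),
      ofReal_integral_eq_lintegral_ofReal hIntF (Filter.Eventually.of_forall h0), h2]

lemma MN_integrable {r s : ℝ} (hr : 1 < r) (hs : 1 < s) {f : Zt m k → ℂ} (hf : Measurable f)
    (h : MN r s (fun z => ‖f z‖ₑ) ≠ ∞) : Integrable f :=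
  ⟨hf.aestronglyMeasurable, (L1_le_MN hr hs hf.enorm).trans_lt h.lt_top⟩

instance ztSub (m k : ℕ) : MeasurableSub₂ (Zt m k) := ContinuousSub.measurableSub₂

lemma cv_dual {K : Zt m k → ℂ} (hK : Continuous K) (he : ∀ z, K (-z) = K z) {f g : Zt m k → ℂ} (hf : Integrable f)
    (hg : Integrable g) : ∫ z, cv K f z * g z = ∫ z, f z * cv K g z := by
  unfold cv
  simp only [← integral_mul_const, ← integral_const_mul]
  rw [integral_integral_swap]
  · congr 1; ext w; congr 1; ext z
    rw [← he (w - z), neg_sub]; ring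
  · obtain ⟨B, hB⟩ := isCompact_univ.exists_bound_of_continuousOn hK.continuousOn
    have h1 : Integrable (fun p : Zt m k × Zt m k => g p.1 * f p.2) (volume.prod volume) := hg.mul_prod hf
    have h2 := h1.bdd_mul (f := fun p => K (p.1 - p.2)) (c := B) (by
      exact (hK.measurable.comp (measurable_fst.sub measurable_snd)).aestronglyMeasurable) (Filter.Eventually.of_forall fun p => hB _ trivial)
    refine h2.congr (Filter.Eventually.of_forall fun p => ?_)
    simp only [Function.uncurry]; ring

lemma duality {r r' s s' : ℝ} (hr : r.HolderConjugate r') (hs : s.HolderConjugate s') {K : Zt m k → ℂ}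
    (hK : Continuous K) (he : ∀ z, K (-z) = K z) {C : ℝ≥0∞} (hC : C ≠ 0)
    (h : ∀ g, Measurable g → MN r' s' (fun z => ‖cv K g z‖ₑ) ≤ C * MN r' s' (fun z => ‖g z‖ₑ)) :
    ∀ f, Measurable f → MN r s (fun z => ‖cv K f z‖ₑ) ≤ C * MN r s (fun z => ‖f z‖ₑ) := by
  intro f hf
  by_cases hfin : MN r s (fun z => ‖f z‖ₑ) = ∞
  · rw [hfin, ENNReal.mul_top hC]; exact le_top
  have hfi := MN_integrable hr.lt hs.lt hf hfin
  have hFc : Continuous (cv K f) := cv_cont hK hfi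
  obtain ⟨g, hgm, hg1, hg2, hg3, _⟩ := dual_fun hr hs hFc
  set E := MN r s (fun z => ‖cv K f z‖ₑ) with hE
  have hgfin : MN r' s' (fun z => ‖g z‖ₑ) ≠ ∞ :=
    ne_top_of_le_ne_top (ENNReal.rpow_ne_top_of_nonneg (by linarith [hr.lt]) hg2) hg1
  have hgi := MN_integrable hr.symm.lt hs.symm.lt hgm hgfin
  have hGc : Continuous (cv K g) := cv_cont hK hgi
  have key : E ^ r ≤ C * MN r s (fun z => ‖f z‖ₑ) * E ^ (r - 1) := by
    rw [hg3, cv_dual hK he hfi hgi]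
    calc _ ≤ ∫⁻ z, ‖f z * cv K g z‖ₑ := enorm_integral_le_lintegral_enorm _
      _ = ∫⁻ z, ‖f z‖ₑ * ‖cv K g z‖ₑ := by simp only [enorm_mul]
      _ ≤ MN r s (fun z => ‖f z‖ₑ) * MN r' s' (fun z => ‖cv K g z‖ₑ) := MN_holder hr hs hf.enorm hGc.measurable.enorm
      _ ≤ MN r s (fun z => ‖f z‖ₑ) * (C * E ^ (r - 1)) := by
        gcongr
        exact (h g hgm).trans (by gcongr)
      _ = _ := by ring
  rcases eq_or_ne E 0 with h0 | h0
  · rw [h0]; exact zero_le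
  · have e : E ^ r = E * E ^ (r - 1) := by
      conv_lhs => rw [show r = 1 + (r - 1) by ring, ENNReal.rpow_add _ _ h0 hg2, ENNReal.rpow_one]
    rw [e] at key
    rwa [ENNReal.mul_le_mul_iff_left] at key
    · simp [h0, hg2]
    · exact ENNReal.rpow_ne_top_of_nonneg (by linarith [hr.lt]) hg2

end Dual

set_option linter.unusedSectionVars false
set_option linter.unusedVariables false

section Fourier
variable {m k : ℕ}

lemma exists_ch_ne (ξ : Lam m k) (h : ξ ≠ 0) : ∃ z, ch ξ z ≠ 1 := by
  have hne : ∃ i, co i (latCoe ξ) ≠ 0 := by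
    by_contra hcon
    push Not at hcon
    refine h (Prod.ext (funext fun i => ?_) (funext fun i => ?_))
    · have := hcon (Sum.inl i); simpa [co, latCoe] using this
    · have := hcon (Sum.inr i); simpa [co, latCoe] using this
  obtain ⟨i, hi⟩ := hne
  have hv : ∃ v : Eu m k, ∀ j, co j v = if j = i then (2 * co i (latCoe ξ))⁻¹ else 0 :=
    ⟨(fun j => if Sum.inl j = i then (2 * co i (latCoe ξ))⁻¹ else 0,
      fun j => if Sum.inr j = i then (2 * co i (latCoe ξ))⁻¹ else 0), by rintro (j | j) <;> simp [co]⟩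
  obtain ⟨v, hv⟩ := hv
  refine ⟨pr v, ?_⟩
  rw [ch_pr, Finset.sum_eq_single i]
  · rw [hv, if_pos rfl]
    have e : (2 * π * I * ((co i (latCoe ξ) * (2 * co i (latCoe ξ))⁻¹ : ℝ) : ℂ)) = π * I := by
      have : co i (latCoe ξ) * (2 * co i (latCoe ξ))⁻¹ = 1 / 2 := by field_simp
      rw [this]; push_cast; ring
    rw [e, Complex.exp_pi_mul_I]
    norm_num
  · intro j _ hj; rw [hv, if_neg hj]; simp
  · simp

lemma ch_integrable (ξ : Lam m k) : Integrable (ch ξ) :=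
  (ch_cont ξ).integrable_of_hasCompactSupport (HasCompactSupport.of_compactSpace _)

lemma int_ch (ξ : Lam m k) : ∫ z, ch ξ z = if ξ = 0 then 1 else 0 := by
  split_ifs with h
  · subst h; simp [ch_zero]
  · obtain ⟨w, hw⟩ := exists_ch_ne ξ h
    have h1 : ∫ z, ch ξ (z + w) = ∫ z, ch ξ z := integral_add_right_eq_self _ w
    simp only [ch_zadd] at h1
    rw [integral_mul_const] at h1
    have : (∫ z, ch ξ z) * (ch ξ w - 1) = 0 := by rw [mul_sub, h1]; ring
    rcases mul_eq_zero.1 this with h2 | h2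
    · exact h2
    · exact absurd (sub_eq_zero.1 h2) hw

lemma ch_ch (ξ η : Lam m k) : ∫ z, ch ξ z * conj (ch η z) = if ξ = η then 1 else 0 := by
  have : ∀ z, ch ξ z * conj (ch η z) = ch (ξ - η) z := fun z => by
    rw [sub_eq_add_neg, ch_add, ch_neg]
  simp only [this, int_ch, sub_eq_zero]

lemma int_mul_ch {f : Zt m k → ℂ} (hf : Integrable f) (ξ : Lam m k) :
    Integrable fun z => f z * conj (ch ξ z) := by
  have := hf.bdd_mul (f := fun z => conj (ch ξ z)) (c := 1)
    (Complex.continuous_conj.comp (ch_cont ξ)).aestronglyMeasurable (Filter.Eventually.of_forall fun z => by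
      rw [RCLike.norm_conj, ch_norm])
  simpa only [mul_comm] using this

lemma cv_ker {L : ℕ} {a : Lam m k → ℂ} (ha : Spt L a) {f : Zt m k → ℂ} (hf : Integrable f) (z : Zt m k) :
    cv (Ker a) f z = ∑ ξ ∈ bx m k L, a ξ * fcoef f ξ * ch ξ z := by
  unfold cv
  have : ∀ w, Ker a (z - w) * f w = ∑ ξ ∈ bx m k L, a ξ * ch ξ z * (f w * conj (ch ξ w)) := by
    intro w
    rw [ha.ker, Finset.sum_mul]
    refine Finset.sum_congr rfl fun ξ _ => ?_
    rw [ch_zsub]; ring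
  simp only [this]
  rw [integral_finsetSum _ fun ξ _ => (int_mul_ch hf ξ).const_mul _]
  refine Finset.sum_congr rfl fun ξ _ => ?_
  rw [integral_const_mul, fcoef_eq]; ring

/-- trigonometric polynomial -/
def tp (B : Finset (Lam m k)) (c : Lam m k → ℂ) (z : Zt m k) : ℂ := ∑ ξ ∈ B, c ξ * ch ξ z

lemma tp_cont (B : Finset (Lam m k)) (c : Lam m k → ℂ) : Continuous (tp B c) := by
  unfold tp; fun_prop

lemma cont_integrable {F : Zt m k → ℂ} (hF : Continuous F) : Integrable F :=
  hF.integrable_of_hasCompactSupport (HasCompactSupport.of_compactSpace _)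

lemma fcoef_tp (B : Finset (Lam m k)) (c : Lam m k → ℂ) (η : Lam m k) :
    fcoef (tp B c) η = if η ∈ B then c η else 0 := by
  classical
  rw [fcoef_eq]
  unfold tp
  simp only [Finset.sum_mul, mul_assoc]
  rw [integral_finsetSum _ fun ξ _ => (int_mul_ch (ch_integrable ξ) η).const_mul _]
  simp only [integral_const_mul, ch_ch]
  simp

lemma int_conj_tp {f : Zt m k → ℂ} (hf : Integrable f) (B : Finset (Lam m k)) (c : Lam m k → ℂ) :
    ∫ z, f z * conj (tp B c z) = ∑ ξ ∈ B, conj (c ξ) * fcoef f ξ := by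
  have : ∀ z, f z * conj (tp B c z) = ∑ ξ ∈ B, conj (c ξ) * (f z * conj (ch ξ z)) := by
    intro z
    unfold tp
    rw [map_sum, Finset.mul_sum]
    refine Finset.sum_congr rfl fun ξ _ => ?_
    rw [map_mul]; ring
  simp only [this]
  rw [integral_finsetSum _ fun ξ _ => (int_mul_ch hf ξ).const_mul _]
  simp only [integral_const_mul, fcoef_eq]

lemma int_sq_tp (B : Finset (Lam m k)) (c : Lam m k → ℂ) :
    ∫ z, ‖tp B c z‖ ^ 2 = ∑ ξ ∈ B, ‖c ξ‖ ^ 2 := by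
  have h := int_conj_tp (cont_integrable (tp_cont B c)) B c
  have e : ∀ z, tp B c z * conj (tp B c z) = ((‖tp B c z‖ ^ 2 : ℝ) : ℂ) := fun z => by
    rw [Complex.mul_conj, Complex.normSq_eq_norm_sq]
  simp only [e] at h
  rw [integral_complex_ofReal] at h
  have h2 : ∑ ξ ∈ B, conj (c ξ) * fcoef (tp B c) ξ = ((∑ ξ ∈ B, ‖c ξ‖ ^ 2 : ℝ) : ℂ) := by
    push_cast
    refine Finset.sum_congr rfl fun ξ hξ => ?_
    rw [fcoef_tp, if_pos hξ, mul_comm, Complex.mul_conj, Complex.normSq_eq_norm_sq]; push_cast; rfl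
  rw [h2] at h
  exact_mod_cast h

lemma bessel {f : Zt m k → ℂ} (hf : MemLp f 2) (B : Finset (Lam m k)) :
    ∑ ξ ∈ B, ‖fcoef f ξ‖ ^ 2 ≤ ∫ z, ‖f z‖ ^ 2 := by
  have hfi : Integrable f := hf.integrable one_le_two
  set g := tp B (fcoef f) with hg
  have hgc : Continuous g := tp_cont _ _
  have hg2 : MemLp g 2 := hgc.memLp_of_hasCompactSupport (HasCompactSupport.of_compactSpace _)
  have i1 : Integrable fun z => ‖f z‖ ^ 2 := hf.integrable_norm_pow two_ne_zero
  have i2 : Integrable fun z => ‖g z‖ ^ 2 := hg2.integrable_norm_pow two_ne_zero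
  have hfg : Integrable fun z => f z * conj (g z) := by
    have := hfi.bdd_mul (f := fun z => conj (g z)) (c := (bdd_of_cont hgc).choose)
      (Complex.continuous_conj.comp hgc).aestronglyMeasurable (Filter.Eventually.of_forall fun z => by
        rw [RCLike.norm_conj]; exact (bdd_of_cont hgc).choose_spec.2 z)
    simpa only [mul_comm] using this
  have h1 : ∫ z, f z * conj (g z) = ((∑ ξ ∈ B, ‖fcoef f ξ‖ ^ 2 : ℝ) : ℂ) := by
    rw [hg, int_conj_tp hfi]
    push_cast
    refine Finset.sum_congr rfl fun ξ hξ => ?_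
    rw [mul_comm, Complex.mul_conj, Complex.normSq_eq_norm_sq]; push_cast; rfl
  have h2 : ∫ z, (f z * conj (g z)).re = ∑ ξ ∈ B, ‖fcoef f ξ‖ ^ 2 := by
    have := integral_re (𝕜 := ℂ) hfg
    simp only [RCLike.re_eq_complex_re] at this
    rw [this, h1, Complex.ofReal_re]
  have h3 : 0 ≤ ∫ z, (‖f z‖ ^ 2 - 2 * (f z * conj (g z)).re + ‖g z‖ ^ 2) := by
    refine integral_nonneg fun z => ?_
    have : ‖f z‖ ^ 2 - 2 * (f z * conj (g z)).re + ‖g z‖ ^ 2 = ‖f z - g z‖ ^ 2 := by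
      rw [← Complex.normSq_eq_norm_sq, ← Complex.normSq_eq_norm_sq, ← Complex.normSq_eq_norm_sq, Complex.normSq_sub]
      ring
    simp only [Pi.zero_apply, this]
    positivity
  have i3 : Integrable fun z => 2 * (f z * conj (g z)).re := (hfg.re.const_mul 2)
  have i4 : Integrable fun z => ‖f z‖ ^ 2 - 2 * (f z * conj (g z)).re := i1.sub i3
  rw [integral_add i4 i2, integral_sub i1 i3, integral_const_mul, h2, hg, int_sq_tp] at h3
  linarith

lemma l2_bound {L : ℕ} {a : Lam m k → ℂ} (ha : Spt L a) {c : ℝ} (hc0 : 0 < c) (hc : ∀ ξ, ‖a ξ‖ ≤ c) {f : Zt m k → ℂ}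
    (hf : Measurable f) : ∫⁻ z, ‖cv (Ker a) f z‖ₑ ^ (2:ℝ) ≤ ENNReal.ofReal (c ^ 2) * ∫⁻ z, ‖f z‖ₑ ^ (2:ℝ) := by
  by_cases hfin : ∫⁻ z, ‖f z‖ₑ ^ (2:ℝ) = ∞
  · rw [hfin, ENNReal.mul_top]
    · exact le_top
    · simp; positivity
  have hf2 : MemLp f 2 := by
    refine ⟨hf.aestronglyMeasurable, ?_⟩
    rw [eLpNorm_lt_top_iff_lintegral_rpow_enorm_lt_top two_ne_zero ENNReal.ofNat_ne_top]
    simpa using lt_top_iff_ne_top.2 hfin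
  have hfi : Integrable f := hf2.integrable one_le_two
  have e : cv (Ker a) f = tp (bx m k L) (fun ξ => a ξ * fcoef f ξ) := funext fun z => by
    rw [cv_ker ha hfi]; rfl
  rw [e]
  have conv : ∀ F : Zt m k → ℂ, MemLp F 2 → ∫⁻ z, ‖F z‖ₑ ^ (2:ℝ) = ENNReal.ofReal (∫ z, ‖F z‖ ^ 2) := by
    intro F hF
    rw [ofReal_integral_eq_lintegral_ofReal (hF.integrable_norm_pow two_ne_zero) (Filter.Eventually.of_forall fun z => by positivity)]
    congr 1; ext z
    rw [ENNReal.ofReal_pow (norm_nonneg _), ofReal_norm]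
    norm_cast
  rw [conv _ hf2, conv _ ((tp_cont _ _).memLp_of_hasCompactSupport (HasCompactSupport.of_compactSpace _)), int_sq_tp,
    ← ENNReal.ofReal_mul (by positivity)]
  refine ENNReal.ofReal_le_ofReal ?_
  calc _ ≤ ∑ ξ ∈ bx m k L, c ^ 2 * ‖fcoef f ξ‖ ^ 2 := Finset.sum_le_sum fun ξ _ => by
        rw [norm_mul, mul_pow]
        gcongr
        exact hc ξ
    _ = c ^ 2 * ∑ ξ ∈ bx m k L, ‖fcoef f ξ‖ ^ 2 := by rw [Finset.mul_sum]
    _ ≤ _ := by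
      gcongr
      exact bessel hf2 _

end Fourier

set_option linter.unusedSectionVars false
set_option linter.unusedVariables false

section UBs
variable {m k : ℕ} {φ : Eu m k → ℝ}

lemma IsLPCutoff.dil_zero (hφ : IsLPCutoff φ) (i : ℕ) {v : Eu m k} (h : 2 ^ (i + 1) ≤ eLen v) :
    φ (((2 : ℝ) ^ i)⁻¹ • v) = 0 := by
  refine hφ.eq_zero _ ?_
  rw [eLen_smul, abs_of_pos (by positivity), inv_mul_eq_div, le_div_iff₀ (by positivity)]
  rw [pow_succ] at h; linarith

lemma IsLPCutoff.dil_one (hφ : IsLPCutoff φ) (i : ℕ) {v : Eu m k} (h : eLen v ≤ 2 ^ i) :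
    φ (((2 : ℝ) ^ i)⁻¹ • v) = 1 := by
  refine hφ.eq_one _ ?_
  rw [eLen_smul, abs_of_pos (by positivity), inv_mul_eq_div, div_le_one (by positivity)]
  exact h

lemma IsLPCutoff.psi_hi (hφ : IsLPCutoff φ) {i : ℕ} {ξ : Lam m k} (h : psiCut φ i ξ ≠ 0) :
    eLen (latCoe ξ) < 2 ^ (i + 1) := by
  by_contra hcon
  push Not at hcon
  apply h
  rcases i with _ | i
  · have := hφ.dil_zero 0 hcon
    simpa [psiCut] using this
  · simp only [psiCut, Nat.succ_ne_zero, if_false, add_tsub_cancel_right]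
    rw [hφ.dil_zero _ hcon, hφ.dil_zero i (le_trans (by gcongr <;> simp) hcon), sub_zero]

lemma IsLPCutoff.psi_lo (hφ : IsLPCutoff φ) {i : ℕ} {ξ : Lam m k} (h : psiCut φ (i + 1) ξ ≠ 0) :
    2 ^ i < eLen (latCoe ξ) := by
  by_contra hcon
  push Not at hcon
  apply h
  simp only [psiCut, Nat.succ_ne_zero, if_false, add_tsub_cancel_right]
  rw [hφ.dil_one _ hcon, hφ.dil_one (i + 1) (le_trans hcon (by gcongr <;> simp)), sub_self]

lemma IsLPCutoff.sep (hφ : IsLPCutoff φ) {i j : ℕ} {ξ : Lam m k} (hi : psiCut φ i ξ ≠ 0) (hj : psiCut φ j ξ ≠ 0) :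
    j ≤ i + 1 := by
  by_contra hcon
  obtain ⟨j', rfl⟩ : ∃ j', j = j' + 1 := ⟨j - 1, by omega⟩
  have h1 := hφ.psi_hi hi
  have h2 := hφ.psi_lo hj
  have h3 : (2:ℝ) ^ (i + 1) ≤ 2 ^ j' := pow_le_pow_right₀ (by norm_num) (by omega)
  linarith

lemma IsLPCutoff.psi_abs (hφ : IsLPCutoff φ) (i : ℕ) (ξ : Lam m k) : |psiCut φ i ξ| ≤ 1 := by
  unfold psiCut
  split_ifs
  · have := hφ.mem_Icc (latCoe ξ)
    rw [abs_le]; constructor <;> linarith [this.1, this.2]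
  · have h1 := hφ.mem_Icc (((2 : ℝ) ^ i)⁻¹ • latCoe ξ)
    have h2 := hφ.mem_Icc (((2 : ℝ) ^ (i - 1))⁻¹ • latCoe ξ)
    rw [abs_le]; constructor <;> linarith [h1.1, h1.2, h2.1, h2.2]

lemma IsLPCutoff.psi_even (hφ : IsLPCutoff φ) (i : ℕ) (ξ : Lam m k) : psiCut φ i (-ξ) = psiCut φ i ξ := by
  have : latCoe (-ξ) = - latCoe ξ := by ext i <;> simp [latCoe]
  unfold psiCut
  rw [this, smul_neg, smul_neg, hφ.even, hφ.even, hφ.even]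

/-- randomized symbol -/
def ks (φ : Eu m k → ℝ) (J : ℕ) (ε : ℕ → ℂ) (ξ : Lam m k) : ℂ := ∑ j ∈ range J, ε j * ps φ j ξ

/-- randomized kernel -/
def kk (φ : Eu m k → ℝ) (J : ℕ) (ε : ℕ → ℂ) (z : Zt m k) : ℂ := ∑ j ∈ range J, ε j * pk φ j z

lemma IsLPCutoff.ks_spt (hφ : IsLPCutoff φ) (J : ℕ) (ε : ℕ → ℂ) : Spt (2 ^ (J + 1)) (ks φ J ε) := by
  intro ξ hξ
  obtain ⟨j, hj, h⟩ := Finset.exists_ne_zero_of_sum_ne_zero hξ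
  have hj' := Finset.mem_range.1 hj
  exact ((hφ.spt j).mono (Nat.pow_le_pow_right (by norm_num) (by omega))) ξ (right_ne_zero_of_mul h)

lemma IsLPCutoff.kk_eq (hφ : IsLPCutoff φ) (J : ℕ) (ε : ℕ → ℂ) : kk φ J ε = Ker (ks φ J ε) := by
  ext z
  rw [(hφ.ks_spt J ε).ker]
  unfold kk ks pk
  simp only [Finset.sum_mul]
  rw [Finset.sum_comm]
  refine Finset.sum_congr rfl fun j hj => ?_
  have hj' := Finset.mem_range.1 hj
  rw [((hφ.spt j).mono (Nat.pow_le_pow_right (by norm_num) (show j + 1 ≤ J + 1 by omega))).ker, Finset.mul_sum]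
  simp only [mul_assoc]

lemma IsLPCutoff.kk_cont (hφ : IsLPCutoff φ) (J : ℕ) (ε : ℕ → ℂ) : Continuous (kk φ J ε) := by
  rw [hφ.kk_eq]; exact (hφ.ks_spt J ε).cont

lemma IsLPCutoff.pk_even (hφ : IsLPCutoff φ) (j : ℕ) (z : Zt m k) : pk φ j (-z) = pk φ j z := by
  unfold pk Ker
  rw [← (Equiv.neg (Lam m k)).tsum_eq]
  refine tsum_congr fun ξ => ?_
  simp only [Equiv.neg_apply, ps, hφ.psi_even]
  rw [ch_zneg, ch_neg, Complex.conj_conj]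

lemma IsLPCutoff.kk_even (hφ : IsLPCutoff φ) (J : ℕ) (ε : ℕ → ℂ) (z : Zt m k) : kk φ J ε (-z) = kk φ J ε z := by
  simp [kk, hφ.pk_even]

lemma IsLPCutoff.ks_bound (hφ : IsLPCutoff φ) (J : ℕ) {ε : ℕ → ℂ} (hε : ∀ j, ‖ε j‖ ≤ 1) (ξ : Lam m k) :
    ‖ks φ J ε ξ‖ ≤ 2 := by
  classical
  have h1 : ‖ks φ J ε ξ‖ ≤ ∑ j ∈ range J, |psiCut φ j ξ| := by
    refine (norm_sum_le _ _).trans (Finset.sum_le_sum fun j _ => ?_)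
    rw [norm_mul]
    have : ‖ps φ j ξ‖ = |psiCut φ j ξ| := by simp [ps]
    rw [this]
    exact mul_le_of_le_one_left (abs_nonneg _) (hε j)
  refine h1.trans ?_
  set T := (range J).filter fun j => psiCut φ j ξ ≠ 0 with hT
  have h2 : ∑ j ∈ range J, |psiCut φ j ξ| = ∑ j ∈ T, |psiCut φ j ξ| := by
    rw [hT, Finset.sum_filter_of_ne]
    intro j _ h; exact abs_ne_zero.1 h
  rw [h2]
  rcases T.eq_empty_or_nonempty with h0 | hne
  · rw [h0]; simp
  have hsub : T ⊆ Finset.Icc (T.min' hne) (T.min' hne + 1) := by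
    intro j hj
    rw [Finset.mem_Icc]
    refine ⟨T.min'_le j hj, ?_⟩
    exact hφ.sep (Finset.mem_filter.1 (T.min'_mem hne)).2 (Finset.mem_filter.1 hj).2
  have hcard : T.card ≤ 2 := (Finset.card_le_card hsub).trans (by rw [Nat.card_Icc]; omega)
  calc ∑ j ∈ T, |psiCut φ j ξ| ≤ ∑ j ∈ T, (1:ℝ) := Finset.sum_le_sum fun j _ => hφ.psi_abs j ξ
    _ = T.card := by simp
    _ ≤ 2 := by exact_mod_cast hcard

/-- uniform boundedness -/
def UB (φ : Eu m k → ℝ) (r s : ℝ) : Prop := ∃ C : ℝ≥0∞, C ≠ ∞ ∧ C ≠ 0 ∧ ∀ J (ε : ℕ → ℂ), (∀ j, ‖ε j‖ ≤ 1) →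
  ∀ f : Zt m k → ℂ, Measurable f → MN r s (fun z => ‖cv (kk φ J ε) f z‖ₑ) ≤ C * MN r s (fun z => ‖f z‖ₑ)

lemma UB.dual (hφ : IsLPCutoff φ) {r r' s s' : ℝ} (hr : r.HolderConjugate r') (hs : s.HolderConjugate s') (h : UB φ r' s') :
    UB φ r s := by
  obtain ⟨C, h1, h2, h3⟩ := h
  exact ⟨C, h1, h2, fun J ε hε => duality hr hs (hφ.kk_cont J ε) (hφ.kk_even J ε) h2 (h3 J ε hε)⟩

lemma measurable_cv {K : Zt m k → ℂ} (hK : Continuous K) {f : Zt m k → ℂ} (hf : Measurable f) : Measurable (cv K f) := by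
  by_cases hfi : Integrable f
  · exact (cv_cont hK hfi).measurable
  unfold cv
  refine StronglyMeasurable.measurable ?_
  refine StronglyMeasurable.integral_prod_right' (f := fun p : Zt m k × Zt m k => K (p.1 - p.2) * f p.2) ?_
  refine Measurable.stronglyMeasurable ?_
  exact (hK.measurable.comp (measurable_fst.sub measurable_snd)).mul (hf.comp measurable_snd)

lemma lint_fst (F : Zt m k → ℝ≥0∞) (hF : Measurable F) : ∫⁻ p : Zt m k × Torus 0, F p.1 = ∫⁻ z, F z := by
  rw [Measure.volume_eq_prod, lintegral_prod (fun p : Zt m k × Torus 0 => F p.1) (hF.comp measurable_fst).aemeasurable]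
  refine lintegral_congr fun z => ?_
  simp only []
  rw [lintegral_const]; simp

lemma cv_fst (K f : Zt m k → ℂ) (p : Zt m k × Torus 0) :
    cv (fun p : Zt m k × Torus 0 => K p.1) (fun p => f p.1) p = cv K f p.1 := by
  unfold cv
  simp only [Prod.fst_sub]
  rw [Measure.volume_eq_prod]
  have := integral_fun_fst (μ := (volume : Measure (Zt m k))) (ν := (volume : Measure (Torus 0))) (fun z => K (p.1 - z) * f z)
  rw [this]; simp

lemma ofst (f : Zt m k × Torus 0 → ℂ) : f = fun p => f (p.1, 0) := by
  ext p
  congr 1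
  exact Prod.ext rfl (Subsingleton.elim _ _)

lemma IsLPCutoff.ub22 (hφ : IsLPCutoff φ) (J : ℕ) {ε : ℕ → ℂ} (hε : ∀ j, ‖ε j‖ ≤ 1) {f : Zt m k → ℂ}
    (hf : Measurable f) : ∫⁻ z, ‖cv (kk φ J ε) f z‖ₑ ^ (2:ℝ) ≤ ENNReal.ofReal (2 ^ 2) * ∫⁻ z, ‖f z‖ₑ ^ (2:ℝ) := by
  rw [hφ.kk_eq]
  exact l2_bound (hφ.ks_spt J ε) two_pos (hφ.ks_bound J hε) hf

lemma rpow_le_conv {a b C : ℝ≥0∞} {p : ℝ} (hp : 0 < p) (h : a ^ p ≤ C * b ^ p) : a ≤ C ^ (1 / p) * b := by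
  have := ENNReal.rpow_le_rpow h (show 0 ≤ 1 / p by positivity)
  rwa [ENNReal.mul_rpow_of_nonneg _ _ (by positivity), ← ENNReal.rpow_mul, ← ENNReal.rpow_mul, mul_one_div_cancel hp.ne',
    ENNReal.rpow_one, ENNReal.rpow_one] at this

lemma UB.of (r s : ℝ) (hr : 0 < r) (h : ∃ C : ℝ≥0∞, C ≠ ∞ ∧ ∀ J (ε : ℕ → ℂ), (∀ j, ‖ε j‖ ≤ 1) →
    ∀ f : Zt m k → ℂ, Measurable f → MN r s (fun z => ‖cv (kk φ J ε) f z‖ₑ) ^ r ≤ C * MN r s (fun z => ‖f z‖ₑ) ^ r) :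
    UB φ r s := by
  obtain ⟨C, hC, h⟩ := h
  refine ⟨C ^ (1 / r) + 1, by simp [hC, hr.le], by simp, fun J ε hε f hf => ?_⟩
  refine (rpow_le_conv hr (h J ε hε f hf)).trans ?_
  gcongr
  exact le_self_add

lemma IsLPCutoff.ubpp (hφ : IsLPCutoff φ) {p : ℝ} (hp : 1 < p) : UB φ p p := by
  have two : UB φ 2 2 := UB.of 2 2 two_pos ⟨ENNReal.ofReal (2 ^ 2), ENNReal.ofReal_ne_top, fun J ε hε f hf => by
    rw [MN_diag two_pos (measurable_cv (hφ.kk_cont J ε) hf).enorm, MN_diag two_pos hf.enorm]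
    exact hφ.ub22 J hε hf⟩
  have big : ∀ p : ℝ, 2 < p → UB φ p p := by
    intro p hp
    obtain ⟨A, hA, hkb⟩ := hφ.kb_full
    obtain ⟨C', hC', hex⟩ := extrapolate (X := Zt m k) (Y := Torus 0) (homSp_prod m k) one_lt_two hp
      (C := ENNReal.ofReal (2 ^ 2)) (A := A * ENNReal.ofReal (2 ^ (m + k + 5)) * (ENNReal.ofReal (2 ^ (m + k + 2)) * ENNReal.ofReal (14 ^ (m + k))))
      ENNReal.ofReal_ne_top (by finiteness)
    refine UB.of p p (by linarith) ⟨C', hC', fun J ε hε f hf => ?_⟩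
    rw [MN_diag (by linarith) (measurable_cv (hφ.kk_cont J ε) hf).enorm, MN_diag (by linarith) hf.enorm]
    have := hex (fun p => kk φ J ε p.1) ((hφ.kk_cont J ε).comp continuous_fst) (horK_sum (homSp_prod m k) hkb J ε hε) ?_
      (fun p => f p.1) (hf.comp measurable_fst)
    · have e : ∀ a : ℝ≥0∞, (a ^ (2:ℝ)) ^ (p / 2) = a ^ p := fun a => by
        rw [← ENNReal.rpow_mul]; congr 1; ring
      simp only [cv_fst _ f, lintegral_const, measure_univ, mul_one, e] at this
      exact this
    · intro g hg
      rw [ofst g]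
      simp only [cv_fst (kk φ J ε) (fun z => g (z, 0))]
      have hg' : Measurable fun z => g (z, 0) := hg.comp (by fun_prop)
      rw [lint_fst (fun z => ‖cv (kk φ J ε) (fun z => g (z, 0)) z‖ₑ ^ (2:ℝ)) ((measurable_cv (hφ.kk_cont J ε) hg').enorm.pow_const _),
        lint_fst (fun z => ‖g (z, 0)‖ₑ ^ (2:ℝ)) (hg'.enorm.pow_const _)]
      exact hφ.ub22 J hε hg'
  rcases lt_trichotomy p 2 with h | h | h
  · have hc : p.HolderConjugate p.conjExponent := Real.HolderConjugate.conjExponent hp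
    refine UB.dual hφ hc hc (big _ ?_)
    rw [Real.conjExponent, lt_div_iff₀ (by linarith)]; linarith
  · rw [h]; exact two
  · exact big p h

lemma IsLPCutoff.ub (hφ : IsLPCutoff φ) {r s : ℝ} (hr : 1 < r) (hs : 1 < s) : UB φ r s := by
  have big : ∀ r s : ℝ, 1 < s → s < r → UB φ r s := by
    intro r s hs hsr
    obtain ⟨A, hA, hkb⟩ := hφ.kb_mix
    obtain ⟨C, hC, hC0, hub⟩ := hφ.ubpp hs
    obtain ⟨C', hC', hex⟩ := extrapolate (X := Torus m) (Y := Torus k) (homSp_torus m) hs hsr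
      (C := C ^ s) (A := A * ENNReal.ofReal (2 ^ (m + 5)) * (ENNReal.ofReal (2 ^ (m + 2)) * ENNReal.ofReal (14 ^ m)))
      (ENNReal.rpow_ne_top_of_nonneg (by linarith) hC) (by finiteness)
    refine UB.of r s (by linarith) ⟨C', hC', fun J ε hε f hf => ?_⟩
    rw [MN_pow' (by linarith) (by linarith), MN_pow' (by linarith) (by linarith)]
    refine hex (kk φ J ε) (hφ.kk_cont J ε) (horK_sum (homSp_torus m) hkb J ε hε) ?_ f hf
    intro g hg
    have h0 : (0:ℝ) < s := by linarith
    rw [← MN_diag h0 (measurable_cv (hφ.kk_cont J ε) hg).enorm, ← MN_diag h0 hg.enorm,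
      ← ENNReal.mul_rpow_of_nonneg _ _ h0.le]
    exact ENNReal.rpow_le_rpow (hub J ε hε g hg) h0.le
  rcases lt_trichotomy r s with h | h | h
  · have hc : r.HolderConjugate r.conjExponent := Real.HolderConjugate.conjExponent hr
    have hc' : s.HolderConjugate s.conjExponent := Real.HolderConjugate.conjExponent hs
    refine UB.dual hφ hc hc' (big _ _ hc'.symm.lt ?_)
    rw [Real.conjExponent, Real.conjExponent, div_lt_div_iff₀ (by linarith) (by linarith)]; nlinarith
  · rw [h]; exact hφ.ubpp hs
  · exact big r s hs h

end UBs

set_option linter.unusedSectionVars false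
set_option linter.unusedVariables false

section Khin

/-- signs attached to a finite set -/
def sg (S : Finset ℕ) (j : ℕ) : ℂ := if j ∈ S then 1 else -1

lemma sg_norm (S : Finset ℕ) (j : ℕ) : ‖sg S j‖ ≤ 1 := by
  unfold sg; split_ifs <;> simp

/-- random sum -/
def rs (a : ℕ → ℂ) (J : ℕ) (S : Finset ℕ) : ℂ := ∑ j ∈ range J, sg S j * a j

lemma rs_sum (a : ℕ → ℂ) (J : ℕ) (G : ℂ → ℝ) : ∑ S ∈ (range (J + 1)).powerset, G (rs a (J + 1) S) =
    ∑ S ∈ (range J).powerset, (G (rs a J S - a J) + G (rs a J S + a J)) := by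
  rw [Finset.range_add_one, Finset.sum_powerset_insert (by simp), ← Finset.sum_add_distrib]
  refine Finset.sum_congr rfl fun S hS => ?_
  have hS' : J ∉ S := fun h => by simpa using Finset.mem_powerset.1 hS h
  congr 2
  · rw [rs, Finset.sum_range_succ, ← rs]
    simp [sg, hS', sub_eq_add_neg]
  · rw [rs, Finset.sum_range_succ]
    have : ∑ j ∈ range J, sg (insert J S) j * a j = rs a J S := by
      refine Finset.sum_congr rfl fun j hj => ?_
      have : j ≠ J := (Finset.mem_range.1 hj).ne
      simp [sg, this]
    rw [this]; simp [sg]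

lemma norm4 (x a : ℂ) : ‖x - a‖ ^ 2 + ‖x + a‖ ^ 2 = 2 * (‖x‖ ^ 2 + ‖a‖ ^ 2) ∧
    ‖x - a‖ ^ 4 + ‖x + a‖ ^ 4 ≤ 2 * (‖x‖ ^ 4 + 6 * ‖x‖ ^ 2 * ‖a‖ ^ 2 + ‖a‖ ^ 4) := by
  have e : ∀ w : ℂ, ‖w‖ ^ 2 = w.re ^ 2 + w.im ^ 2 := fun w => by
    rw [← Complex.normSq_eq_norm_sq, Complex.normSq_apply]; ring
  have e4 : ∀ w : ℂ, ‖w‖ ^ 4 = (w.re ^ 2 + w.im ^ 2) ^ 2 := fun w => by rw [← e]; ring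
  simp only [e, e4, Complex.sub_re, Complex.sub_im, Complex.add_re, Complex.add_im]
  constructor
  · ring
  · nlinarith [sq_nonneg (x.re * a.im - x.im * a.re)]

lemma rs_m2 (a : ℕ → ℂ) (J : ℕ) : ∑ S ∈ (range J).powerset, ‖rs a J S‖ ^ 2 = 2 ^ J * ∑ j ∈ range J, ‖a j‖ ^ 2 := by
  induction J with
  | zero => simp [rs]
  | succ J ih =>
    rw [rs_sum a J (fun w => ‖w‖ ^ 2)]
    simp only [fun S => (norm4 (rs a J S) (a J)).1, ← Finset.mul_sum, Finset.sum_add_distrib, ih, Finset.sum_const,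
      Finset.card_powerset, Finset.card_range, Finset.sum_range_succ, nsmul_eq_mul]
    push_cast; ring

lemma rs_m4 (a : ℕ → ℂ) (J : ℕ) : ∑ S ∈ (range J).powerset, ‖rs a J S‖ ^ 4 ≤ 3 * 2 ^ J * (∑ j ∈ range J, ‖a j‖ ^ 2) ^ 2 := by
  induction J with
  | zero => simp [rs]
  | succ J ih =>
    rw [rs_sum a J (fun w => ‖w‖ ^ 4)]
    refine (Finset.sum_le_sum fun S _ => (norm4 (rs a J S) (a J)).2).trans ?_
    have e : ∀ S, 6 * ‖rs a J S‖ ^ 2 * ‖a J‖ ^ 2 = (6 * ‖a J‖ ^ 2) * ‖rs a J S‖ ^ 2 := fun S => by ring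
    simp only [e, ← Finset.mul_sum, Finset.sum_add_distrib, rs_m2, Finset.sum_const,
      Finset.card_powerset, Finset.card_range, Finset.sum_range_succ, nsmul_eq_mul]
    push_cast
    set σ := ∑ j ∈ range J, ‖a j‖ ^ 2
    have h2 : (0:ℝ) < 2 ^ J := by positivity
    have h4 : 0 ≤ 2 ^ J * ‖a J‖ ^ 4 := by positivity
    rw [pow_succ 2 J]
    nlinarith

lemma khin (a : ℕ → ℂ) (J : ℕ) : Real.sqrt (∑ j ∈ range J, ‖a j‖ ^ 2) ≤
    2 * (2 ^ J)⁻¹ * ∑ S ∈ (range J).powerset, ‖rs a J S‖ := by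
  have h2 := rs_m2 a J
  have h4 := rs_m4 a J
  have h0 : 0 ≤ ∑ j ∈ range J, ‖a j‖ ^ 2 := Finset.sum_nonneg fun j _ => by positivity
  set q := ∑ j ∈ range J, ‖a j‖ ^ 2
  set σ := Real.sqrt q with hσ
  have hq : q = σ ^ 2 := (Real.sq_sqrt h0).symm
  have hσ0 : 0 ≤ σ := Real.sqrt_nonneg _
  rcases hσ0.eq_or_lt with h | h
  · rw [← h]; positivity
  have hp : ∀ t : ℝ, 0 ≤ t → σ ^ 2 * t ^ 2 - t ^ 4 / 6 ≤ σ ^ 3 * t := by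
    intro t ht
    have : 0 ≤ σ ^ 3 - σ ^ 2 * t + t ^ 3 / 6 := by
      nlinarith [mul_nonneg ht (sq_nonneg (t - 3 / 2 * σ)), mul_nonneg hσ0 (sq_nonneg (t - 3 / 2 * σ)), mul_nonneg hσ0 (sq_nonneg (t - σ)), pow_pos h 3, mul_nonneg hσ0 (sq_nonneg (t - 4 / 3 * σ)), mul_nonneg ht (sq_nonneg (t - 4 / 3 * σ))]
    nlinarith
  have hs := Finset.sum_le_sum fun S (_ : S ∈ (range J).powerset) => hp ‖rs a J S‖ (norm_nonneg _)
  rw [Finset.sum_sub_distrib, ← Finset.mul_sum, ← Finset.mul_sum, ← Finset.sum_div, h2, hq] at hs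
  rw [hq] at h4
  have hJ : (0:ℝ) < 2 ^ J := by positivity
  rw [mul_assoc, ← div_eq_inv_mul, mul_div_assoc', le_div_iff₀ hJ]
  have h3 : 0 < σ ^ 3 := by positivity
  refine le_of_mul_le_mul_left ?_ h3
  nlinarith

end Khin

section Sq
variable {m k : ℕ} {φ : Eu m k → ℝ}

/-- truncated square function -/
def sqJ (φ : Eu m k → ℝ) (J : ℕ) (f : Zt m k → ℂ) (z : Zt m k) : ℝ≥0∞ :=
  ENNReal.ofReal (Real.sqrt (∑ j ∈ range J, ‖cv (pk φ j) f z‖ ^ 2))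

lemma IsLPCutoff.cv_kk (hφ : IsLPCutoff φ) (J : ℕ) (ε : ℕ → ℂ) {f : Zt m k → ℂ} (hf : Integrable f) (z : Zt m k) :
    cv (kk φ J ε) f z = ∑ j ∈ range J, ε j * cv (pk φ j) f z := by
  unfold cv kk
  simp only [Finset.sum_mul, mul_assoc]
  rw [integral_finsetSum _ fun j _ => (cv_int (hφ.pk_cont j) hf z).const_mul _]
  simp only [integral_const_mul]

lemma IsLPCutoff.sqJ_meas (hφ : IsLPCutoff φ) (J : ℕ) {f : Zt m k → ℂ} (hf : Integrable f) : Measurable (sqJ φ J f) := by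
  unfold sqJ
  have : ∀ j, Continuous (cv (pk φ j) f) := fun j => cv_cont (hφ.pk_cont j) hf
  exact (Continuous.measurable (by fun_prop)).ennreal_ofReal

lemma sqJ_mono (f : Zt m k → ℂ) : Monotone fun J => sqJ φ J f := by
  intro J J' h z
  unfold sqJ
  refine ENNReal.ofReal_le_ofReal (Real.sqrt_le_sqrt ?_)
  exact Finset.sum_le_sum_of_subset_of_nonneg (by simpa using h) fun _ _ _ => by positivity

lemma IsLPCutoff.sq_bound (hφ : IsLPCutoff φ) {r s : ℝ} (hr : 1 < r) (hs : 1 < s) : ∃ C : ℝ≥0∞, C ≠ ∞ ∧ C ≠ 0 ∧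
    ∀ f : Zt m k → ℂ, Measurable f → MN r s (fun z => ‖f z‖ₑ) ≠ ∞ → ∀ J,
      MN r s (sqJ φ J f) ≤ C * MN r s (fun z => ‖f z‖ₑ) := by
  obtain ⟨C, hC, hC0, h⟩ := hφ.ub hr hs
  refine ⟨2 * C, by finiteness, by simp [hC0], fun f hf hfin J => ?_⟩
  have hfi := MN_integrable hr hs hf hfin
  have hr0 : 0 < r := by linarith
  have hs0 : 0 < s := by linarith
  have hm : ∀ S : Finset ℕ, Measurable fun z => ‖cv (kk φ J (sg S)) f z‖ₑ := fun S =>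
    (measurable_cv (hφ.kk_cont J _) hf).enorm
  have hp : ∀ z, sqJ φ J f z ≤ ENNReal.ofReal (2 * (2 ^ J)⁻¹) * ∑ S ∈ (range J).powerset, ‖cv (kk φ J (sg S)) f z‖ₑ := by
    intro z
    unfold sqJ
    refine (ENNReal.ofReal_le_ofReal (khin (fun j => cv (pk φ j) f z) J)).trans ?_
    rw [ENNReal.ofReal_mul (by positivity), ENNReal.ofReal_sum_of_nonneg fun _ _ => norm_nonneg _]
    simp only [ofReal_norm, hφ.cv_kk J _ hfi, rs]
    exact le_rfl
  refine (MN_mono hr0 hs0 hp).trans ?_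
  rw [MN_const_mul hr0 hs0 _ (Finset.measurable_fun_sum _ fun S _ => hm S)]
  refine (mul_le_mul_right ((MN_sum hr.le hs.le _ hm).trans (Finset.sum_le_sum fun S _ => h J (sg S) (sg_norm S) f hf)) _).trans ?_
  rw [Finset.sum_const, Finset.card_powerset, Finset.card_range, nsmul_eq_mul, ← mul_assoc, ← mul_assoc]
  gcongr
  rw [ENNReal.ofReal_mul (by norm_num), ENNReal.ofReal_inv_of_pos (by positivity), mul_assoc]
  rw [show ENNReal.ofReal (2 ^ J) = ((2 ^ J : ℕ) : ℝ≥0∞) by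
    rw [← ENNReal.ofReal_natCast]; push_cast; rfl]
  rw [ENNReal.inv_mul_cancel (by simp) (ENNReal.natCast_ne_top _)]
  simp

end Sq

set_option linter.unusedSectionVars false
set_option linter.unusedVariables false

section Lower
variable {m k : ℕ} {φ : Eu m k → ℝ}

lemma fcoef_cv {L : ℕ} {a : Lam m k → ℂ} (ha : Spt L a) {f : Zt m k → ℂ} (hf : Integrable f) (ξ : Lam m k) :
    fcoef (cv (Ker a) f) ξ = a ξ * fcoef f ξ := by
  have e : cv (Ker a) f = tp (bx m k L) (fun ξ => a ξ * fcoef f ξ) := funext fun z => by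
    rw [cv_ker ha hf]; rfl
  rw [e, fcoef_tp]
  split_ifs with h
  · rfl
  · have : a ξ = 0 := by by_contra h'; exact h (ha ξ h')
    rw [this, zero_mul]

lemma cv_comp {L : ℕ} {a b : Lam m k → ℂ} (ha : Spt L a) (hb : Spt L b) {f : Zt m k → ℂ} (hf : Integrable f) (z : Zt m k) :
    cv (Ker b) (cv (Ker a) f) z = ∑ ξ ∈ bx m k L, b ξ * a ξ * fcoef f ξ * ch ξ z := by
  rw [cv_ker hb (cont_integrable (cv_cont ha.cont hf))]
  refine Finset.sum_congr rfl fun ξ _ => ?_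
  rw [fcoef_cv ha hf]; ring

lemma IsLPCutoff.ks_one (J : ℕ) (ξ : Lam m k) : ks φ (J + 1) (fun _ => 1) ξ = φ (((2:ℝ) ^ J)⁻¹ • latCoe ξ) := by
  unfold ks
  simp only [one_mul]
  induction J with
  | zero => simp [ps, psiCut]
  | succ J ih =>
    rw [Finset.sum_range_succ, ih]
    simp [ps, psiCut]

lemma IsLPCutoff.ks_one' (J : ℕ) : ks φ (J + 1) (fun _ => 1) = sy φ (2 ^ J) := by
  ext ξ; rw [IsLPCutoff.ks_one]; rfl

lemma IsLPCutoff.proj_low (hφ : IsLPCutoff φ) {J j : ℕ} (hj : j < J) {f : Zt m k → ℂ} (hf : Integrable f) (z : Zt m k) :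
    cv (kk φ (J + 1) (fun _ => 1)) (cv (pk φ j) f) z = cv (pk φ j) f z := by
  have h1 : Spt (2 ^ (J + 1 + 1)) (ps φ j) := (hφ.spt j).mono (Nat.pow_le_pow_right (by norm_num) (by omega))
  rw [hφ.kk_eq, pk, cv_comp h1 (hφ.ks_spt _ _) hf, cv_ker h1 hf]
  refine Finset.sum_congr rfl fun ξ _ => ?_
  congr 2
  by_cases h0 : psiCut φ j ξ = 0
  · simp [ps, h0]
  · rw [IsLPCutoff.ks_one, hφ.dil_one, Complex.ofReal_one, one_mul]
    exact (hφ.psi_hi h0).le.trans (pow_le_pow_right₀ (by norm_num) (by omega))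

lemma IsLPCutoff.proj_orth (hφ : IsLPCutoff φ) {i j : ℕ} (hij : ¬ (j ≤ i + 1 ∧ i ≤ j + 1)) {f : Zt m k → ℂ}
    (hf : Integrable f) (z : Zt m k) : cv (pk φ i) (cv (pk φ j) f) z = 0 := by
  have h1 : Spt (2 ^ (i + j + 1)) (ps φ j) := (hφ.spt j).mono (Nat.pow_le_pow_right (by norm_num) (by omega))
  have h2 : Spt (2 ^ (i + j + 1)) (ps φ i) := (hφ.spt i).mono (Nat.pow_le_pow_right (by norm_num) (by omega))
  rw [pk, pk, cv_comp h1 h2 hf]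
  refine Finset.sum_eq_zero fun ξ _ => ?_
  have : ps φ i ξ * ps φ j ξ = 0 := by
    by_contra hcon
    have hi : psiCut φ i ξ ≠ 0 := fun h => hcon (by simp [ps, h])
    have hj : psiCut φ j ξ ≠ 0 := fun h => hcon (by simp [ps, h])
    exact hij ⟨hφ.sep hi hj, hφ.sep hj hi⟩
  rw [this]; simp

/-- near diagonal pairs -/
def nd (J : ℕ) : Finset (ℕ × ℕ) := (range J ×ˢ range (J + 1)).filter fun p => p.1 ≤ p.2 + 1 ∧ p.2 ≤ p.1 + 1

lemma nd_cs (J : ℕ) (a b : ℕ → ℝ) : ∑ p ∈ nd J, a p.1 * b p.2 ≤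
    3 * (Real.sqrt (∑ j ∈ range J, a j ^ 2) * Real.sqrt (∑ j ∈ range (J + 1), b j ^ 2)) := by
  have h := Finset.sum_mul_sq_le_sq_mul_sq (nd J) (fun p => a p.1) (fun p => b p.2)
  have ha : ∑ p ∈ nd J, a p.1 ^ 2 ≤ 3 * ∑ j ∈ range J, a j ^ 2 := by
    unfold nd
    rw [Finset.sum_filter, Finset.sum_product, Finset.mul_sum]
    refine Finset.sum_le_sum fun j _ => ?_
    simp only []
    rw [← Finset.sum_filter, Finset.sum_const, nsmul_eq_mul]
    gcongr
    have : ((range (J + 1)).filter fun i => j ≤ i + 1 ∧ i ≤ j + 1) ⊆ Finset.Icc (j - 1) (j + 1) := by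
      intro i hi
      have := (Finset.mem_filter.1 hi).2
      rw [Finset.mem_Icc]; omega
    have := Finset.card_le_card this
    rw [Nat.card_Icc] at this
    have h3 : j + 1 + 1 - (j - 1) ≤ 3 := by omega
    exact_mod_cast this.trans h3
  have hb : ∑ p ∈ nd J, b p.2 ^ 2 ≤ 3 * ∑ j ∈ range (J + 1), b j ^ 2 := by
    unfold nd
    rw [Finset.sum_filter, Finset.sum_product_right, Finset.mul_sum]
    refine Finset.sum_le_sum fun j _ => ?_
    simp only []
    rw [← Finset.sum_filter, Finset.sum_const, nsmul_eq_mul]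
    gcongr
    have : ((range J).filter fun i => i ≤ j + 1 ∧ j ≤ i + 1) ⊆ Finset.Icc (j - 1) (j + 1) := by
      intro i hi
      have := (Finset.mem_filter.1 hi).2
      rw [Finset.mem_Icc]; omega
    have := Finset.card_le_card this
    rw [Nat.card_Icc] at this
    have h3 : j + 1 + 1 - (j - 1) ≤ 3 := by omega
    exact_mod_cast this.trans h3
  refine le_of_sq_le_sq ?_ (by positivity)
  have n1 : 0 ≤ ∑ j ∈ range J, a j ^ 2 := Finset.sum_nonneg fun j _ => by positivity
  have n2 : 0 ≤ ∑ j ∈ range (J + 1), b j ^ 2 := Finset.sum_nonneg fun j _ => by positivity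
  rw [mul_pow, mul_pow, Real.sq_sqrt n1, Real.sq_sqrt n2]
  refine h.trans ((mul_le_mul ha hb (Finset.sum_nonneg fun j _ => by positivity) (by positivity)).trans (le_of_eq (by ring)))

lemma IsLPCutoff.pair (hφ : IsLPCutoff φ) (J : ℕ) {f g : Zt m k → ℂ} (hf : Integrable f) (hg : Integrable g) :
    ∫ z, cv (kk φ J (fun _ => 1)) f z * g z = ∫ z, ∑ p ∈ nd J, cv (pk φ p.1) f z * cv (pk φ p.2) g z := by
  have cf : ∀ j, Continuous (cv (pk φ j) f) := fun j => cv_cont (hφ.pk_cont j) hf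
  have cg : ∀ j, Continuous (cv (pk φ j) g) := fun j => cv_cont (hφ.pk_cont j) hg
  have i1 : ∀ j, Integrable fun z => cv (pk φ j) f z * g z := fun j => by
    obtain ⟨b, hb0, hb⟩ := bdd_of_cont (cf j)
    exact hg.bdd_mul (c := b) (cf j).aestronglyMeasurable (Filter.Eventually.of_forall hb)
  have i2 : ∀ i j, Integrable fun z => cv (pk φ j) f z * cv (pk φ i) g z := fun i j =>
    cont_integrable ((cf j).mul (cg i))
  rw [integral_finsetSum _ fun p _ => i2 p.2 p.1]
  simp only [hφ.cv_kk J _ hf, one_mul, Finset.sum_mul]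
  rw [integral_finsetSum _ fun j _ => i1 j]
  unfold nd
  rw [Finset.sum_filter, Finset.sum_product]
  refine Finset.sum_congr rfl fun j hj => ?_
  have e1 : ∫ z, cv (pk φ j) f z * g z = ∫ z, cv (kk φ (J + 1) (fun _ => 1)) (cv (pk φ j) f) z * g z := by
    simp only [hφ.proj_low (Finset.mem_range.1 hj) hf]
  rw [e1, cv_dual (hφ.kk_cont _ _) (hφ.kk_even _ _) (cont_integrable (cf j)) hg]
  simp only [hφ.cv_kk (J + 1) _ hg, one_mul, Finset.mul_sum]
  rw [integral_finsetSum _ fun i _ => i2 i j]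
  refine Finset.sum_congr rfl fun i _ => ?_
  split_ifs with h
  · rfl
  · rw [← cv_dual (hφ.pk_cont _) (hφ.pk_even _) (cont_integrable (cf j)) hg]
    simp only [hφ.proj_orth h hf, zero_mul, integral_zero]

lemma IsLPCutoff.lower (hφ : IsLPCutoff φ) {r s : ℝ} (hr : 1 < r) (hs : 1 < s) : ∃ C : ℝ≥0∞, C ≠ ∞ ∧ C ≠ 0 ∧
    ∀ f : Zt m k → ℂ, Integrable f → ∀ J,
      MN r s (fun z => ‖cv (kk φ J (fun _ => 1)) f z‖ₑ) ≤ C * MN r s (sqJ φ J f) := by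
  have hcr : r.HolderConjugate r.conjExponent := Real.HolderConjugate.conjExponent hr
  have hcs : s.HolderConjugate s.conjExponent := Real.HolderConjugate.conjExponent hs
  obtain ⟨C, hC, hC0, h⟩ := hφ.sq_bound hcr.symm.lt hcs.symm.lt
  refine ⟨3 * C, by finiteness, by simp [hC0], fun f hf J => ?_⟩
  have cF : Continuous (cv (kk φ J (fun _ => 1)) f) := cv_cont (hφ.kk_cont _ _) hf
  obtain ⟨g, hgm, hg1, hfin, hg2, -⟩ := dual_fun hcr hcs cF
  set N := MN r s (fun z => ‖cv (kk φ J (fun _ => 1)) f z‖ₑ) with hN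
  have hr1 : 0 < r - 1 := by linarith
  have hgfin : MN r.conjExponent s.conjExponent (fun z => ‖g z‖ₑ) ≠ ∞ :=
    ne_top_of_le_ne_top (ENNReal.rpow_ne_top_of_nonneg hr1.le hfin) hg1
  have hgi : Integrable g := MN_integrable hcr.symm.lt hcs.symm.lt hgm hgfin
  have key : N ^ r ≤ 3 * C * MN r s (sqJ φ J f) * N ^ (r - 1) := by
    rw [hg2, hφ.pair J hf hgi]
    refine (enorm_integral_le_lintegral_enorm _).trans ?_
    have hp : ∀ z, ‖∑ p ∈ nd J, cv (pk φ p.1) f z * cv (pk φ p.2) g z‖ₑ ≤ 3 * (sqJ φ J f z * sqJ φ (J + 1) g z) := by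
      intro z
      unfold sqJ
      rw [← ENNReal.ofReal_mul (Real.sqrt_nonneg _), show (3:ℝ≥0∞) = ENNReal.ofReal 3 by simp, ← ENNReal.ofReal_mul (by norm_num)]
      refine enorm_le_of ((norm_sum_le _ _).trans ?_)
      simp only [norm_mul]
      exact nd_cs J (fun j => ‖cv (pk φ j) f z‖) (fun j => ‖cv (pk φ j) g z‖)
    refine (lintegral_mono hp).trans ?_
    have m1 := hφ.sqJ_meas J hf
    have m2 := hφ.sqJ_meas (J + 1) hgi
    rw [lintegral_const_mul _ (by fun_prop)]
    calc _ ≤ 3 * (MN r s (sqJ φ J f) * MN r.conjExponent s.conjExponent (sqJ φ (J + 1) g)) := by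
          gcongr; exact MN_holder hcr hcs m1 m2
      _ ≤ 3 * (MN r s (sqJ φ J f) * (C * N ^ (r - 1))) := by
          gcongr
          exact (h g hgm hgfin (J + 1)).trans (by gcongr)
      _ = _ := by ring
  by_cases h0 : N = 0
  · rw [h0]; exact zero_le
  have e : N ^ r = N * N ^ (r - 1) := by
    conv_rhs => rw [← ENNReal.rpow_one N, ← ENNReal.rpow_mul, one_mul, ← ENNReal.rpow_add _ _ h0 hfin]
    congr 1; ring
  rw [e] at key
  exact (ENNReal.mul_le_mul_iff_left (by simp [h0, hfin]) (ENNReal.rpow_ne_top_of_nonneg hr1.le hfin)).1 key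

end Lower

set_option linter.unusedSectionVars false
set_option linter.unusedVariables false

section Limit
variable {m k : ℕ} {φ : Eu m k → ℝ}

/-- splitting of the coordinates -/
def spl (m k : ℕ) : C(Zt m k, UnitAddTorus (Fin m ⊕ Fin k)) :=
  ⟨fun z => Sum.elim z.1 z.2, by
    refine continuous_pi fun i => ?_
    rcases i with i | i <;> simp <;> fun_prop⟩

/-- gluing of the coordinates -/
def glu (m k : ℕ) : C(UnitAddTorus (Fin m ⊕ Fin k), Zt m k) :=
  ⟨fun w => (fun i => w (Sum.inl i), fun i => w (Sum.inr i)), by fun_prop⟩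

lemma tp_of_span {h : C(UnitAddTorus (Fin m ⊕ Fin k), ℂ)}
    (hh : h ∈ Submodule.span ℂ (Set.range (UnitAddTorus.mFourier (d := Fin m ⊕ Fin k)))) :
    ∃ B c, ∀ z : Zt m k, h (spl m k z) = tp B c z := by
  classical
  induction hh using Submodule.span_induction with
  | mem x hx =>
    obtain ⟨n, rfl⟩ := hx
    refine ⟨{(fun i => n (Sum.inl i), fun i => n (Sum.inr i))}, fun _ => 1, fun z => ?_⟩
    simp [tp, ch, eChar, UnitAddTorus.mFourier, spl, Fintype.prod_sum_type]
  | zero => exact ⟨∅, 0, fun z => by simp [tp]⟩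
  | add x y hx hy ih1 ih2 =>
    obtain ⟨B, c, h1⟩ := ih1
    obtain ⟨B', c', h2⟩ := ih2
    refine ⟨B ∪ B', fun ξ => (if ξ ∈ B then c ξ else 0) + (if ξ ∈ B' then c' ξ else 0), fun z => ?_⟩
    rw [ContinuousMap.add_apply, h1, h2]
    unfold tp
    simp only [add_mul, Finset.sum_add_distrib, ite_mul, zero_mul]
    rw [← Finset.sum_filter, ← Finset.sum_filter]
    congr 2
    · ext ξ; simp only [mem_filter, mem_union]; tauto
    · ext ξ; simp only [mem_filter, mem_union]; tauto
  | smul a x hx ih =>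
    obtain ⟨B, c, h1⟩ := ih
    refine ⟨B, fun ξ => a * c ξ, fun z => ?_⟩
    rw [ContinuousMap.smul_apply, h1]
    simp [tp, Finset.mul_sum, mul_assoc]

lemma tp_dense_C {F : Zt m k → ℂ} (hF : Continuous F) {δ : ℝ} (hδ : 0 < δ) : ∃ B c, ∀ z, ‖F z - tp B c z‖ ≤ δ := by
  set F' : C(UnitAddTorus (Fin m ⊕ Fin k), ℂ) := (⟨F, hF⟩ : C(Zt m k, ℂ)).comp (glu m k)
  have h : F' ∈ (Submodule.span ℂ (Set.range (UnitAddTorus.mFourier (d := Fin m ⊕ Fin k)))).topologicalClosure := by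
    rw [UnitAddTorus.span_mFourier_closure_eq_top]; trivial
  obtain ⟨h, hh, hd⟩ := Metric.mem_closure_iff.1 h δ hδ
  obtain ⟨B, c, e⟩ := tp_of_span hh
  refine ⟨B, c, fun z => ?_⟩
  rw [← e]
  have h1 : F z = F' (spl m k z) := rfl
  rw [h1, ← dist_eq_norm]
  exact (ContinuousMap.dist_apply_le_dist _).trans hd.le

lemma tp_dense {f : Zt m k → ℂ} (hf : Integrable f) {δ : ℝ} (hδ : 0 < δ) :
    ∃ B c, ∫⁻ z, ‖f z - tp B c z‖ₑ ≤ ENNReal.ofReal δ := by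
  haveI : (volume : Measure (Zt m k)).Regular := Measure.Regular.of_sigmaCompactSpace_of_isLocallyFiniteMeasure _
  obtain ⟨g, -, hg, hgc, -⟩ := hf.exists_hasCompactSupport_lintegral_sub_le (ε := ENNReal.ofReal (δ / 2)) (by simp [hδ])
  obtain ⟨B, c, h⟩ := tp_dense_C hgc (half_pos hδ)
  refine ⟨B, c, ?_⟩
  calc ∫⁻ z, ‖f z - tp B c z‖ₑ ≤ ∫⁻ z, (‖f z - g z‖ₑ + ENNReal.ofReal (δ / 2)) := lintegral_mono fun z => by
        have : f z - tp B c z = (f z - g z) + (g z - tp B c z) := by ring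
        rw [this]
        refine (enorm_add_le _ _).trans ?_
        gcongr
        exact enorm_le_of (h z)
    _ = (∫⁻ z, ‖f z - g z‖ₑ) + ENNReal.ofReal (δ / 2) := by
        rw [lintegral_add_right _ measurable_const]; simp
    _ ≤ ENNReal.ofReal (δ / 2) + ENNReal.ofReal (δ / 2) := by gcongr
    _ = ENNReal.ofReal δ := by rw [← ENNReal.ofReal_add (by positivity) (by positivity)]; ring_nf

lemma young {K : Zt m k → ℂ} (hK : Continuous K) {u : Zt m k → ℂ} (hu : Measurable u) :
    ∫⁻ z, ‖cv K u z‖ₑ ≤ (∫⁻ z, ‖K z‖ₑ) * ∫⁻ z, ‖u z‖ₑ := by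
  calc ∫⁻ z, ‖cv K u z‖ₑ ≤ ∫⁻ z, ∫⁻ w, ‖K (z - w)‖ₑ * ‖u w‖ₑ := lintegral_mono fun z => by
        unfold cv
        refine (enorm_integral_le_lintegral_enorm _).trans (le_of_eq ?_)
        simp only [enorm_mul]
    _ = ∫⁻ w, ∫⁻ z, ‖K (z - w)‖ₑ * ‖u w‖ₑ := by
        refine lintegral_lintegral_swap ?_
        have h1 : Measurable fun p : Zt m k × Zt m k => K (p.1 - p.2) := hK.measurable.comp (measurable_fst.sub measurable_snd)
        exact (h1.enorm.mul (hu.comp measurable_snd).enorm).aemeasurable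
    _ = ∫⁻ w, (∫⁻ z, ‖K z‖ₑ) * ‖u w‖ₑ := by
        refine lintegral_congr fun w => ?_
        rw [lintegral_mul_const _ (show Measurable fun z => ‖K (z - w)‖ₑ from (hK.measurable.comp (measurable_id.sub_const w)).enorm)]
        congr 1
        exact lintegral_sub_right_eq_self (fun z => ‖K z‖ₑ) w
    _ = _ := lintegral_const_mul _ hu.enorm

lemma IsLPCutoff.kk_one (hφ : IsLPCutoff φ) : ∃ A : ℝ≥0∞, A ≠ ∞ ∧ ∀ J, ∫⁻ z, ‖kk φ (J + 1) (fun _ => 1) z‖ₑ ≤ A := by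
  obtain ⟨C, hC0, hC⟩ := ker_size hφ.sc (m + k + 1)
  refine ⟨ENNReal.ofReal C * (ENNReal.ofReal (2 ^ (m + k + 2)) * ENNReal.ofReal (14 ^ (m + k))), by finiteness, fun J => ?_⟩
  have hN : (1:ℝ) ≤ 2 ^ J := one_le_pow₀ (by norm_num)
  have h := weight_le (homSp_prod m k) (N := 2 ^ J) (by positivity) (Φ := fun _ => 1) measurable_const 0
  simp only [zero_sub, norm_neg, mul_one, Wt] at h
  calc _ ≤ ∫⁻ z : Zt m k, ENNReal.ofReal C * ENNReal.ofReal ((2 ^ J) ^ (m + k) * ((1 + 2 ^ J * ‖z‖) ^ (m + k + 1))⁻¹) :=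
        lintegral_mono fun z => by
          rw [← ENNReal.ofReal_mul hC0, hφ.kk_eq, IsLPCutoff.ks_one']
          exact enorm_le_of (hC _ hN z)
    _ = ENNReal.ofReal C * ∫⁻ z : Zt m k, ENNReal.ofReal ((2 ^ J) ^ (m + k) * ((1 + 2 ^ J * ‖z‖) ^ (m + k + 1))⁻¹) :=
        lintegral_const_mul' _ _ ENNReal.ofReal_ne_top
    _ ≤ _ := by
        gcongr
        refine h.trans ?_
        exact mul_le_of_le_one_right' (Mx_one_le (homSp_prod m k) 0)

lemma IsLPCutoff.kk_tp (hφ : IsLPCutoff φ) (B : Finset (Lam m k)) (c : Lam m k → ℂ) : ∃ J0, ∀ J, J0 ≤ J → ∀ z,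
    cv (kk φ (J + 1) (fun _ => 1)) (tp B c) z = tp B c z := by
  classical
  obtain ⟨M, hM⟩ := (B.finite_toSet.image fun ξ => eLen (latCoe ξ)).bddAbove
  obtain ⟨J0, hJ0⟩ := pow_unbounded_of_one_lt M (one_lt_two (α := ℝ))
  refine ⟨J0, fun J hJ z => ?_⟩
  have h1 : ∀ ξ ∈ B, ks φ (J + 1) (fun _ => 1) ξ = 1 := by
    intro ξ hξ
    rw [IsLPCutoff.ks_one, hφ.dil_one, Complex.ofReal_one]
    have : eLen (latCoe ξ) ≤ M := hM ⟨ξ, hξ, rfl⟩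
    exact this.trans (hJ0.le.trans (pow_le_pow_right₀ (by norm_num) hJ))
  have hsub : B ⊆ bx m k (2 ^ (J + 1 + 1)) := fun ξ hξ => hφ.ks_spt (J + 1) (fun _ => 1) ξ (by rw [h1 ξ hξ]; exact one_ne_zero)
  rw [hφ.kk_eq, cv_ker (hφ.ks_spt _ _) (cont_integrable (tp_cont B c)), tp]
  rw [← Finset.sum_subset hsub]
  · refine Finset.sum_congr rfl fun ξ hξ => ?_
    rw [fcoef_tp, if_pos hξ, h1 ξ hξ, one_mul]
  · intro ξ _ hξ
    rw [fcoef_tp, if_neg hξ]; simp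

lemma IsLPCutoff.l1_conv (hφ : IsLPCutoff φ) {f : Zt m k → ℂ} (hf : Measurable f) (hfi : Integrable f) :
    Filter.Tendsto (fun J => ∫⁻ z, ‖cv (kk φ (J + 1) (fun _ => 1)) f z - f z‖ₑ) Filter.atTop (nhds 0) := by
  obtain ⟨A, hA, hk⟩ := hφ.kk_one
  rw [ENNReal.tendsto_nhds_zero]
  intro ε hε
  obtain ⟨δ, hδ, hδε⟩ : ∃ δ : ℝ, 0 < δ ∧ (A + 1) * ENNReal.ofReal δ ≤ ε := by
    by_cases ht : ε = ∞
    · exact ⟨1, one_pos, by rw [ht]; exact le_top⟩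
    refine ⟨(ε / (A + 1)).toReal, ENNReal.toReal_pos ?_ ?_, ?_⟩
    · simp [hA, hε.ne']
    · exact (ENNReal.div_lt_top ht (by simp)).ne
    · rw [ENNReal.ofReal_toReal (ENNReal.div_lt_top ht (by simp)).ne]
      exact ENNReal.mul_div_le
  obtain ⟨B, c, hBc⟩ := tp_dense hfi hδ
  obtain ⟨J0, hJ0⟩ := hφ.kk_tp B c
  filter_upwards [Filter.eventually_ge_atTop J0] with J hJ
  have ht := cont_integrable (tp_cont B c)
  have hu : Measurable fun z => f z - tp B c z := hf.sub (tp_cont B c).measurable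
  have hK := hφ.kk_cont (J + 1) (fun _ => 1)
  have e : ∀ z, cv (kk φ (J + 1) (fun _ => 1)) f z - f z =
      cv (kk φ (J + 1) (fun _ => 1)) (fun z => f z - tp B c z) z - (f z - tp B c z) := by
    intro z
    have := cv_add hK (hfi.sub ht) ht z
    simp only [Pi.sub_apply, sub_add_cancel] at this
    rw [show (fun w => f w) = f from rfl] at this
    rw [this, hJ0 J hJ]; simp only [Pi.sub_def]; ring
  calc _ ≤ ∫⁻ z, (‖cv (kk φ (J + 1) (fun _ => 1)) (fun z => f z - tp B c z) z‖ₑ + ‖f z - tp B c z‖ₑ) :=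
        lintegral_mono fun z => by rw [e]; exact enorm_sub_le
    _ = (∫⁻ z, ‖cv (kk φ (J + 1) (fun _ => 1)) (fun z => f z - tp B c z) z‖ₑ) + ∫⁻ z, ‖f z - tp B c z‖ₑ :=
        lintegral_add_right _ hu.enorm
    _ ≤ A * ENNReal.ofReal δ + ENNReal.ofReal δ := by
        gcongr
        exact (young hK hu).trans (mul_le_mul' (hk J) hBc)
    _ = (A + 1) * ENNReal.ofReal δ := by ring
    _ ≤ ε := hδε

lemma IsLPCutoff.fatou (hφ : IsLPCutoff φ) {r s : ℝ} (hr : 1 < r) (hs : 1 < s) {f : Zt m k → ℂ} (hf : Measurable f)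
    (hfi : Integrable f) {B : ℝ≥0∞} (hB : ∀ J, MN r s (fun z => ‖cv (kk φ J (fun _ => 1)) f z‖ₑ) ≤ B) :
    MN r s (fun z => ‖f z‖ₑ) ≤ B := by
  have hm : ∀ J, Measurable (cv (kk φ J (fun _ => 1)) f) := fun J => measurable_cv (hφ.kk_cont J _) hf
  have h1 : TendstoInMeasure volume (fun J => cv (kk φ (J + 1) (fun _ => 1)) f) Filter.atTop f := by
    refine tendstoInMeasure_of_tendsto_eLpNorm (p := 1) one_ne_zero (fun J => (hm _).aestronglyMeasurable)
      hf.aestronglyMeasurable ?_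
    simp only [eLpNorm_one_eq_lintegral_enorm]
    exact hφ.l1_conv hf hfi
  obtain ⟨ns, -, hns⟩ := h1.exists_seq_tendsto_ae
  refine le_trans (le_of_eq ?_) (MN_liminf (by linarith) (by linarith)
    (u := fun i z => ‖cv (kk φ (ns i + 1) (fun _ => 1)) f z‖ₑ) (fun i => (hm _).enorm) fun i => hB (ns i + 1))
  refine MN_congr_ae (by linarith) (by linarith) ?_
  filter_upwards [hns] with z hz
  exact (hz.enorm.liminf_eq).symm

end Limit

set_option linter.unusedSectionVars false
set_option linter.unusedVariables false

section Final
variable {m k : ℕ} {φ : Eu m k → ℝ}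

lemma mixed_eq {r s : ℝ≥0∞} (hr : r ≠ ∞) (hs : s ≠ ∞) (f : Zt m k → ℂ) :
    mixedNorm r s f = MN r.toReal s.toReal (fun z => ‖f z‖ₑ) := by
  simp only [mixedNorm, eNorm, if_neg hr, if_neg hs]
  rfl

lemma IsLPCutoff.lp_eq (hφ : IsLPCutoff φ) (j : ℕ) {f : Zt m k → ℂ} (hf : Integrable f) (z : Zt m k) :
    lpProj φ j f z = cv (pk φ j) f z := by
  rw [pk, cv_ker (hφ.spt j) hf]
  unfold lpProj
  refine tsum_eq_sum fun ξ hξ => ?_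
  have : (psiCut φ j ξ : ℂ) = 0 := by by_contra h'; exact hξ (hφ.spt j ξ h')
  rw [this]; simp

lemma lpProj_congr (j : ℕ) {f g : Zt m k → ℂ} (h : f =ᵐ[volume] g) (z : Zt m k) : lpProj φ j f z = lpProj φ j g z := by
  unfold lpProj
  refine tsum_congr fun ξ => ?_
  have : fcoef f ξ = fcoef g ξ := integral_congr_ae (h.mono fun z hz => by simp only [hz])
  rw [this]

lemma sq_le_sup (f : Zt m k → ℂ) (z : Zt m k) :
    ENNReal.ofReal (Real.sqrt (∑' j, ‖cv (pk φ j) f z‖ ^ 2)) ≤ ⨆ J, sqJ φ J f z := by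
  by_cases hs : Summable fun j => ‖cv (pk φ j) f z‖ ^ 2
  · have h1 := hs.hasSum.tendsto_sum_nat
    have h2 := (ENNReal.continuous_ofReal.comp Real.continuous_sqrt).tendsto _ |>.comp h1
    exact le_of_tendsto' h2 fun J => le_iSup (fun J => sqJ φ J f z) J
  · rw [tsum_eq_zero_of_not_summable hs]; simp

lemma sqJ_le_of_fin (f : Zt m k → ℂ) (z : Zt m k) (h : (⨆ J, sqJ φ J f z) < ∞) (J : ℕ) :
    sqJ φ J f z ≤ ENNReal.ofReal (Real.sqrt (∑' j, ‖cv (pk φ j) f z‖ ^ 2)) := by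
  have hs : Summable fun j => ‖cv (pk φ j) f z‖ ^ 2 := by
    refine summable_of_sum_range_le (c := (⨆ J, sqJ φ J f z).toReal ^ 2) (fun j => by positivity) fun n => ?_
    have h1 := (ENNReal.ofReal_le_iff_le_toReal h.ne).1 (le_iSup (fun J => sqJ φ J f z) n)
    exact (Real.sqrt_le_left ENNReal.toReal_nonneg).1 h1
  exact ENNReal.ofReal_le_ofReal (Real.sqrt_le_sqrt (hs.sum_le_tsum _ fun j _ => by positivity))

end Final

/-- Littlewood–Paley theorem on mixed Lebesgue spaces over the torus: for
`1 < r, r̃ < ∞` and the smooth dyadic projectors `P_N`, `N ∈ 2^ℕ`, built from an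
admissible cutoff `φ`, there is `C > 1` so that for every
`f ∈ L^r_x L^r̃_y(𝕋^m × 𝕋^k)`,
`C⁻¹ ‖f‖_{L^r_x L^r̃_y} ≤ ‖(∑_N |P_N f|²)^{1/2}‖_{L^r_x L^r̃_y} ≤ C ‖f‖_{L^r_x L^r̃_y}`. -/
theorem littlewood_paley_mixed (m k : ℕ) (r rt : ℝ≥0∞)
    (hr1 : 1 < r) (hr2 : r < ∞) (hrt1 : 1 < rt) (hrt2 : rt < ∞)
    (φ : (Fin m → ℝ) × (Fin k → ℝ) → ℝ) (hφ : IsLPCutoff φ) :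
    ∃ C : ℝ, 1 < C ∧ ∀ f : Torus m × Torus k → ℂ,
      AEStronglyMeasurable f volume → mixedNorm r rt f ≠ ∞ →
        (ENNReal.ofReal C)⁻¹ * mixedNorm r rt f ≤
            mixedNorm r rt
              (fun z => (Real.sqrt (∑' j : ℕ, ‖lpProj φ j f z‖ ^ 2) : ℂ)) ∧
          mixedNorm r rt
              (fun z => (Real.sqrt (∑' j : ℕ, ‖lpProj φ j f z‖ ^ 2) : ℂ)) ≤
            ENNReal.ofReal C * mixedNorm r rt f := by
  have hr : 1 < r.toReal := by
    rw [← ENNReal.toReal_one]; exact ENNReal.toReal_strict_mono hr2.ne hr1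
  have hs : 1 < rt.toReal := by
    rw [← ENNReal.toReal_one]; exact ENNReal.toReal_strict_mono hrt2.ne hrt1
  have hr0 : 0 < r.toReal := by linarith
  have hs0 : 0 < rt.toReal := by linarith
  obtain ⟨C1, hC1, -, hub⟩ := hφ.sq_bound hr hs
  obtain ⟨C2, hC2, -, hlb⟩ := hφ.lower hr hs
  refine ⟨2 + C1.toReal + C2.toReal, by linarith [C1.toReal_nonneg, C2.toReal_nonneg], fun f hf hfin => ?_⟩
  have le1 : C1 ≤ ENNReal.ofReal (2 + C1.toReal + C2.toReal) := by
    rw [ENNReal.le_ofReal_iff_toReal_le hC1 (by positivity)]; linarith [C2.toReal_nonneg]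
  have le2 : C2 ≤ ENNReal.ofReal (2 + C1.toReal + C2.toReal) := by
    rw [ENNReal.le_ofReal_iff_toReal_le hC2 (by positivity)]; linarith [C1.toReal_nonneg]
  rw [mixed_eq hr2.ne hrt2.ne] at hfin
  rw [mixed_eq hr2.ne hrt2.ne, mixed_eq hr2.ne hrt2.ne]
  set g := hf.mk f with hg
  have hgm : Measurable g := hf.stronglyMeasurable_mk.measurable
  have hfg : f =ᵐ[volume] g := hf.ae_eq_mk
  have e1 : MN r.toReal rt.toReal (fun z => ‖f z‖ₑ) = MN r.toReal rt.toReal (fun z => ‖g z‖ₑ) :=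
    MN_congr_ae hr0 hs0 (hfg.mono fun z hz => by rw [hz])
  rw [e1] at hfin ⊢
  have hgi : Integrable g := MN_integrable hr hs hgm hfin
  have e2 : (fun z => ‖(Real.sqrt (∑' j : ℕ, ‖lpProj φ j f z‖ ^ 2) : ℂ)‖ₑ) =
      fun z => ENNReal.ofReal (Real.sqrt (∑' j, ‖cv (pk φ j) g z‖ ^ 2)) := by
    ext z
    simp only [lpProj_congr _ hfg, hφ.lp_eq _ hgi]
    rw [← ofReal_norm, Complex.norm_real, Real.norm_of_nonneg (Real.sqrt_nonneg _)]
  rw [e2]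
  have hsup : MN r.toReal rt.toReal (fun z => ⨆ J, sqJ φ J g z) ≤ C1 * MN r.toReal rt.toReal (fun z => ‖g z‖ₑ) :=
    MN_iSup hr0 hs0 (fun J => hφ.sqJ_meas J hgi) (sqJ_mono g) fun J => hub g hgm hfin J
  have hmeas : Measurable fun z => ⨆ J, sqJ φ J g z := Measurable.iSup fun J => hφ.sqJ_meas J hgi
  have hae : ∀ᵐ z, (⨆ J, sqJ φ J g z) < ∞ := by
    refine ae_lt_top hmeas ?_
    refine ne_top_of_le_ne_top ?_ ((L1_le_MN hr hs hmeas).trans hsup)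
    exact ENNReal.mul_ne_top hC1 hfin
  constructor
  · rw [ENNReal.inv_mul_le_iff (by simp; positivity) ENNReal.ofReal_ne_top]
    refine hφ.fatou hr hs hgm hgi fun J => ?_
    refine (hlb g hgi J).trans (mul_le_mul' le2 (MN_mono_ae hr0 hs0 ?_))
    filter_upwards [hae] with z hz
    exact sqJ_le_of_fin g z hz J
  · refine (MN_mono hr0 hs0 (sq_le_sup g)).trans (hsup.trans (mul_le_mul' le1 le_rfl))

end
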